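/- arXiv:1509.08545 — 2 statements merged into one kernel-verified Lean document; each statement's English description precedes it below -/
import Mathlib

section
/- Let d ≥ 1, R > 0, α ∈ ℝ, let φ : [0,1] → ℝ be smooth, and let S and A be the operators S f_j = i∂_t f_j − 2d f_j + Σ_{k=1}^d cosh((2α/R)((j_k + 1/2)/R + φ δ_{1k})) f_{j+e_k} + Σ_{k=1}^d cosh((2α/R)((j_k − 1/2)/R + φ δ_{1k})) f_{j−e_k} and A f_j = −2iα (j₁/R + φ) φ' f_j − Σ_{k=1}^d sinh((2α/R)((j_k + 1/2)/R + φ δ_{1k})) f_{j+e_k} + Σ_{k=1}^d sinh((2α/R)((j_k − 1/2)/R + φ δ_{1k})) f_{j−e_k}. Then for every f ∈ C₀¹([0,1], ℓ²(ℤ^d)) with compact support in time contained in (0,1), the space–time inner product ⟨[S,A]f, f⟩ equals 4 sinh(2α/R²) ∫₀¹ Σ_{j∈ℤ^d} Σ_{k=1}^d sinh²((2α/R)(j_k/R + φ δ_{1k})) |f_j|² dt + 4 sinh(2α/R²) ∫₀¹ Σ_{j∈ℤ^d} Σ_{k=1}^d |(f_{j+e_k} − f_{j−e_k})/2|² dt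 + 2α ∫₀¹ Σ_{j∈ℤ^d} [(j₁/R + φ)φ'' + (φ')²] |f_j|² dt + (8α/R) ∫₀¹ Σ_{j∈ℤ^d} φ' cosh((2α/R)((j₁ + 1/2)/R + φ)) Im(f_{j+e₁} \overline{f_j}) dt. -/
/-- The symmetric part `S` of the conjugated operator (dimension `d+1`):
`S F_j = i ∂_t F_j - 2(d+1) F_j + Σ_k cosh((2α/R)((j_k+1/2)/R + φ δ_{1k})) F_{j+e_k}
 + Σ_k cosh((2α/R)((j_k-1/2)/R + φ δ_{1k})) F_{j-e_k}`,
where `F'` denotes the time derivative of `F`. -/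
noncomputable def opS {d : ℕ} (α R : ℝ) (φ : ℝ → ℝ)
    (F F' : ℝ → (Fin (d + 1) → ℤ) → ℂ) (t : ℝ) (j : Fin (d + 1) → ℤ) : ℂ :=
  Complex.I * F' t j - 2 * ((d : ℂ) + 1) * F t j +
    (∑ k, (Real.cosh (2 * α / R * (((j k : ℝ) + 1 / 2) / R +
        if (k : ℕ) = 0 then φ t else 0)) : ℂ) * F t (j + Pi.single k 1)) +
    ∑ k, (Real.cosh (2 * α / R * (((j k : ℝ) - 1 / 2) / R +
        if (k : ℕ) = 0 then φ t else 0)) : ℂ) * F t (j - Pi.single k 1)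

/-- The skew-symmetric part `A` of the conjugated operator (dimension `d+1`):
`A F_j = -2iα(j₁/R + φ)φ' F_j - Σ_k sinh((2α/R)((j_k+1/2)/R + φ δ_{1k})) F_{j+e_k}
 + Σ_k sinh((2α/R)((j_k-1/2)/R + φ δ_{1k})) F_{j-e_k}`. -/
noncomputable def opA {d : ℕ} (α R : ℝ) (φ : ℝ → ℝ)
    (F : ℝ → (Fin (d + 1) → ℤ) → ℂ) (t : ℝ) (j : Fin (d + 1) → ℤ) : ℂ :=
  -2 * Complex.I * α * (((j 0 : ℝ) / R + φ t) * deriv φ t) * F t j -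
    (∑ k, (Real.sinh (2 * α / R * (((j k : ℝ) + 1 / 2) / R +
        if (k : ℕ) = 0 then φ t else 0)) : ℂ) * F t (j + Pi.single k 1)) +
    ∑ k, (Real.sinh (2 * α / R * (((j k : ℝ) - 1 / 2) / R +
        if (k : ℕ) = 0 then φ t else 0)) : ℂ) * F t (j - Pi.single k 1)

/-- The nearest-neighbour operator in direction `k` with symmetric `cosh` weights. -/
noncomputable def coshHop {n : ℕ} (θ : Fin n → ℝ → ℝ) (k : Fin n)
    (u : (Fin n → ℤ) → ℂ) (j : Fin n → ℤ) : ℂ :=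
  (Real.cosh (θ k ((j k : ℝ) + 1 / 2)) : ℂ) * u (j + Pi.single k 1) +
    (Real.cosh (θ k ((j k : ℝ) - 1 / 2)) : ℂ) * u (j - Pi.single k 1)

/-- The nearest-neighbour operator in direction `k` with skew-symmetric `sinh` weights. -/
noncomputable def sinhHop {n : ℕ} (θ : Fin n → ℝ → ℝ) (k : Fin n)
    (u : (Fin n → ℤ) → ℂ) (j : Fin n → ℤ) : ℂ :=
  -((Real.sinh (θ k ((j k : ℝ) + 1 / 2)) : ℂ) * u (j + Pi.single k 1)) +
    (Real.sinh (θ k ((j k : ℝ) - 1 / 2)) : ℂ) * u (j - Pi.single k 1)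

/-- The nearest-neighbour operator in direction `k` with skew-symmetric `cosh` weights. -/
noncomputable def skewCoshHop {n : ℕ} (θ : Fin n → ℝ → ℝ) (k : Fin n)
    (u : (Fin n → ℤ) → ℂ) (j : Fin n → ℤ) : ℂ :=
  (Real.cosh (θ k ((j k : ℝ) + 1 / 2)) : ℂ) * u (j + Pi.single k 1) -
    (Real.cosh (θ k ((j k : ℝ) - 1 / 2)) : ℂ) * u (j - Pi.single k 1)

/-- The commutator of `coshHop` and `sinhHop` in direction `k`, for a phase of slope `p`. -/
noncomputable def hopCommutator {n : ℕ} (p : ℝ) (θ : Fin n → ℝ → ℝ) (k : Fin n)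
    (u : (Fin n → ℤ) → ℂ) (j : Fin n → ℤ) : ℂ :=
  (Real.sinh p : ℂ) * ((2 + 4 * (Real.sinh (θ k (j k)) : ℂ) ^ 2) * u j -
    u (j + Pi.single k 1 + Pi.single k 1) - u (j - Pi.single k 1 - Pi.single k 1))

lemma coshHop_sinhHop_comm_of_ne {n : ℕ} (θ : Fin n → ℝ → ℝ) {k l : Fin n} (h : k ≠ l)
    (u : (Fin n → ℤ) → ℂ) (j : Fin n → ℤ) :
    coshHop θ k (sinhHop θ l u) j = sinhHop θ l (coshHop θ k u) j := by
  have e1 : j + Pi.single k 1 + Pi.single l 1 = j + Pi.single l 1 + Pi.single k 1 := by abel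
  have e2 : j + Pi.single k 1 - Pi.single l 1 = j - Pi.single l 1 + Pi.single k 1 := by abel
  have e3 : j - Pi.single k 1 + Pi.single l 1 = j + Pi.single l 1 - Pi.single k 1 := by abel
  have e4 : j - Pi.single k 1 - Pi.single l 1 = j - Pi.single l 1 - Pi.single k 1 := by abel
  simp only [coshHop, sinhHop, Pi.add_apply, Pi.sub_apply, Pi.single_eq_of_ne h,
    Pi.single_eq_of_ne h.symm, add_zero, sub_zero, e1, e2, e3, e4]
  ring

lemma coshHop_sinhHop_self {n : ℕ} {p : ℝ} {θ : Fin n → ℝ → ℝ} {k : Fin n}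
    (hθ : ∀ x y, θ k (x + y) = θ k x + p * y) (u : (Fin n → ℤ) → ℂ) (j : Fin n → ℤ) :
    coshHop θ k (sinhHop θ k u) j - sinhHop θ k (coshHop θ k u) j =
      hopCommutator p θ k u j := by
  set x := θ k (j k) with hx
  have h1 : θ k ((j k : ℝ) + 1 / 2) = x + p / 2 := by rw [hθ]; ring
  have h2 : θ k ((j k : ℝ) - 1 / 2) = x - p / 2 := by rw [sub_eq_add_neg, hθ]; ring
  have h3 : θ k (((j k + 1 : ℤ) : ℝ) + 1 / 2) = (x + p / 2) + p := by
    push_cast; rw [hθ, hθ]; ring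
  have h4 : θ k (((j k - 1 : ℤ) : ℝ) - 1 / 2) = (x - p / 2) - p := by
    push_cast; rw [sub_eq_add_neg, sub_eq_add_neg, hθ, hθ]; ring
  have h5 : θ k (((j k + 1 : ℤ) : ℝ) - 1 / 2) = x + p / 2 := by
    rw [← h1]; push_cast; congr 1; ring
  have h6 : θ k (((j k - 1 : ℤ) : ℝ) + 1 / 2) = x - p / 2 := by
    rw [← h2]; push_cast; congr 1; ring
  have h7 : j + Pi.single k 1 - Pi.single k 1 = j := by abel
  have h8 : j - Pi.single k 1 + Pi.single k 1 = j := by abel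
  have hd : Real.cosh (x + p / 2) * Real.sinh (x + p / 2) -
      Real.cosh (x - p / 2) * Real.sinh (x - p / 2) =
      Real.sinh p * (1 + 2 * Real.sinh x ^ 2) := by
    have hp : Real.sinh p = 2 * Real.sinh (p / 2) * Real.cosh (p / 2) := by
      rw [← Real.sinh_two_mul]; congr 1; ring
    rw [hp, Real.cosh_add, Real.sinh_add, Real.cosh_sub, Real.sinh_sub]
    linear_combination (2 * Real.sinh (p / 2) * Real.cosh (p / 2)) * Real.cosh_sq x
  have ha : Real.sinh (x + p / 2) * Real.cosh (x + p / 2 + p) -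
      Real.cosh (x + p / 2) * Real.sinh (x + p / 2 + p) = -Real.sinh p := by
    rw [Real.cosh_add (x + p / 2) p, Real.sinh_add (x + p / 2) p]
    linear_combination (-Real.sinh p) * Real.cosh_sq (x + p / 2)
  have hb : Real.cosh (x - p / 2) * Real.sinh (x - p / 2 - p) -
      Real.sinh (x - p / 2) * Real.cosh (x - p / 2 - p) = -Real.sinh p := by
    rw [Real.cosh_sub (x - p / 2) p, Real.sinh_sub (x - p / 2) p]
    linear_combination (-Real.sinh p) * Real.cosh_sq (x - p / 2)
  simp only [coshHop, sinhHop, hopCommutator, Pi.add_apply, Pi.sub_apply, Pi.single_eq_same,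
    h1, h2, h3, h4, h5, h6, h7, h8, ← hx]
  have hd' := congrArg Complex.ofReal hd
  have ha' := congrArg Complex.ofReal ha
  have hb' := congrArg Complex.ofReal hb
  simp only [Complex.ofReal_mul, Complex.ofReal_sub, Complex.ofReal_add, Complex.ofReal_pow,
    Complex.ofReal_neg, Complex.ofReal_one, Complex.ofReal_ofNat] at hd' ha' hb'
  linear_combination 2 * u j * hd' + u (j + Pi.single k 1 + Pi.single k 1) * ha' +
    u (j - Pi.single k 1 - Pi.single k 1) * hb'

lemma coshHop_sum {n : ℕ} {ι : Type*} (s : Finset ι) (θ : Fin n → ℝ → ℝ) (k : Fin n)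
    (g : ι → (Fin n → ℤ) → ℂ) (j : Fin n → ℤ) :
    coshHop θ k (fun i => ∑ l ∈ s, g l i) j = ∑ l ∈ s, coshHop θ k (g l) j := by
  simp only [coshHop, Finset.mul_sum, Finset.sum_add_distrib]

lemma sinhHop_sum {n : ℕ} {ι : Type*} (s : Finset ι) (θ : Fin n → ℝ → ℝ) (k : Fin n)
    (g : ι → (Fin n → ℤ) → ℂ) (j : Fin n → ℤ) :
    sinhHop θ k (fun i => ∑ l ∈ s, g l i) j = ∑ l ∈ s, sinhHop θ k (g l) j := by
  simp only [sinhHop, Finset.mul_sum, Finset.sum_add_distrib, Finset.sum_neg_distrib]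

lemma sum_coshHop_sinhHop_comm {n : ℕ} {p : ℝ} {θ : Fin n → ℝ → ℝ}
    (hθ : ∀ k x y, θ k (x + y) = θ k x + p * y) (u : (Fin n → ℤ) → ℂ) (j : Fin n → ℤ) :
    (∑ k, coshHop θ k (fun i => ∑ l, sinhHop θ l u i) j) -
      ∑ l, sinhHop θ l (fun i => ∑ k, coshHop θ k u i) j = ∑ k, hopCommutator p θ k u j := by
  simp only [coshHop_sum, sinhHop_sum]
  rw [Finset.sum_comm (f := fun l k => sinhHop θ l (coshHop θ k u) j),
    ← Finset.sum_sub_distrib]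
  refine Finset.sum_congr rfl fun k _ => ?_
  rw [← Finset.sum_sub_distrib, Finset.sum_eq_single k]
  · exact coshHop_sinhHop_self (hθ k) u j
  · intro l _ hl
    rw [coshHop_sinhHop_comm_of_ne θ hl.symm, sub_self]
  · simp

/-- The phase `(2α/R)(x/R + φ δ_{1k})`. -/
noncomputable def phase {d : ℕ} (α R : ℝ) (φ : ℝ → ℝ) (t : ℝ) (k : Fin (d + 1)) (x : ℝ) : ℝ :=
  2 * α / R * (x / R + if (k : ℕ) = 0 then φ t else 0)

/-- The time derivative of `phase`. -/
noncomputable def phaseVelocity {d : ℕ} (α R : ℝ) (φ : ℝ → ℝ) (t : ℝ) (k : Fin (d + 1)) : ℝ :=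
  2 * α / R * if (k : ℕ) = 0 then deriv φ t else 0

/-- The multiplication coefficient of `opA`. -/
noncomputable def potential {d : ℕ} (α R : ℝ) (φ : ℝ → ℝ) (t : ℝ) (j : Fin (d + 1) → ℤ) : ℂ :=
  -2 * Complex.I * α * (((j 0 : ℝ) / R + φ t) * deriv φ t)

lemma phase_add {d : ℕ} (α R : ℝ) (φ : ℝ → ℝ) (t : ℝ) (k : Fin (d + 1)) (x y : ℝ) :
    phase α R φ t k (x + y) = phase α R φ t k x + 2 * α / R ^ 2 * y := by
  simp only [phase]
  ring

lemma opA_eq {d : ℕ} (α R : ℝ) (φ : ℝ → ℝ) (F : ℝ → (Fin (d + 1) → ℤ) → ℂ) (t : ℝ)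
    (j : Fin (d + 1) → ℤ) :
    opA α R φ F t j =
      potential α R φ t j * F t j + ∑ k, sinhHop (phase α R φ t) k (F t) j := by
  simp only [opA, potential, sinhHop, phase, Finset.sum_add_distrib, Finset.sum_neg_distrib]
  ring

lemma opS_eq {d : ℕ} (α R : ℝ) (φ : ℝ → ℝ) (F F' : ℝ → (Fin (d + 1) → ℤ) → ℂ) (t : ℝ)
    (j : Fin (d + 1) → ℤ) :
    opS α R φ F F' t j = Complex.I * F' t j - 2 * ((d : ℂ) + 1) * F t j +
      ∑ k, coshHop (phase α R φ t) k (F t) j := by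
  simp only [opS, coshHop, phase, Finset.sum_add_distrib]
  ring

lemma hasDerivAt_phase {d : ℕ} (α R : ℝ) {φ : ℝ → ℝ} {t : ℝ} (hφ : DifferentiableAt ℝ φ t)
    (k : Fin (d + 1)) (x : ℝ) :
    HasDerivAt (fun s => phase α R φ s k x) (phaseVelocity α R φ t k) t := by
  unfold phase phaseVelocity
  refine HasDerivAt.const_mul _ (HasDerivAt.const_add _ ?_)
  split_ifs
  · exact hφ.hasDerivAt
  · exact hasDerivAt_const _ _

lemma hasDerivAt_sinhHop_phase {d : ℕ} (α R : ℝ) {φ : ℝ → ℝ} {t : ℝ}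
    (hφ : DifferentiableAt ℝ φ t) {f f' : ℝ → (Fin (d + 1) → ℤ) → ℂ}
    (hf : ∀ j, HasDerivAt (fun s => f s j) (f' t j) t) (k : Fin (d + 1))
    (j : Fin (d + 1) → ℤ) :
    HasDerivAt (fun s => sinhHop (phase α R φ s) k (f s) j)
      (sinhHop (phase α R φ t) k (f' t) j -
        phaseVelocity α R φ t k * skewCoshHop (phase α R φ t) k (f t) j) t := by
  have hs (x : ℝ) := (hasDerivAt_phase α R hφ k x).sinh.ofReal_comp
  have h := (((hs ((j k : ℝ) + 1 / 2)).mul (hf (j + Pi.single k 1))).neg).add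
    ((hs ((j k : ℝ) - 1 / 2)).mul (hf (j - Pi.single k 1)))
  refine h.congr_deriv ?_
  simp only [sinhHop, skewCoshHop, Complex.ofReal_mul]
  ring

lemma hasDerivAt_potential {d : ℕ} (α R : ℝ) {φ : ℝ → ℝ} {t : ℝ}
    (hφ : DifferentiableAt ℝ φ t) (hφ' : DifferentiableAt ℝ (deriv φ) t)
    (j : Fin (d + 1) → ℤ) :
    HasDerivAt (fun s => potential α R φ s j)
      (-2 * Complex.I * α *
        ((((j 0 : ℝ) / R + φ t) * deriv (deriv φ) t + deriv φ t ^ 2 : ℝ) : ℂ)) t := by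
  have h := ((hφ.hasDerivAt.const_add ((j 0 : ℝ) / R)).mul hφ'.hasDerivAt).ofReal_comp.const_mul
    (-2 * Complex.I * α)
  refine (h.congr_deriv ?_).congr_of_eventuallyEq (Filter.Eventually.of_forall fun s => ?_)
  · push_cast; ring
  · simp [potential]

lemma coshHop_potential {d : ℕ} (α R : ℝ) (φ : ℝ → ℝ) (t : ℝ) (k : Fin (d + 1))
    (u : (Fin (d + 1) → ℤ) → ℂ) (j : Fin (d + 1) → ℤ) :
    coshHop (phase α R φ t) k (fun i => potential α R φ t i * u i) j =
      potential α R φ t j * coshHop (phase α R φ t) k u j -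
        Complex.I * phaseVelocity α R φ t k * skewCoshHop (phase α R φ t) k u j := by
  have hp : potential α R φ t (j + Pi.single k 1) =
      potential α R φ t j - Complex.I * phaseVelocity α R φ t k := by
    rcases eq_or_ne k 0 with rfl | hk
    · simp [potential, phaseVelocity]; ring
    · have : (k : ℕ) ≠ 0 := fun h => hk (Fin.ext h)
      simp only [potential, phaseVelocity, Pi.add_apply, Pi.single_eq_of_ne hk.symm,
        if_neg this, add_zero, mul_zero, Complex.ofReal_zero, sub_zero]
  have hm : potential α R φ t (j - Pi.single k 1) =
      potential α R φ t j + Complex.I * phaseVelocity α R φ t k := by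
    rcases eq_or_ne k 0 with rfl | hk
    · simp [potential, phaseVelocity]; ring
    · have : (k : ℕ) ≠ 0 := fun h => hk (Fin.ext h)
      simp only [potential, phaseVelocity, Pi.sub_apply, Pi.single_eq_of_ne hk.symm,
        if_neg this, sub_zero, mul_zero, Complex.ofReal_zero, add_zero]
  simp only [coshHop, skewCoshHop, hp, hm]
  ring

lemma coshHop_add {n : ℕ} (θ : Fin n → ℝ → ℝ) (k : Fin n)
    (u v : (Fin n → ℤ) → ℂ) (j : Fin n → ℤ) :
    coshHop θ k (fun i => u i + v i) j = coshHop θ k u j + coshHop θ k v j := by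
  simp only [coshHop]
  ring

lemma sinhHop_linear_combination {n : ℕ} (θ : Fin n → ℝ → ℝ) (k : Fin n) (a b : ℂ)
    (u v w : (Fin n → ℤ) → ℂ) (j : Fin n → ℤ) :
    sinhHop θ k (fun i => a * u i - b * v i + w i) j =
      a * sinhHop θ k u j - b * sinhHop θ k v j + sinhHop θ k w j := by
  simp only [sinhHop]
  ring

lemma commutator_eq {d : ℕ} (α R : ℝ) {φ : ℝ → ℝ} {t : ℝ}
    (hφ : DifferentiableAt ℝ φ t) (hφ' : DifferentiableAt ℝ (deriv φ) t)
    {f f' : ℝ → (Fin (d + 1) → ℤ) → ℂ} {Af' : ℝ → (Fin (d + 1) → ℤ) → ℂ}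
    (hf : ∀ j, HasDerivAt (fun s => f s j) (f' t j) t) {j : Fin (d + 1) → ℤ}
    (hAf : HasDerivAt (fun s => opA α R φ f s j) (Af' t j) t) :
    opS α R φ (fun s => opA α R φ f s) Af' t j -
        opA α R φ (fun s j' => opS α R φ f f' s j') t j =
      ((2 * α * (((j 0 : ℝ) / R + φ t) * deriv (deriv φ) t + deriv φ t ^ 2) : ℝ) : ℂ) * f t j +
        ∑ k, (hopCommutator (2 * α / R ^ 2) (phase α R φ t) k (f t) j -
          2 * Complex.I * phaseVelocity α R φ t k *
            skewCoshHop (phase α R φ t) k (f t) j) := by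
  have hder := ((hasDerivAt_potential α R hφ hφ' j).mul (hf j)).add
    (HasDerivAt.fun_sum fun k (_ : k ∈ Finset.univ) => hasDerivAt_sinhHop_phase α R hφ hf k j)
  have hval := hAf.unique (hder.congr_of_eventuallyEq
    (Filter.Eventually.of_forall fun s => opA_eq α R φ f s j))
  have hcomm := sum_coshHop_sinhHop_comm (phase_add α R φ t) (f t) j
  have hC (k : Fin (d + 1)) : coshHop (phase α R φ t) k (fun i => opA α R φ f t i) j =
      potential α R φ t j * coshHop (phase α R φ t) k (f t) j -
        Complex.I * phaseVelocity α R φ t k * skewCoshHop (phase α R φ t) k (f t) j +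
        coshHop (phase α R φ t) k (fun i => ∑ l, sinhHop (phase α R φ t) l (f t) i) j := by
    simp only [opA_eq]
    rw [coshHop_add, coshHop_potential]
  have hS (k : Fin (d + 1)) : sinhHop (phase α R φ t) k (fun i => opS α R φ f f' t i) j =
      Complex.I * sinhHop (phase α R φ t) k (f' t) j -
        2 * ((d : ℂ) + 1) * sinhHop (phase α R φ t) k (f t) j +
        sinhHop (phase α R φ t) k (fun i => ∑ l, coshHop (phase α R φ t) l (f t) i) j := by
    simp only [opS_eq]
    rw [sinhHop_linear_combination]
  rw [opS_eq, opA_eq α R φ (fun s j' => opS α R φ f f' s j'), hval, opS_eq, opA_eq]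
  rw [Finset.sum_congr rfl fun k _ => hC k, Finset.sum_congr rfl fun k _ => hS k]
  simp only [Finset.sum_add_distrib, Finset.sum_sub_distrib, ← Finset.mul_sum, ← hcomm, mul_assoc]
  push_cast
  linear_combination (-2 * α * (((j 0 : ℂ) / R + φ t) * (deriv (deriv φ) t : ℝ) +
    (deriv φ t : ℝ) ^ 2) * f t j) * Complex.I_sq

lemma tsum_add_right_eq {G M : Type*} [AddGroup G] [AddCommMonoid M] [TopologicalSpace M]
    (v : G) (g : G → M) : ∑' j, g (j + v) = ∑' j, g j :=
  (Equiv.addRight v).tsum_eq g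

lemma hasSum_skewCoshHop_mul_conj {n : ℕ} (θ : Fin n → ℝ → ℝ) (k : Fin n)
    {u : (Fin n → ℤ) → ℂ} {F : Finset (Fin n → ℤ)} (hu : ∀ j ∉ F, u j = 0) :
    HasSum (fun j => skewCoshHop θ k u j * (starRingEnd ℂ) (u j))
      (2 * Complex.I * ((∑' j : Fin n → ℤ, Real.cosh (θ k ((j k : ℝ) + 1 / 2)) *
        (u (j + Pi.single k 1) * (starRingEnd ℂ) (u j)).im : ℝ) : ℂ)) := by
  have s {g : (Fin n → ℤ) → ℂ} : Summable fun j => g j * (starRingEnd ℂ) (u j) :=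
    summable_of_ne_finset_zero (s := F) fun j hj => by simp [hu j hj]
  have s' {g : (Fin n → ℤ) → ℂ} : Summable fun j => g j * u j :=
    summable_of_ne_finset_zero (s := F) fun j hj => by simp [hu j hj]
  have hshift : ∑' j, (Real.cosh (θ k ((j k : ℝ) - 1 / 2)) : ℂ) * u (j - Pi.single k 1) *
      (starRingEnd ℂ) (u j) =
      ∑' j, (Real.cosh (θ k ((j k : ℝ) + 1 / 2)) : ℂ) * (starRingEnd ℂ) (u (j + Pi.single k 1)) *
        u j := by
    rw [← tsum_add_right_eq (Pi.single k 1)]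
    refine tsum_congr fun j => ?_
    have h : (((j + Pi.single k 1 : Fin n → ℤ) k : ℤ) : ℝ) - 1 / 2 = (j k : ℝ) + 1 / 2 := by
      rw [Pi.add_apply, Pi.single_eq_same]; push_cast; ring
    rw [h, add_sub_cancel_right]
    ring
  refine (s (g := skewCoshHop θ k u)).hasSum_iff.2 ?_
  simp only [skewCoshHop, sub_mul]
  rw [Summable.tsum_sub s s, hshift, ← Summable.tsum_sub s s', Complex.ofReal_tsum, ← tsum_mul_left]
  refine tsum_congr fun j => ?_
  have := Complex.sub_conj (u (j + Pi.single k 1) * (starRingEnd ℂ) (u j))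
  simp only [map_mul, Complex.conj_conj] at this
  rw [Complex.ofReal_mul]
  push_cast at this
  linear_combination (Real.cosh (θ k ((j k : ℝ) + 1 / 2)) : ℂ) * this

lemma hasSum_hopCommutator_mul_conj {n : ℕ} (p : ℝ) (θ : Fin n → ℝ → ℝ) (k : Fin n)
    {u : (Fin n → ℤ) → ℂ} {F : Finset (Fin n → ℤ)} (hu : ∀ j ∉ F, u j = 0) :
    HasSum (fun j => hopCommutator p θ k u j * (starRingEnd ℂ) (u j))
      ((4 * Real.sinh p * (∑' j : Fin n → ℤ, Real.sinh (θ k (j k)) ^ 2 * ‖u j‖ ^ 2) +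
        4 * Real.sinh p * ∑' j : Fin n → ℤ,
          ‖(u (j + Pi.single k 1) - u (j - Pi.single k 1)) / 2‖ ^ 2 : ℝ) : ℂ) := by
  set e : Fin n → ℤ := Pi.single k 1 with he
  have s (g : (Fin n → ℤ) → ℂ) : Summable fun j => g j * (starRingEnd ℂ) (u j) :=
    summable_of_ne_finset_zero (s := F) fun j hj => by simp [hu j hj]
  have hs (g : (Fin n → ℤ) → ℂ) (v : Fin n → ℤ) :
      HasSum (fun j => g (j + v) * (starRingEnd ℂ) (u (j + v)))
        (∑' j, g j * (starRingEnd ℂ) (u j)) :=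
    (Equiv.addRight v).hasSum_iff (f := fun j => g j * (starRingEnd ℂ) (u j)) |>.2 (s g).hasSum
  have hD : HasSum (fun j => ((‖(u (j + e) - u (j - e)) / 2‖ ^ 2 : ℝ) : ℂ))
      (1 / 4 * ((∑' j, u j * (starRingEnd ℂ) (u j)) -
        (∑' j, u (j + e + e) * (starRingEnd ℂ) (u j)) -
        (∑' j, u (j - e - e) * (starRingEnd ℂ) (u j)) +
        ∑' j, u j * (starRingEnd ℂ) (u j))) := by
    have h := ((((hs u e).sub (hs (fun j => u (j + e + e)) (-e))).sub
      (hs (fun j => u (j - e - e)) e)).add (hs u (-e))).mul_left (1 / 4)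
    refine h.congr_fun fun j => ?_
    rw [Complex.ofReal_pow, ← Complex.mul_conj']
    simp only [map_div₀, map_sub, Complex.conj_ofNat, ← sub_eq_add_neg, sub_add_cancel,
      add_sub_cancel_right]
    ring
  have hQ : HasSum (fun j => ((Real.sinh (θ k (j k)) ^ 2 * ‖u j‖ ^ 2 : ℝ) : ℂ))
      ((∑' j : Fin n → ℤ, Real.sinh (θ k (j k)) ^ 2 * ‖u j‖ ^ 2 : ℝ) : ℂ) :=
    Complex.hasSum_ofReal.2 (summable_of_ne_finset_zero (s := F) fun j hj => by
      simp [hu j hj]).hasSum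
  have h := ((((hQ.mul_left 4).add ((s u).hasSum.mul_left 2)).sub
    (s (fun j => u (j + e + e))).hasSum).sub (s (fun j => u (j - e - e))).hasSum).mul_left
    (Real.sinh p : ℂ)
  have h' := h.congr_fun (g := fun j => hopCommutator p θ k u j * (starRingEnd ℂ) (u j)) fun j => by
    simp only [hopCommutator, ← he, Complex.ofReal_mul, Complex.ofReal_pow, ← Complex.mul_conj']
    ring
  refine (congrArg (HasSum _) ?_).mpr h'
  rw [Complex.ofReal_add, Complex.ofReal_mul (4 * Real.sinh p), Complex.ofReal_mul (4 * Real.sinh p),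
    Complex.ofReal_tsum (fun j => ‖(u (j + e) - u (j - e)) / 2‖ ^ 2), hD.tsum_eq]
  push_cast
  ring

lemma hasSum_commutator_mul_conj {d : ℕ} (α R : ℝ) {φ : ℝ → ℝ} {t : ℝ}
    (hφ : DifferentiableAt ℝ φ t) (hφ' : DifferentiableAt ℝ (deriv φ) t)
    {f f' : ℝ → (Fin (d + 1) → ℤ) → ℂ} {Af' : ℝ → (Fin (d + 1) → ℤ) → ℂ}
    (hf : ∀ j, HasDerivAt (fun s => f s j) (f' t j) t)
    (hAf : ∀ j, HasDerivAt (fun s => opA α R φ f s j) (Af' t j) t)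
    {F : Finset (Fin (d + 1) → ℤ)} (hF : ∀ j ∉ F, f t j = 0) :
    HasSum (fun j => (opS α R φ (fun s => opA α R φ f s) Af' t j -
        opA α R φ (fun s j' => opS α R φ f f' s j') t j) * (starRingEnd ℂ) (f t j))
      ((2 * α * (∑' j : Fin (d + 1) → ℤ,
          (((j 0 : ℝ) / R + φ t) * deriv (deriv φ) t + deriv φ t ^ 2) * ‖f t j‖ ^ 2) +
        ∑ k, (4 * Real.sinh (2 * α / R ^ 2) *
            (∑' j : Fin (d + 1) → ℤ, Real.sinh (phase α R φ t k (j k)) ^ 2 * ‖f t j‖ ^ 2) +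
          4 * Real.sinh (2 * α / R ^ 2) * (∑' j : Fin (d + 1) → ℤ,
            ‖(f t (j + Pi.single k 1) - f t (j - Pi.single k 1)) / 2‖ ^ 2) +
          4 * phaseVelocity α R φ t k * (∑' j : Fin (d + 1) → ℤ,
            Real.cosh (phase α R φ t k ((j k : ℝ) + 1 / 2)) *
              (f t (j + Pi.single k 1) * (starRingEnd ℂ) (f t j)).im)) : ℝ) : ℂ) := by
  have h3 : HasSum (fun j => (((((j 0 : ℝ) / R + φ t) * deriv (deriv φ) t + deriv φ t ^ 2) *
      ‖f t j‖ ^ 2 : ℝ) : ℂ)) ((∑' j : Fin (d + 1) → ℤ,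
          (((j 0 : ℝ) / R + φ t) * deriv (deriv φ) t + deriv φ t ^ 2) * ‖f t j‖ ^ 2 : ℝ) : ℂ) :=
    Complex.hasSum_ofReal.2 (summable_of_ne_finset_zero (s := F) fun j hj => by
      simp [hF j hj]).hasSum
  have hk := hasSum_sum fun k (_ : k ∈ Finset.univ) =>
    (hasSum_hopCommutator_mul_conj (2 * α / R ^ 2) (phase α R φ t) k hF).sub
      ((hasSum_skewCoshHop_mul_conj (phase α R φ t) k hF).mul_left
        (2 * Complex.I * phaseVelocity α R φ t k))
  have h := (h3.mul_left (2 * α : ℂ)).add hk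
  refine ((congrArg (HasSum _) ?_).mpr (h.congr_fun fun j => ?_))
  · rw [Complex.ofReal_add, Complex.ofReal_sum, Complex.ofReal_mul (2 * α)]
    congr 1
    · push_cast; ring
    · refine Finset.sum_congr rfl fun k _ => ?_
      rw [Complex.ofReal_add, sub_eq_add_neg, Complex.ofReal_mul (4 * phaseVelocity α R φ t k)]
      congr 1
      push_cast
      linear_combination (4 * phaseVelocity α R φ t k * ∑' j : Fin (d + 1) → ℤ,
        Complex.cosh (phase α R φ t k ((j k : ℝ) + 1 / 2)) *
          ((f t (j + Pi.single k 1) * (starRingEnd ℂ) (f t j)).im : ℂ)) * Complex.I_sq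
  · rw [commutator_eq α R hφ hφ' hf (hAf j), add_mul, Finset.sum_mul]
    congr 1
    · rw [Complex.ofReal_mul (_ + _), Complex.ofReal_pow, ← Complex.mul_conj']
      push_cast
      ring
    · refine Finset.sum_congr rfl fun k _ => ?_
      ring

lemma continuousOn_tsum_of_finset {ι X M : Type*} [TopologicalSpace X] [AddCommMonoid M]
    [TopologicalSpace M] [ContinuousAdd M] {s : Set X} {g : X → ι → M} {G : Finset ι}
    (h0 : ∀ x, ∀ j ∉ G, g x j = 0) (hg : ∀ j, ContinuousOn (fun x => g x j) s) :
    ContinuousOn (fun x => ∑' j, g x j) s := by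
  rw [funext fun x => tsum_eq_sum (h0 x)]
  exact continuousOn_finsetSum _ fun j _ => hg j

lemma exists_finset_forall_neighbor_notMem {n : ℕ} (F : Finset (Fin n → ℤ)) :
    ∃ G : Finset (Fin n → ℤ), ∀ j ∉ G, ∀ k : Fin n,
      j + Pi.single k 1 ∉ F ∧ j - Pi.single k 1 ∉ F := by
  refine ⟨Finset.univ.biUnion fun k : Fin n => F.image (fun j => j - Pi.single k 1) ∪
    F.image fun j => j + Pi.single k 1, fun j hj k => ⟨fun h => hj ?_, fun h => hj ?_⟩⟩ <;>
  simp only [Finset.mem_biUnion, Finset.mem_univ, true_and, Finset.mem_union, Finset.mem_image]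
  · exact ⟨k, Or.inl ⟨_, h, add_sub_cancel_right _ _⟩⟩
  · exact ⟨k, Or.inr ⟨_, h, sub_add_cancel _ _⟩⟩

/-- **The commutator identity.** For `f ∈ C₀¹([0,1], ℓ²(ℤ^d))` (compactly supported in
space and with time support in `(0,1)`), the space–time inner product `⟨[S,A]f, f⟩`,
where `[S,A] = SA - AS` and the `i∂_t` term of `S` acts also on the time-dependent
coefficients of `A` (encoded by `Af'`, the time derivative of `Af`), equals
`4 sinh(2α/R²) ∫ Σ_j Σ_k sinh²((2α/R)(j_k/R + φδ_{1k})) |f_j|²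
 + 4 sinh(2α/R²) ∫ Σ_j Σ_k |(f_{j+e_k} - f_{j-e_k})/2|²
 + 2α ∫ Σ_j [(j₁/R + φ)φ'' + (φ')²] |f_j|²
 + (8α/R) ∫ Σ_j φ' cosh((2α/R)((j₁+1/2)/R + φ)) Im(f_{j+e₁} conj f_j)`. -/
theorem commutator_inner_product_identity (d : ℕ) (R α : ℝ) (hR : 0 < R)
    (φ : ℝ → ℝ) (hφ : ContDiff ℝ (⊤ : ℕ∞) φ)
    (f f' Af' : ℝ → (Fin (d + 1) → ℤ) → ℂ)
    (hf : ∀ j, ∀ t ∈ Set.Icc (0 : ℝ) 1, HasDerivAt (fun s => f s j) (f' t j) t)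
    (hf' : ∀ j, ContinuousOn (fun t => f' t j) (Set.Icc (0 : ℝ) 1))
    (hAf : ∀ j, ∀ t ∈ Set.Icc (0 : ℝ) 1,
      HasDerivAt (fun s => opA α R φ f s j) (Af' t j) t)
    (hsuppt : ∃ a b : ℝ, 0 < a ∧ a ≤ b ∧ b < 1 ∧ ∀ j, ∀ t, t ∉ Set.Icc a b → f t j = 0)
    (hsupps : ∃ F : Finset (Fin (d + 1) → ℤ), ∀ t, ∀ j ∉ F, f t j = 0) :
    (∫ t in (0 : ℝ)..1, ∑' j : Fin (d + 1) → ℤ,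
        (opS α R φ (fun s => opA α R φ f s) Af' t j -
            opA α R φ (fun s j' => opS α R φ f f' s j') t j) * (starRingEnd ℂ) (f t j)) =
      Complex.ofReal
        (4 * Real.sinh (2 * α / R ^ 2) *
            (∫ t in (0 : ℝ)..1, ∑' j : Fin (d + 1) → ℤ, ∑ k,
              Real.sinh (2 * α / R * ((j k : ℝ) / R +
                  if (k : ℕ) = 0 then φ t else 0)) ^ 2 * ‖f t j‖ ^ 2) +
          4 * Real.sinh (2 * α / R ^ 2) *
            (∫ t in (0 : ℝ)..1, ∑' j : Fin (d + 1) → ℤ, ∑ k,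
              ‖(f t (j + Pi.single k 1) - f t (j - Pi.single k 1)) / 2‖ ^ 2) +
          2 * α *
            (∫ t in (0 : ℝ)..1, ∑' j : Fin (d + 1) → ℤ,
              (((j 0 : ℝ) / R + φ t) * deriv (deriv φ) t + deriv φ t ^ 2) *
                ‖f t j‖ ^ 2) +
          8 * α / R *
            (∫ t in (0 : ℝ)..1, ∑' j : Fin (d + 1) → ℤ,
              deriv φ t * Real.cosh (2 * α / R * (((j 0 : ℝ) + 1 / 2) / R + φ t)) *
                (f t (j + Pi.single 0 1) * (starRingEnd ℂ) (f t j)).im)) := by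
  obtain ⟨F, hF⟩ := hsupps
  obtain ⟨G, hG⟩ := exists_finset_forall_neighbor_notMem F
  have hφ1 : ContDiff ℝ (⊤ : ℕ∞) (deriv φ) := (contDiff_infty_iff_deriv.1 hφ).2
  have hφ2 : Continuous (deriv (deriv φ)) := (contDiff_infty_iff_deriv.1 hφ1).2.continuous
  have hφd := hφ.differentiable (by simp)
  have hφd1 := hφ1.differentiable (by simp)
  have hφc := hφ.continuous
  have hφc1 := hφ1.continuous
  have hfc (j) : ContinuousOn (fun t => f t j) (Set.Icc 0 1) := fun t ht =>
    (hf j t ht).continuousAt.continuousWithinAt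
  have hG' (t : ℝ) (j) (hj : j ∉ G) (k) : f t (j + Pi.single k 1) = 0 ∧
      f t (j - Pi.single k 1) = 0 :=
    ⟨hF t _ (hG j hj k).1, hF t _ (hG j hj k).2⟩
  have hphase (k : Fin (d + 1)) (x : ℝ) : Continuous fun t => phase α R φ t k x := by
    unfold phase
    split_ifs <;> fun_prop
  have hpt : ∀ t ∈ Set.uIcc (0 : ℝ) 1, (∑' j : Fin (d + 1) → ℤ,
      (opS α R φ (fun s => opA α R φ f s) Af' t j -
        opA α R φ (fun s j' => opS α R φ f f' s j') t j) * (starRingEnd ℂ) (f t j)) =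
      ((4 * Real.sinh (2 * α / R ^ 2) * (∑' j : Fin (d + 1) → ℤ, ∑ k,
          Real.sinh (phase α R φ t k (j k)) ^ 2 * ‖f t j‖ ^ 2) +
        4 * Real.sinh (2 * α / R ^ 2) * (∑' j : Fin (d + 1) → ℤ, ∑ k,
          ‖(f t (j + Pi.single k 1) - f t (j - Pi.single k 1)) / 2‖ ^ 2) +
        2 * α * (∑' j : Fin (d + 1) → ℤ,
          (((j 0 : ℝ) / R + φ t) * deriv (deriv φ) t + deriv φ t ^ 2) * ‖f t j‖ ^ 2) +
        8 * α / R * (∑' j : Fin (d + 1) → ℤ,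
          deriv φ t * Real.cosh (2 * α / R * (((j 0 : ℝ) + 1 / 2) / R + φ t)) *
            (f t (j + Pi.single 0 1) * (starRingEnd ℂ) (f t j)).im) : ℝ) : ℂ) := by
    intro t ht
    rw [Set.uIcc_of_le zero_le_one] at ht
    rw [(hasSum_commutator_mul_conj α R (hφd t) (hφd1 t) (fun j => hf j t ht)
      (fun j => hAf j t ht) (hF t)).tsum_eq]
    congr 1
    have hv : ∑ k, 4 * phaseVelocity α R φ t k * (∑' j : Fin (d + 1) → ℤ,
        Real.cosh (phase α R φ t k ((j k : ℝ) + 1 / 2)) *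
          (f t (j + Pi.single k 1) * (starRingEnd ℂ) (f t j)).im) =
        8 * α / R * (∑' j : Fin (d + 1) → ℤ,
          deriv φ t * Real.cosh (2 * α / R * (((j 0 : ℝ) + 1 / 2) / R + φ t)) *
            (f t (j + Pi.single 0 1) * (starRingEnd ℂ) (f t j)).im) := by
      rw [Finset.sum_eq_single 0]
      · simp only [phaseVelocity, phase, Fin.val_zero, if_true, mul_assoc (deriv φ t),
          tsum_mul_left]
        ring
      · intro k _ hk
        have : (k : ℕ) ≠ 0 := fun h => hk (Fin.ext h)
        simp [phaseVelocity, this]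
      · simp
    rw [Summable.tsum_finsetSum fun k _ => summable_of_ne_finset_zero (s := F) fun j hj => by
        simp [hF t j hj],
      Summable.tsum_finsetSum fun k _ => summable_of_ne_finset_zero (s := G) fun j hj => by
        simp [hG' t j hj k],
      ← hv, Finset.sum_add_distrib, Finset.sum_add_distrib, Finset.mul_sum, Finset.mul_sum]
    ring
  have hI {g : ℝ → ℝ} (h : ContinuousOn g (Set.Icc 0 1)) :
      IntervalIntegrable g MeasureTheory.volume 0 1 :=
    ContinuousOn.intervalIntegrable_of_Icc zero_le_one h
  have c1 := continuousOn_tsum_of_finset (s := Set.Icc (0 : ℝ) 1) (G := F)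
    (g := fun t j => ∑ k, Real.sinh (phase α R φ t k (j k)) ^ 2 * ‖f t j‖ ^ 2)
    (fun t j hj => by simp [hF t j hj])
    (fun j => continuousOn_finsetSum _ fun k _ =>
      (((Real.continuous_sinh.comp (hphase k _)).pow 2).continuousOn).mul ((hfc j).norm.pow 2))
  have c2 := continuousOn_tsum_of_finset (s := Set.Icc (0 : ℝ) 1) (G := G)
    (g := fun t j => ∑ k, ‖(f t (j + Pi.single k 1) - f t (j - Pi.single k 1)) / 2‖ ^ 2)
    (fun t j hj => by simp [hG' t j hj])
    (fun j => continuousOn_finsetSum _ fun k _ =>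
      (((hfc _).sub (hfc _)).div_const 2).norm.pow 2)
  have c3 := continuousOn_tsum_of_finset (s := Set.Icc (0 : ℝ) 1) (G := F)
    (g := fun t j => (((j 0 : ℝ) / R + φ t) * deriv (deriv φ) t + deriv φ t ^ 2) * ‖f t j‖ ^ 2)
    (fun t j hj => by simp [hF t j hj])
    (fun j => (Continuous.continuousOn (by fun_prop)).mul ((hfc j).norm.pow 2))
  have c4 := continuousOn_tsum_of_finset (s := Set.Icc (0 : ℝ) 1) (G := F)
    (g := fun t j => deriv φ t * Real.cosh (2 * α / R * (((j 0 : ℝ) + 1 / 2) / R + φ t)) *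
      (f t (j + Pi.single 0 1) * (starRingEnd ℂ) (f t j)).im)
    (fun t j hj => by simp [hF t j hj])
    (fun j => (Continuous.continuousOn (by fun_prop)).mul
      (Complex.continuous_im.comp_continuousOn
        ((hfc _).mul (Complex.continuous_conj.comp_continuousOn (hfc j)))))
  rw [intervalIntegral.integral_congr hpt, intervalIntegral.integral_ofReal,
    intervalIntegral.integral_add
      (((hI c1).const_mul _).add ((hI c2).const_mul _) |>.add ((hI c3).const_mul _))
      ((hI c4).const_mul _),
    intervalIntegral.integral_add (((hI c1).const_mul _).add ((hI c2).const_mul _))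
      ((hI c3).const_mul _),
    intervalIntegral.integral_add ((hI c1).const_mul _) ((hI c2).const_mul _)]
  simp only [intervalIntegral.integral_const_mul]
  rfl
end

section
/- Let d ≥ 1 and let u = (u_j)_{j∈ℤ^d} ∈ C¹([0,1], ℓ²(ℤ^d)) satisfy |i∂_t u_j(t) + Δ_d u_j(t)| ≤ |V_j(t) u_j(t)| for all t ∈ [0,1] and j ∈ ℤ^d, where V is a time-dependent bounded potential with ‖V‖_∞ < ∞. Then for every μ > 0 and t ∈ [0,1], there exist constants c₀ = c₀(d) > 0 and c > 0, independent of μ and t, such that Σ_{j∈ℤ^d} e^{2μ c₀ |j| log(|j|+1)} |u_j(t)|² ≤ e^{c‖V‖_∞} Σ_{j∈ℤ^d} e^{2μ |j| log(|j|+1)} (|u_j(0)|² + |u_j(1)|²), provided the right-hand side is finite. -/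
open MeasureTheory
open scoped ENNReal

/-- Euclidean norm of a lattice point of `ℤ^d`. -/
noncomputable def latNorm {d : ℕ} (j : Fin d → ℤ) : ℝ :=
  Real.sqrt (∑ k, ((j k : ℝ)) ^ 2)

/-- Discrete Laplacian on `ℤ^d`:
`Δ_d f j = Σ_{k=1}^d (f (j+e_k) + f (j-e_k) - 2 f j)`. -/
noncomputable def discreteLap {d : ℕ} (f : (Fin d → ℤ) → ℂ) (j : Fin d → ℤ) : ℂ :=
  ∑ k, (f (j + Pi.single k 1) + f (j - Pi.single k 1) - 2 * f j)

section AlmostConvex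

variable {ψ N N' r : ℝ → ℝ} {L : ℝ}

theorem sub_mul_le_of_deriv_ge (hN : ∀ t ∈ Set.Ioo (0 : ℝ) 1, HasDerivAt N (N' t) t)
    (hN' : ∀ t ∈ Set.Ioo (0 : ℝ) 1, -(L ^ 2 / 2) ≤ N' t) {s t : ℝ} (hs : s ∈ Set.Ioo (0 : ℝ) 1)
    (ht : t ∈ Set.Ioo (0 : ℝ) 1) (hst : s ≤ t) : N s - L ^ 2 / 2 * (t - s) ≤ N t := by
  have h := (convex_Ioo (0 : ℝ) 1).mul_sub_le_image_sub_of_le_deriv (f := N) (C := -(L ^ 2 / 2))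
    (fun x hx => (hN x hx).continuousAt.continuousWithinAt)
    (fun x hx => (hN x (interior_subset hx)).differentiableAt.differentiableWithinAt)
    (fun x hx => by
      rw [(hN x (interior_subset hx)).deriv]
      exact hN' x (interior_subset hx)) s hs t ht hst
  linarith

theorem sub_zero_le_of_almost_convex (hψc : ContinuousOn ψ (Set.Icc 0 1))
    (hψ : ∀ t ∈ Set.Ioo (0 : ℝ) 1, HasDerivAt ψ (2 * N t + r t) t)
    (hr : ∀ t ∈ Set.Ioo (0 : ℝ) 1, |r t| ≤ 2 * L)
    (hN : ∀ t ∈ Set.Ioo (0 : ℝ) 1, HasDerivAt N (N' t) t)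
    (hN' : ∀ t ∈ Set.Ioo (0 : ℝ) 1, -(L ^ 2 / 2) ≤ N' t) {t : ℝ} (ht : t ∈ Set.Ioo (0 : ℝ) 1) :
    ψ t - ψ 0 ≤ t * (2 * N t + L ^ 2 * t + 2 * L) := by
  have h := (convex_Icc (0 : ℝ) t).image_sub_le_mul_sub_of_deriv_le (f := ψ)
    (C := 2 * N t + L ^ 2 * t + 2 * L)
    (hψc.mono (Set.Icc_subset_Icc_right ht.2.le))
    (fun x hx => by
      rw [interior_Icc] at hx
      exact (hψ x ⟨hx.1, hx.2.trans ht.2⟩).differentiableAt.differentiableWithinAt)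
    (fun x hx => by
      rw [interior_Icc] at hx
      have hx' : x ∈ Set.Ioo (0 : ℝ) 1 := ⟨hx.1, hx.2.trans ht.2⟩
      rw [(hψ x hx').deriv]
      have h1 := sub_mul_le_of_deriv_ge hN hN' hx' ht hx.2.le
      have h2 := (abs_le.1 (hr x hx')).2
      nlinarith [mul_nonneg (sq_nonneg L) hx'.1.le])
    0 (Set.left_mem_Icc.2 ht.1.le) t (Set.right_mem_Icc.2 ht.1.le) ht.1.le
  linarith

theorem le_one_sub_of_almost_convex (hψc : ContinuousOn ψ (Set.Icc 0 1))
    (hψ : ∀ t ∈ Set.Ioo (0 : ℝ) 1, HasDerivAt ψ (2 * N t + r t) t)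
    (hr : ∀ t ∈ Set.Ioo (0 : ℝ) 1, |r t| ≤ 2 * L)
    (hN : ∀ t ∈ Set.Ioo (0 : ℝ) 1, HasDerivAt N (N' t) t)
    (hN' : ∀ t ∈ Set.Ioo (0 : ℝ) 1, -(L ^ 2 / 2) ≤ N' t) {t : ℝ} (ht : t ∈ Set.Ioo (0 : ℝ) 1) :
    (1 - t) * (2 * N t - L ^ 2 * (1 - t) - 2 * L) ≤ ψ 1 - ψ t := by
  have h := (convex_Icc t 1).mul_sub_le_image_sub_of_le_deriv (f := ψ)
    (C := 2 * N t - L ^ 2 * (1 - t) - 2 * L)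
    (hψc.mono (Set.Icc_subset_Icc_left ht.1.le))
    (fun x hx => by
      rw [interior_Icc] at hx
      exact (hψ x ⟨ht.1.trans hx.1, hx.2⟩).differentiableAt.differentiableWithinAt)
    (fun x hx => by
      rw [interior_Icc] at hx
      have hx' : x ∈ Set.Ioo (0 : ℝ) 1 := ⟨ht.1.trans hx.1, hx.2⟩
      rw [(hψ x hx').deriv]
      have h1 := sub_mul_le_of_deriv_ge hN hN' ht hx' hx.1.le
      have h2 := (abs_le.1 (hr x hx')).1
      nlinarith [mul_nonneg (sq_nonneg L) (sub_nonneg.2 hx'.2.le)])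
    t (Set.left_mem_Icc.2 ht.2.le) 1 (Set.right_mem_Icc.2 ht.2.le) ht.2.le
  linarith

theorem le_of_almost_convex (hL : 0 ≤ L) (hψc : ContinuousOn ψ (Set.Icc 0 1))
    (hψ : ∀ t ∈ Set.Ioo (0 : ℝ) 1, HasDerivAt ψ (2 * N t + r t) t)
    (hr : ∀ t ∈ Set.Ioo (0 : ℝ) 1, |r t| ≤ 2 * L)
    (hN : ∀ t ∈ Set.Ioo (0 : ℝ) 1, HasDerivAt N (N' t) t)
    (hN' : ∀ t ∈ Set.Ioo (0 : ℝ) 1, -(L ^ 2 / 2) ≤ N' t) {t : ℝ} (ht : t ∈ Set.Icc (0 : ℝ) 1) :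
    ψ t ≤ (1 - t) * ψ 0 + t * ψ 1 + (L + L ^ 2) := by
  rcases ht.1.eq_or_lt with rfl | h0
  · nlinarith
  rcases ht.2.eq_or_lt with rfl | h1
  · nlinarith
  have ha := mul_le_mul_of_nonneg_left
    (sub_zero_le_of_almost_convex hψc hψ hr hN hN' ⟨h0, h1⟩) (sub_nonneg.2 h1.le)
  have hb := mul_le_mul_of_nonneg_left
    (le_one_sub_of_almost_convex hψc hψ hr hN hN' ⟨h0, h1⟩) h0.le
  have hq : t * (1 - t) ≤ 1 / 4 := by nlinarith [sq_nonneg (t - 1 / 2)]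
  nlinarith [mul_le_mul_of_nonneg_right hq (by positivity : 0 ≤ L ^ 2 + 4 * L)]

end AlmostConvex

/-- A trajectory of `w' = S w + A w + F`, with `S` symmetric, `A` skew-symmetric, `S` and `A`
commuting, and a perturbation `F` of relative size at most `L`. -/
structure PerturbedFlow {E : Type*} [NormedAddCommGroup E] [InnerProductSpace ℝ E]
    (S A : E →L[ℝ] E) (L : ℝ) (w F : ℝ → E) : Prop where
  nonneg : 0 ≤ L
  symm : ∀ x y, inner ℝ (S x) y = inner ℝ x (S y)
  skew : ∀ x y, inner ℝ (A x) y = -inner ℝ x (A y)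
  comm : ∀ x, S (A x) = A (S x)
  cont : ContinuousOn w (Set.Icc 0 1)
  deriv : ∀ t ∈ Set.Ioo (0 : ℝ) 1, HasDerivAt w (S (w t) + A (w t) + F t) t
  bound : ∀ t ∈ Set.Ioo (0 : ℝ) 1, ‖F t‖ ≤ L * ‖w t‖

namespace PerturbedFlow

variable {E : Type*} [NormedAddCommGroup E] [InnerProductSpace ℝ E]
  {S A : E →L[ℝ] E} {L : ℝ} {w F : ℝ → E}

theorem hasDerivAt_norm_sq (h : PerturbedFlow S A L w F) {t : ℝ} (ht : t ∈ Set.Ioo (0 : ℝ) 1) :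
    HasDerivAt (fun t => ‖w t‖ ^ 2)
      (2 * inner ℝ (S (w t)) (w t) + 2 * inner ℝ (w t) (F t)) t := by
  have hd := (h.deriv t ht).norm_sq
  have hA : inner ℝ (w t) (A (w t)) = 0 := by
    have := h.skew (w t) (w t)
    rw [real_inner_comm] at this
    linarith
  convert! hd using 1
  rw [inner_add_right, inner_add_right, hA, h.symm]
  ring

theorem hasDerivAt_inner (h : PerturbedFlow S A L w F) {t : ℝ} (ht : t ∈ Set.Ioo (0 : ℝ) 1) :
    HasDerivAt (fun t => inner ℝ (S (w t)) (w t))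
      (2 * ‖S (w t)‖ ^ 2 + 2 * inner ℝ (S (w t)) (F t)) t := by
  have hd := ((S.hasFDerivAt.comp_hasDerivAt t (h.deriv t ht))).inner ℝ (h.deriv t ht)
  convert! hd using 1
  have h1 : inner ℝ (S (w t)) (A (w t)) = 0 := by
    have h2 := h.skew (w t) (S (w t))
    have h3 := real_inner_comm (A (w t)) (S (w t))
    rw [← h.comm, ← h.symm (w t) (A (w t))] at h2
    linarith
  rw [h.symm (S (w t) + A (w t) + F t)]
  simp only [Function.comp_apply, inner_add_left, inner_add_right, h1, ← real_inner_self_eq_norm_sq]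
  rw [real_inner_comm (S (w t)) (A (w t)), h1, real_inner_comm (S (w t)) (F t)]
  ring

theorem abs_inner_le (h : PerturbedFlow S A L w F) {t : ℝ} (ht : t ∈ Set.Ioo (0 : ℝ) 1) :
    |inner ℝ (w t) (F t)| ≤ L * ‖w t‖ ^ 2 := by
  refine (abs_real_inner_le_norm _ _).trans ?_
  nlinarith [h.bound t ht, norm_nonneg (w t)]

/-- The frequency function `⟨S w, w⟩ / ‖w‖²`. -/
noncomputable def freq (S : E →L[ℝ] E) (w : ℝ → E) (t : ℝ) : ℝ :=
  inner ℝ (S (w t)) (w t) / ‖w t‖ ^ 2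

theorem exists_hasDerivAt_freq (h : PerturbedFlow S A L w F) {t : ℝ}
    (ht : t ∈ Set.Ioo (0 : ℝ) 1) (hw : w t ≠ 0) :
    ∃ n : ℝ, HasDerivAt (freq S w) n t ∧ -(L ^ 2 / 2) ≤ n ∧
      ‖S (w t)‖ ^ 2 / ‖w t‖ ^ 2 ≤ L ^ 2 + n + 2 * freq S w t ^ 2 + 2 * L * |freq S w t| := by
  have hH : 0 < ‖w t‖ ^ 2 := by positivity
  refine ⟨_, (h.hasDerivAt_inner ht).div (h.hasDerivAt_norm_sq ht) hH.ne', ?_, ?_⟩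
  · rw [le_div_iff₀ (by positivity)]
    have hcs := abs_real_inner_le_norm (S (w t) + (1 / 2 : ℝ) • F t) (w t)
    have hcs2 := sq_le_sq' (neg_le_of_abs_le hcs) (le_of_abs_le hcs)
    have hn : ‖S (w t) + (1 / 2 : ℝ) • F t‖ ^ 2 =
        ‖S (w t)‖ ^ 2 + inner ℝ (S (w t)) (F t) + ‖F t‖ ^ 2 / 4 := by
      rw [norm_add_sq_real, inner_smul_right, norm_smul]
      norm_num
      ring
    rw [mul_pow, hn, inner_add_left, inner_smul_left, real_inner_comm (w t) (F t)] at hcs2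
    have hF : ‖F t‖ ^ 2 ≤ L ^ 2 * ‖w t‖ ^ 2 := by
      rw [← mul_pow]
      exact pow_le_pow_left₀ (norm_nonneg _) (h.bound t ht) 2
    simp only [conj_trivial] at hcs2
    nlinarith [sq_nonneg (inner ℝ (w t) (F t)), mul_le_mul_of_nonneg_left hF hH.le]
  · have hF := h.bound t ht
    have h1 : -(‖S (w t)‖ ^ 2 + L ^ 2 * ‖w t‖ ^ 2) ≤ 2 * inner ℝ (S (w t)) (F t) := by
      have := (abs_le.1 (abs_real_inner_le_norm (S (w t)) (F t))).1
      nlinarith [sq_nonneg (‖S (w t)‖ - ‖F t‖), norm_nonneg (F t), norm_nonneg (w t), h.nonneg]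
    have h2 := abs_le.1 (h.abs_inner_le ht)
    have h3 : |inner ℝ (w t) (F t) / ‖w t‖ ^ 2| ≤ L := by
      rw [abs_div, abs_of_pos hH, div_le_iff₀ hH]
      exact h.abs_inner_le ht
    have key : ((2 * ‖S (w t)‖ ^ 2 + 2 * inner ℝ (S (w t)) (F t)) * ‖w t‖ ^ 2 -
        inner ℝ (S (w t)) (w t) * (2 * inner ℝ (S (w t)) (w t) + 2 * inner ℝ (w t) (F t))) /
        (‖w t‖ ^ 2) ^ 2 = (2 * ‖S (w t)‖ ^ 2 + 2 * inner ℝ (S (w t)) (F t)) / ‖w t‖ ^ 2 -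
        2 * freq S w t ^ 2 - 2 * freq S w t * (inner ℝ (w t) (F t) / ‖w t‖ ^ 2) := by
      unfold freq
      field_simp
      ring
    rw [key]
    have h4 : ‖S (w t)‖ ^ 2 / ‖w t‖ ^ 2 - L ^ 2 ≤
        (2 * ‖S (w t)‖ ^ 2 + 2 * inner ℝ (S (w t)) (F t)) / ‖w t‖ ^ 2 := by
      rw [div_sub' hH.ne']
      gcongr
      linarith
    have h5 : freq S w t * (inner ℝ (w t) (F t) / ‖w t‖ ^ 2) ≤ |freq S w t| * L := by
      refine (le_abs_self _).trans ?_
      rw [abs_mul]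
      gcongr
    linarith

theorem hasDerivAt_log_norm_sq (h : PerturbedFlow S A L w F) {t : ℝ}
    (ht : t ∈ Set.Ioo (0 : ℝ) 1) (hw : w t ≠ 0) :
    HasDerivAt (fun t => Real.log (‖w t‖ ^ 2))
      (2 * freq S w t + 2 * (inner ℝ (w t) (F t) / ‖w t‖ ^ 2)) t := by
  have hH : ‖w t‖ ^ 2 ≠ 0 := by positivity
  convert! (h.hasDerivAt_norm_sq ht).log hH using 1
  unfold freq
  ring

theorem abs_error_le (h : PerturbedFlow S A L w F) {t : ℝ} (ht : t ∈ Set.Ioo (0 : ℝ) 1)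
    (hw : w t ≠ 0) : |2 * (inner ℝ (w t) (F t) / ‖w t‖ ^ 2)| ≤ 2 * L := by
  have hH : 0 < ‖w t‖ ^ 2 := by positivity
  rw [abs_mul, abs_div, abs_of_pos hH, abs_two]
  gcongr
  rw [div_le_iff₀ hH]
  exact h.abs_inner_le ht

theorem continuousOn_log_norm_sq (h : PerturbedFlow S A L w F)
    (hw : ∀ t ∈ Set.Icc (0 : ℝ) 1, w t ≠ 0) :
    ContinuousOn (fun t => Real.log (‖w t‖ ^ 2)) (Set.Icc 0 1) :=
  (h.cont.norm.pow 2).log fun t ht => pow_ne_zero 2 (norm_ne_zero_iff.2 (hw t ht))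

/-- Logarithmic convexity of the norm, up to the size of the perturbation. -/
theorem norm_sq_le (h : PerturbedFlow S A L w F) (hw : ∀ t ∈ Set.Icc (0 : ℝ) 1, w t ≠ 0) {t : ℝ}
    (ht : t ∈ Set.Icc (0 : ℝ) 1) :
    ‖w t‖ ^ 2 ≤ Real.exp (L + L ^ 2) * ((1 - t) * ‖w 0‖ ^ 2 + t * ‖w 1‖ ^ 2) := by
  have hpos : ∀ t ∈ Set.Icc (0 : ℝ) 1, 0 < ‖w t‖ ^ 2 := fun t ht => by
    have := hw t ht
    positivity
  have hsub : ∀ t ∈ Set.Ioo (0 : ℝ) 1, w t ≠ 0 := fun t ht => hw t (Set.Ioo_subset_Icc_self ht)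
  choose! n hn hn' _ using fun t ht => h.exists_hasDerivAt_freq (t := t) ht (hsub t ht)
  have hlog := le_of_almost_convex h.nonneg (h.continuousOn_log_norm_sq hw)
    (fun t ht => h.hasDerivAt_log_norm_sq ht (hsub t ht))
    (fun t ht => h.abs_error_le ht (hsub t ht)) hn hn' ht
  have h0 := hpos 0 (by simp)
  have h1 := hpos 1 (by simp)
  rw [Real.log_le_iff_le_exp (hpos t ht), add_comm, Real.exp_add] at hlog
  refine hlog.trans ?_
  gcongr
  have := convexOn_exp.2 (Set.mem_univ (Real.log (‖w 0‖ ^ 2)))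
    (Set.mem_univ (Real.log (‖w 1‖ ^ 2))) (sub_nonneg.2 ht.2) ht.1 (by ring)
  simpa only [smul_eq_mul, Real.exp_log h0, Real.exp_log h1] using this

/-- Growth of the norm controlled by the norm of the symmetric part. -/
theorem norm_sq_le_exp (h : PerturbedFlow S A L w F) {s t : ℝ} (hs : s ∈ Set.Icc (0 : ℝ) 1)
    (ht : t ∈ Set.Icc (0 : ℝ) 1) :
    ‖w t‖ ^ 2 ≤ Real.exp (2 * ‖S‖ + 2 * L) * ‖w s‖ ^ 2 := by
  set K := 2 * ‖S‖ + 2 * L with hK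
  have hK0 : 0 ≤ K := by have := h.nonneg; positivity
  have hder : ∀ t ∈ Set.Ioo (0 : ℝ) 1,
      |2 * inner ℝ (S (w t)) (w t) + 2 * inner ℝ (w t) (F t)| ≤ K * ‖w t‖ ^ 2 := by
    intro t ht
    have h1 := (abs_real_inner_le_norm (S (w t)) (w t)).trans
      (mul_le_mul_of_nonneg_right (S.le_opNorm (w t)) (norm_nonneg _))
    have h2 := h.abs_inner_le ht
    rw [abs_le] at *
    constructor <;> nlinarith
  have hexp : ∀ c : ℝ, ∀ t ∈ Set.Ioo (0 : ℝ) 1,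
      HasDerivAt (fun t => Real.exp (c * t) * ‖w t‖ ^ 2)
        (Real.exp (c * t) * (c * ‖w t‖ ^ 2 + (2 * inner ℝ (S (w t)) (w t) +
          2 * inner ℝ (w t) (F t)))) t := by
    intro c t ht
    have := (((hasDerivAt_id t).const_mul c).exp).mul (h.hasDerivAt_norm_sq ht)
    convert! this using 1
    simp only [id]
    ring
  have hcont : ∀ c : ℝ, ContinuousOn (fun t => Real.exp (c * t) * ‖w t‖ ^ 2) (Set.Icc 0 1) :=
    fun c => (by fun_prop : Continuous fun t : ℝ => Real.exp (c * t)).continuousOn.mul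
      (h.cont.norm.pow 2)
  rcases le_total s t with hst | hst
  · have hanti : AntitoneOn (fun t => Real.exp (-K * t) * ‖w t‖ ^ 2) (Set.Icc 0 1) := by
      refine antitoneOn_of_deriv_nonpos (convex_Icc 0 1) (hcont _) ?_ ?_ <;>
        rw [interior_Icc] <;> intro x hx
      · exact (hexp _ x hx).differentiableAt.differentiableWithinAt
      · rw [(hexp _ x hx).deriv]
        have := (abs_le.1 (hder x hx)).2
        exact mul_nonpos_of_nonneg_of_nonpos (Real.exp_nonneg _) (by linarith)
    have := hanti hs ht hst
    calc ‖w t‖ ^ 2 = Real.exp (K * t) * (Real.exp (-K * t) * ‖w t‖ ^ 2) := by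
          simp [← mul_assoc, ← Real.exp_add]
      _ ≤ Real.exp (K * t) * (Real.exp (-K * s) * ‖w s‖ ^ 2) := by gcongr
      _ = Real.exp (K * (t - s)) * ‖w s‖ ^ 2 := by
          rw [← mul_assoc, ← Real.exp_add]; ring_nf
      _ ≤ Real.exp K * ‖w s‖ ^ 2 := by
          gcongr
          nlinarith [hs.1, ht.2]
  · have hmono : MonotoneOn (fun t => Real.exp (K * t) * ‖w t‖ ^ 2) (Set.Icc 0 1) := by
      refine monotoneOn_of_deriv_nonneg (convex_Icc 0 1) (hcont _) ?_ ?_ <;>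
        rw [interior_Icc] <;> intro x hx
      · exact (hexp _ x hx).differentiableAt.differentiableWithinAt
      · rw [(hexp _ x hx).deriv]
        have := (abs_le.1 (hder x hx)).1
        exact mul_nonneg (Real.exp_nonneg _) (by linarith)
    have := hmono ht hs hst
    calc ‖w t‖ ^ 2 = Real.exp (-K * t) * (Real.exp (K * t) * ‖w t‖ ^ 2) := by
          simp [← mul_assoc, ← Real.exp_add]
      _ ≤ Real.exp (-K * t) * (Real.exp (K * s) * ‖w s‖ ^ 2) := by gcongr
      _ = Real.exp (K * (s - t)) * ‖w s‖ ^ 2 := by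
          rw [← mul_assoc, ← Real.exp_add]; ring_nf
      _ ≤ Real.exp K * ‖w s‖ ^ 2 := by
          gcongr
          nlinarith [hs.2, ht.1]

/-- At some interior time the symmetric part is bounded by the logarithmic size of the solution. -/
theorem exists_norm_symm_le (h : PerturbedFlow S A L w F)
    (hw : ∀ t ∈ Set.Icc (0 : ℝ) 1, w t ≠ 0) {a b Λ : ℝ} (ha : 0 < a) (hab : a < b) (hb : b < 1)
    (h0 : ∀ t ∈ Set.Icc a b, (Real.log (‖w 0‖ ^ 2) - Real.log (‖w t‖ ^ 2)) / t ≤ Λ)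
    (h1 : ∀ t ∈ Set.Icc a b, (Real.log (‖w 1‖ ^ 2) - Real.log (‖w t‖ ^ 2)) / (1 - t) ≤ Λ) :
    ∃ t ∈ Set.Ioo a b, ‖S (w t)‖ ^ 2 ≤
      (L ^ 2 + 2 * (Λ + L ^ 2 + 2 * L) / (b - a) + 2 * (Λ + L ^ 2 + 2 * L) ^ 2 +
        2 * L * (Λ + L ^ 2 + 2 * L)) * ‖w t‖ ^ 2 := by
  have hsub : ∀ t ∈ Set.Ioo (0 : ℝ) 1, w t ≠ 0 := fun t ht => hw t (Set.Ioo_subset_Icc_self ht)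
  have hL := h.nonneg
  choose! n hn hn' hn'' using fun t ht => h.exists_hasDerivAt_freq (t := t) ht (hsub t ht)
  have hsub' : ∀ t ∈ Set.Icc a b, t ∈ Set.Ioo (0 : ℝ) 1 :=
    fun t ht => ⟨ha.trans_le ht.1, ht.2.trans_lt hb⟩
  have hfreq : ∀ t ∈ Set.Icc a b, |freq S w t| ≤ Λ + L ^ 2 + 2 * L := by
    intro t ht
    have ht' := hsub' t ht
    have hu := sub_zero_le_of_almost_convex (h.continuousOn_log_norm_sq hw)
      (fun t ht => h.hasDerivAt_log_norm_sq ht (hsub t ht))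
      (fun t ht => h.abs_error_le ht (hsub t ht)) hn hn' ht'
    have hl := le_one_sub_of_almost_convex (h.continuousOn_log_norm_sq hw)
      (fun t ht => h.hasDerivAt_log_norm_sq ht (hsub t ht))
      (fun t ht => h.abs_error_le ht (hsub t ht)) hn hn' ht'
    have hu' := (le_div_iff₀' (sub_pos.2 ht'.2)).2 hl
    have hl' : -(2 * freq S w t + L ^ 2 * t + 2 * L) ≤
        (Real.log (‖w 0‖ ^ 2) - Real.log (‖w t‖ ^ 2)) / t := by
      rw [le_div_iff₀' ht'.1]
      linarith
    have e0 := h0 t ht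
    have e1 := h1 t ht
    have e2 : L ^ 2 * t ≤ L ^ 2 := mul_le_of_le_one_right (sq_nonneg L) ht'.2.le
    have e3 : 0 ≤ L ^ 2 * t := mul_nonneg (sq_nonneg L) ht'.1.le
    have hΛ : 0 ≤ Λ + L ^ 2 + 2 * L := by nlinarith
    rw [abs_le]
    constructor <;> nlinarith
  obtain ⟨t, ht, hslope⟩ := exists_hasDerivAt_eq_slope (freq S w) n hab
    (fun t ht => (hn t (hsub' t ht)).continuousAt.continuousWithinAt)
    (fun t ht => hn t (hsub' t (Set.Ioo_subset_Icc_self ht)))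
  refine ⟨t, ht, ?_⟩
  have ht' := hsub' t (Set.Ioo_subset_Icc_self ht)
  have hH : 0 < ‖w t‖ ^ 2 := by
    have := hsub t ht'
    positivity
  rw [← div_le_iff₀ hH]
  refine (hn'' t ht').trans ?_
  have hf := hfreq t (Set.Ioo_subset_Icc_self ht)
  have hfa := abs_le.1 (hfreq a (Set.left_mem_Icc.2 hab.le))
  have hfb := abs_le.1 (hfreq b (Set.right_mem_Icc.2 hab.le))
  have hn1 : n t ≤ 2 * (Λ + L ^ 2 + 2 * L) / (b - a) := by
    rw [hslope]
    have := sub_pos.2 hab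
    gcongr
    linarith
  have hsq : freq S w t ^ 2 ≤ (Λ + L ^ 2 + 2 * L) ^ 2 := sq_le_sq.2 (hf.trans (le_abs_self _))
  have hlin : L * |freq S w t| ≤ L * (Λ + L ^ 2 + 2 * L) := by gcongr
  linarith

end PerturbedFlow

/-- A square-summable trajectory of `∂_t u = i Δ_d u + F` on `[0,1]` with `|F| ≤ L |u|`. -/
structure LatticeFlow {d : ℕ} (u u' : ℝ → (Fin d → ℤ) → ℂ) (L : ℝ) : Prop where
  nonneg : 0 ≤ L
  deriv : ∀ j, ∀ t ∈ Set.Icc (0 : ℝ) 1,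
    HasDerivWithinAt (fun s => u s j) (u' t j) (Set.Icc (0 : ℝ) 1) t
  summable : ∀ t ∈ Set.Icc (0 : ℝ) 1, Summable fun j => ‖u t j‖ ^ 2
  bound : ∀ t ∈ Set.Icc (0 : ℝ) 1, ∀ j,
    ‖u' t j - Complex.I * discreteLap (u t) j‖ ≤ L * ‖u t j‖

/-- A bounded nonnegative weight on `ℤ^d` whose values at neighbours are comparable. -/
structure SlowWeight {d : ℕ} (ω : (Fin d → ℤ) → ℝ) (Γ : ℝ) : Prop where
  nonneg : ∀ j, 0 ≤ ω j
  bounded : ∃ B, ∀ j, ω j ≤ B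
  add : ∀ j k, ω j ≤ Γ * ω (j + Pi.single k 1)
  sub : ∀ j k, ω j ≤ Γ * ω (j - Pi.single k 1)

/-- The weighted energy `Σ_j ω_j |v_j|²`. -/
noncomputable def energy {d : ℕ} (ω : (Fin d → ℤ) → ℝ) (v : (Fin d → ℤ) → ℂ) : ℝ :=
  ∑' j, ω j * ‖v j‖ ^ 2

/-- The growth rate of the energy with a weight of neighbour ratio `Γ`. -/
def growthRate (d : ℕ) (L Γ : ℝ) : ℝ := 2 * L + 6 * d + 2 * d * Γ

theorem slowWeight_one (d : ℕ) : SlowWeight (fun _ : Fin d → ℤ => 1) 1 :=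
  ⟨fun _ => zero_le_one, ⟨1, fun _ => le_rfl⟩, fun _ _ => by simp, fun _ _ => by simp⟩

namespace LatticeFlow

variable {d : ℕ} {u u' : ℝ → (Fin d → ℤ) → ℂ} {L : ℝ} {ω : (Fin d → ℤ) → ℝ} {Γ : ℝ}

theorem norm_deriv_le (h : LatticeFlow u u' L) {t : ℝ} (ht : t ∈ Set.Icc (0 : ℝ) 1)
    (j : Fin d → ℤ) :
    ‖u' t j‖ ≤ (L + 2 * d) * ‖u t j‖ +
      ∑ k, (‖u t (j + Pi.single k 1)‖ + ‖u t (j - Pi.single k 1)‖) := by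
  have h1 : ‖discreteLap (u t) j‖ ≤
      ∑ k, (‖u t (j + Pi.single k 1)‖ + ‖u t (j - Pi.single k 1)‖ + 2 * ‖u t j‖) := by
    refine norm_sum_le_of_le _ fun k _ => (norm_sub_le _ _).trans ?_
    rw [norm_mul, Complex.norm_two]
    gcongr
    exact norm_add_le _ _
  rw [Finset.sum_add_distrib, Finset.sum_const, Finset.card_univ, Fintype.card_fin,
    nsmul_eq_mul] at h1
  have h2 := norm_add_le (u' t j - Complex.I * discreteLap (u t) j)
    (Complex.I * discreteLap (u t) j)
  rw [sub_add_cancel, norm_mul, Complex.norm_I, one_mul] at h2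
  linarith [h.bound t ht j]

theorem summable_energy (h : LatticeFlow u u' L) (hω : SlowWeight ω Γ) {t : ℝ}
    (ht : t ∈ Set.Icc (0 : ℝ) 1) : Summable fun j => ω j * ‖u t j‖ ^ 2 := by
  obtain ⟨B, hB⟩ := hω.bounded
  exact ((h.summable t ht).mul_left B).of_nonneg_of_le
    (fun j => mul_nonneg (hω.nonneg j) (sq_nonneg _)) (fun j => by gcongr; exact hB j)

theorem energy_nonneg (hω : SlowWeight ω Γ) (v : (Fin d → ℤ) → ℂ) : 0 ≤ energy ω v :=
  tsum_nonneg fun j => mul_nonneg (hω.nonneg j) (sq_nonneg _)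

theorem sum_le_energy (h : LatticeFlow u u' L) (hω : SlowWeight ω Γ) {t : ℝ}
    (ht : t ∈ Set.Icc (0 : ℝ) 1) (s : Finset (Fin d → ℤ)) :
    ∑ j ∈ s, ω j * ‖u t j‖ ^ 2 ≤ energy ω (u t) :=
  (h.summable_energy hω ht).sum_le_tsum s fun j _ => mul_nonneg (hω.nonneg j) (sq_nonneg _)

theorem sum_shift_le (h : LatticeFlow u u' L) (hω : SlowWeight ω Γ) {t : ℝ}
    (ht : t ∈ Set.Icc (0 : ℝ) 1) (s : Finset (Fin d → ℤ)) (e : Fin d → ℤ) (hΓ : 0 ≤ Γ)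
    (he : ∀ j, ω j ≤ Γ * ω (j + e)) :
    ∑ j ∈ s, ω j * ‖u t (j + e)‖ ^ 2 ≤ Γ * energy ω (u t) := by
  calc ∑ j ∈ s, ω j * ‖u t (j + e)‖ ^ 2
      ≤ ∑ j ∈ s, Γ * (ω (j + e) * ‖u t (j + e)‖ ^ 2) := by
        refine Finset.sum_le_sum fun j _ => ?_
        rw [← mul_assoc]
        gcongr
        exact he j
    _ = Γ * ∑ j ∈ s.map (Equiv.addRight e).toEmbedding, ω j * ‖u t j‖ ^ 2 := by
        rw [← Finset.mul_sum, Finset.sum_map]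
        rfl
    _ ≤ Γ * energy ω (u t) := by
        gcongr
        exact h.sum_le_energy hω ht _

theorem sum_deriv_le (h : LatticeFlow u u' L) (hω : SlowWeight ω Γ) (hΓ : 0 ≤ Γ) {t : ℝ}
    (ht : t ∈ Set.Icc (0 : ℝ) 1) (s : Finset (Fin d → ℤ)) :
    ∑ j ∈ s, ω j * (2 * (‖u t j‖ * ‖u' t j‖)) ≤ growthRate d L Γ * energy ω (u t) := by
  have hpt : ∀ j ∈ s, ω j * (2 * (‖u t j‖ * ‖u' t j‖)) ≤
      (2 * L + 6 * d) * (ω j * ‖u t j‖ ^ 2) +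
        ∑ k, (ω j * ‖u t (j + Pi.single k 1)‖ ^ 2 + ω j * ‖u t (j + -Pi.single k 1)‖ ^ 2) := by
    intro j _
    have h1 := mul_le_mul_of_nonneg_left (h.norm_deriv_le ht j) (norm_nonneg (u t j))
    have h2 : ‖u t j‖ * ∑ k, (‖u t (j + Pi.single k 1)‖ + ‖u t (j - Pi.single k 1)‖) ≤
        (∑ k, (‖u t (j + Pi.single k 1)‖ ^ 2 + ‖u t (j + -Pi.single k 1)‖ ^ 2)) / 2 +
          d * ‖u t j‖ ^ 2 := by
      have h0 : (d : ℝ) * ‖u t j‖ ^ 2 = ∑ _k : Fin d, ‖u t j‖ ^ 2 := by simp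
      rw [Finset.mul_sum, Finset.sum_div, h0, ← Finset.sum_add_distrib]
      refine Finset.sum_le_sum fun k _ => ?_
      rw [← sub_eq_add_neg]
      nlinarith [sq_nonneg (‖u t j‖ - ‖u t (j + Pi.single k 1)‖),
        sq_nonneg (‖u t j‖ - ‖u t (j - Pi.single k 1)‖)]
    have h3 : 2 * (‖u t j‖ * ‖u' t j‖) ≤ (2 * L + 6 * d) * ‖u t j‖ ^ 2 +
        ∑ k, (‖u t (j + Pi.single k 1)‖ ^ 2 + ‖u t (j + -Pi.single k 1)‖ ^ 2) := by
      nlinarith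
    refine (mul_le_mul_of_nonneg_left h3 (hω.nonneg j)).trans_eq ?_
    simp only [← mul_add, ← Finset.mul_sum]
    ring
  refine (Finset.sum_le_sum hpt).trans ?_
  rw [Finset.sum_add_distrib, ← Finset.mul_sum, Finset.sum_comm]
  have hk : ∀ k ∈ (Finset.univ : Finset (Fin d)), ∑ j ∈ s, (ω j * ‖u t (j + Pi.single k 1)‖ ^ 2 +
      ω j * ‖u t (j + -Pi.single k 1)‖ ^ 2) ≤ 2 * (Γ * energy ω (u t)) := by
    intro k _
    rw [Finset.sum_add_distrib, two_mul]
    refine add_le_add (h.sum_shift_le hω ht s _ hΓ fun j => hω.add j k)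
      (h.sum_shift_le hω ht s _ hΓ fun j => ?_)
    rw [← sub_eq_add_neg]
    exact hω.sub j k
  have h4 := Finset.sum_le_sum hk
  rw [Finset.sum_const, Finset.card_univ, Fintype.card_fin, nsmul_eq_mul] at h4
  have hL := h.nonneg
  have h5 := mul_le_mul_of_nonneg_left (h.sum_le_energy hω ht s)
    (by positivity : 0 ≤ 2 * L + 6 * (d : ℝ))
  unfold growthRate
  linarith

theorem growthRate_nonneg (h : LatticeFlow u u' L) (hΓ : 0 ≤ Γ) : 0 ≤ growthRate d L Γ := by
  have := h.nonneg
  unfold growthRate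
  positivity

theorem energy_le_add (h : LatticeFlow u u' L) (hω : SlowWeight ω Γ) (hΓ : 0 ≤ Γ) {a b M : ℝ}
    (hsub : Set.Icc a b ⊆ Set.Icc 0 1) (hM : ∀ t ∈ Set.Icc a b, energy ω (u t) ≤ M) {s t : ℝ}
    (hs : s ∈ Set.Icc a b) (ht : t ∈ Set.Icc a b) :
    energy ω (u t) ≤ energy ω (u s) + growthRate d L Γ * M * (b - a) := by
  have hab : a ≤ b := hs.1.trans hs.2
  have hC := h.growthRate_nonneg hΓ
  refine Real.tsum_le_of_sum_le (fun j => mul_nonneg (hω.nonneg j) (sq_nonneg _)) fun A => ?_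
  have hd : ∀ x ∈ Set.Icc a b, HasDerivWithinAt (fun t => ∑ j ∈ A, ω j * ‖u t j‖ ^ 2)
      (∑ j ∈ A, ω j * (2 * inner ℝ (u x j) (u' x j))) (Set.Icc a b) x := fun x hx =>
    HasDerivWithinAt.fun_sum fun j _ =>
      (((h.deriv j x (hsub hx)).mono hsub).norm_sq).const_mul (ω j)
  have hb : ∀ x ∈ Set.Icc a b, ‖∑ j ∈ A, ω j * (2 * inner ℝ (u x j) (u' x j))‖ ≤
      growthRate d L Γ * M := by
    intro x hx
    refine (norm_sum_le _ _).trans (le_trans (Finset.sum_le_sum fun j _ => ?_)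
      ((h.sum_deriv_le hω hΓ (hsub hx) A).trans (mul_le_mul_of_nonneg_left (hM x hx) hC)))
    rw [norm_mul, norm_mul, Real.norm_of_nonneg (hω.nonneg j), Real.norm_two]
    have := hω.nonneg j
    gcongr
    exact abs_real_inner_le_norm _ _
  have hmv := (convex_Icc a b).norm_image_sub_le_of_norm_hasDerivWithin_le hd hb hs ht
  have hst : ‖t - s‖ ≤ b - a := by
    rw [Real.norm_eq_abs, abs_le]
    constructor <;> linarith [hs.1, hs.2, ht.1, ht.2]
  have hM0 : 0 ≤ M := (energy_nonneg hω _).trans (hM s hs)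
  have h1 := (le_abs_self _).trans (hmv.trans
    (mul_le_mul_of_nonneg_left hst (mul_nonneg hC hM0)))
  linarith [h.sum_le_energy hω (hsub hs) A]

/-- On short intervals a bounded energy at most doubles. -/
theorem energy_le_two_mul (h : LatticeFlow u u' L) (hω : SlowWeight ω Γ) (hΓ : 0 ≤ Γ)
    {a b : ℝ} (hsub : Set.Icc a b ⊆ Set.Icc 0 1) (hab : growthRate d L Γ * (b - a) ≤ 1 / 2)
    (hbdd : BddAbove ((fun t => energy ω (u t)) '' Set.Icc a b)) {s t : ℝ}
    (hs : s ∈ Set.Icc a b) (ht : t ∈ Set.Icc a b) :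
    energy ω (u t) ≤ 2 * energy ω (u s) := by
  set M := sSup ((fun t => energy ω (u t)) '' Set.Icc a b) with hMdef
  have hM : ∀ t ∈ Set.Icc a b, energy ω (u t) ≤ M :=
    fun t ht => le_csSup hbdd (Set.mem_image_of_mem _ ht)
  have hM0 : 0 ≤ M := (energy_nonneg hω _).trans (hM s hs)
  have hMs : M ≤ energy ω (u s) + M / 2 := by
    refine csSup_le ⟨_, Set.mem_image_of_mem _ hs⟩ ?_
    rintro _ ⟨x, hx, rfl⟩
    have := h.energy_le_add hω hΓ hsub hM hs hx
    nlinarith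
  linarith [hM t ht]

end LatticeFlow

theorem bddAbove_image_of_locally {N : ℝ → ℝ} {K : Set ℝ} (hK : IsCompact K)
    (h : ∀ t ∈ K, ∃ ε > 0, BddAbove (N '' (K ∩ Metric.ball t ε))) : BddAbove (N '' K) := by
  refine hK.induction_on (p := fun s => BddAbove (N '' s)) (by simp)
    (fun s t hst ht => ht.mono (Set.image_mono hst))
    (fun s t hs ht => by rw [Set.image_union]; exact hs.union ht) fun t ht => ?_
  obtain ⟨ε, hε, hb⟩ := h t ht
  exact ⟨K ∩ Metric.ball t ε, Filter.inter_mem self_mem_nhdsWithin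
    (mem_nhdsWithin_of_mem_nhds (Metric.ball_mem_nhds t hε)), hb⟩

/-- A nonnegative lower semicontinuous function on `[0,1]` which at most doubles on every short
interval where it is bounded is bounded. -/
theorem bddAbove_of_le_two_mul {N : ℝ → ℝ} {δ : ℝ} (hδ : 0 < δ)
    (hlsc : ∀ n : ℕ, IsClosed {t | t ∈ Set.Icc (0 : ℝ) 1 ∧ N t ≤ n})
    (hN : ∀ a ∈ Set.Icc (0 : ℝ) 1, ∀ b ∈ Set.Icc (0 : ℝ) 1, |b - a| ≤ δ →
      BddAbove (N '' Set.uIcc a b) → ∀ s ∈ Set.uIcc a b, ∀ t ∈ Set.uIcc a b, N t ≤ 2 * N s) :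
    BddAbove (N '' Set.Icc 0 1) := by
  set Z : Set ℝ := {t | t ∈ Set.Icc (0 : ℝ) 1 ∧
    ∀ ε > 0, ¬BddAbove (N '' (Set.Icc 0 1 ∩ Metric.ball t ε))} with hZ
  have hloc : ∀ t ∈ Set.Icc (0 : ℝ) 1, t ∉ Z →
      ∃ ε > 0, BddAbove (N '' (Set.Icc 0 1 ∩ Metric.ball t ε)) := by
    intro t ht htZ
    by_contra! hcon
    exact htZ ⟨ht, hcon⟩
  rcases Z.eq_empty_or_nonempty with hemp | hne
  · exact bddAbove_image_of_locally isCompact_Icc fun t ht => hloc t ht (by simp [hemp])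
  exfalso
  have hZsub : Z ⊆ Set.Icc 0 1 := fun t ht => ht.1
  have hZc : IsClosed Z := by
    rw [← isOpen_compl_iff, Metric.isOpen_iff]
    intro t ht
    by_cases ht1 : t ∈ Set.Icc (0 : ℝ) 1
    · obtain ⟨ε, hε, hb⟩ := hloc t ht1 ht
      refine ⟨ε / 2, half_pos hε, fun s hs hsZ => hsZ.2 (ε / 2) (half_pos hε) (hb.mono ?_)⟩
      refine Set.image_mono (Set.inter_subset_inter_right _ (Metric.ball_subset_ball' ?_))
      rw [Metric.mem_ball] at hs
      linarith
    · obtain ⟨ε, hε, hb⟩ := Metric.isOpen_iff.1 isClosed_Icc.isOpen_compl t ht1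
      exact ⟨ε, hε, fun s hs hsZ => hb hs hsZ.1⟩
  have hZK : IsCompact Z := isCompact_Icc.of_isClosed_subset hZc hZsub
  have : CompactSpace Z := isCompact_iff_compactSpace.1 hZK
  have : Nonempty Z := hne.to_subtype
  obtain ⟨n, z, hz⟩ := nonempty_interior_of_iUnion_of_closed
    (f := fun n : ℕ => {x : Z | N x ≤ n})
    (fun n => by
      convert (hlsc n).preimage (continuous_subtype_val : Continuous ((↑) : Z → ℝ)) using 1
      ext x
      exact ⟨fun hx => ⟨hZsub x.2, hx⟩, fun hx => hx.2⟩)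
    (by
      ext x
      simpa using exists_nat_ge (N x))
  obtain ⟨ε₀, hε₀, hball⟩ := Metric.isOpen_iff.1 isOpen_interior z hz
  set ε := min ε₀ δ with hε
  have hεpos : 0 < ε := lt_min hε₀ hδ
  have hn : ∀ y ∈ Z, |y - z| < ε → N y ≤ n := fun y hy hyz =>
    (interior_subset (hball (show (⟨y, hy⟩ : Z) ∈ Metric.ball z ε₀ from
      lt_of_lt_of_le hyz (min_le_left _ _))) : (⟨y, hy⟩ : Z) ∈ {x : Z | N x ≤ n})
  refine z.2.2 ε hεpos ⟨2 * n, ?_⟩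
  rintro _ ⟨t, ⟨ht, htz⟩, rfl⟩
  rw [Metric.mem_ball, Real.dist_eq] at htz
  have hzI := hZsub z.2
  have hclosed : IsClosed (Set.uIcc (z : ℝ) t) := isCompact_uIcc.isClosed
  obtain ⟨p, ⟨hpZ, hpz⟩, hpmin⟩ :=
    (hZK.inter_right hclosed).exists_isMinOn ⟨z, z.2, Set.left_mem_uIcc⟩
    (f := fun x => |x - t|) (by fun_prop)
  have hpmin' : ∀ x ∈ Z, x ∈ Set.uIcc (z : ℝ) t → |p - t| ≤ |x - t| :=
    fun x hx hxz => hpmin ⟨hx, hxz⟩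
  have hpI := hZsub hpZ
  have hpt : |p - t| ≤ |(z : ℝ) - t| ∧ |p - z| ≤ |t - z| := by
    rcases Set.mem_uIcc.1 hpz with hpz | hpz <;> grind
  have hNp : N p ≤ n := hn p hpZ (hpt.2.trans_lt htz)
  have hδ' : |t - p| ≤ δ := by
    rw [abs_sub_comm]
    have := abs_sub_comm (z : ℝ) t
    have := min_le_right ε₀ δ
    linarith
  have hin : ∀ x ∈ Set.uIcc p t, x ∈ Set.Icc (0 : ℝ) 1 := fun x hx => by
    rw [Set.mem_uIcc] at hx
    constructor <;> rcases hx with hx | hx <;> linarith [hx.1, hx.2, ht.1, ht.2, hpI.1, hpI.2]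
  have hbig : ∀ y ∈ Set.uIcc p t, y ≠ p → N y ≤ 2 * N t := by
    intro y hy hyp
    have hyt : |t - y| ≤ δ := by
      refine le_trans ?_ hδ'
      rw [Set.mem_uIcc] at hy
      grind
    have hsub : Set.uIcc y t ⊆ Set.uIcc p t := Set.uIcc_subset_uIcc hy Set.right_mem_uIcc
    refine hN y (hin y hy) t ht hyt ?_ t Set.right_mem_uIcc y Set.left_mem_uIcc
    refine bddAbove_image_of_locally isCompact_uIcc fun x hx => ?_
    have hxI := hin x (hsub hx)
    obtain ⟨η, hη, hb⟩ := hloc x hxI fun hxZ => by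
      have h1 := hpmin' x hxZ (Set.uIcc_subset_uIcc hpz Set.right_mem_uIcc (hsub hx))
      rw [Set.mem_uIcc] at hx hy
      grind
    exact ⟨η, hη, hb.mono (Set.image_mono (Set.inter_subset_inter_left _
      fun w hw => hin w (hsub hw)))⟩
  have hfin := hN p hpI t ht hδ' ⟨max (N p) (2 * N t), by
    rintro _ ⟨y, hy, rfl⟩
    by_cases hyp : y = p
    · rw [hyp]; exact le_max_left _ _
    · exact (hbig y hy hyp).trans (le_max_right _ _)⟩ p Set.left_mem_uIcc t Set.right_mem_uIcc
  show N t ≤ 2 * n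
  linarith

namespace LatticeFlow

variable {d : ℕ} {u u' : ℝ → (Fin d → ℤ) → ℂ} {L : ℝ} {ω : (Fin d → ℤ) → ℝ} {Γ : ℝ}

theorem continuousOn_coord (h : LatticeFlow u u' L) (j : Fin d → ℤ) :
    ContinuousOn (fun t => u t j) (Set.Icc 0 1) :=
  fun t ht => (h.deriv j t ht).continuousWithinAt

theorem bddAbove_energy (h : LatticeFlow u u' L) (hω : SlowWeight ω Γ) (hΓ : 0 ≤ Γ) :
    BddAbove ((fun t => energy ω (u t)) '' Set.Icc 0 1) := by
  have hC := h.growthRate_nonneg hΓ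
  refine bddAbove_of_le_two_mul (δ := 1 / (2 * (growthRate d L Γ + 1))) (by positivity)
    (fun n => ?_) fun a ha b hb hab hbdd s hs t ht => ?_
  · have : {t | t ∈ Set.Icc (0 : ℝ) 1 ∧ energy ω (u t) ≤ n} =
        ⋂ A : Finset (Fin d → ℤ), {t | t ∈ Set.Icc (0 : ℝ) 1 ∧ ∑ j ∈ A, ω j * ‖u t j‖ ^ 2 ≤ n} := by
      ext t
      simp only [Set.mem_ofPred_eq, Set.mem_iInter]
      exact ⟨fun ⟨ht, hn⟩ A => ⟨ht, (h.sum_le_energy hω ht A).trans hn⟩, fun hA =>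
        ⟨(hA ∅).1, Real.tsum_le_of_sum_le (fun j => mul_nonneg (hω.nonneg j) (sq_nonneg _))
          fun A => (hA A).2⟩⟩
    rw [this]
    refine isClosed_iInter fun A => ?_
    refine ContinuousOn.preimage_isClosed_of_isClosed (t := Set.Iic (n : ℝ))
      (f := fun t => ∑ j ∈ A, ω j * ‖u t j‖ ^ 2) ?_ isClosed_Icc isClosed_Iic
    exact continuousOn_finsetSum _ fun j _ =>
      ((h.continuousOn_coord j).norm.pow 2).const_smul (ω j)
  · have hsub : Set.uIcc a b ⊆ Set.Icc 0 1 := Set.uIcc_subset_Icc ha hb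
    refine h.energy_le_two_mul hω hΓ hsub ?_ hbdd hs ht
    rw [max_sub_min_eq_abs]
    have h1 := mul_le_mul_of_nonneg_left hab hC
    refine h1.trans ?_
    rw [mul_one_div, div_le_div_iff₀ (by positivity) (by positivity)]
    linarith

/-- The energies at any two times are comparable, with constants depending only on the growth
rate. -/
theorem energy_le_pow_mul (h : LatticeFlow u u' L) (hω : SlowWeight ω Γ) (hΓ : 0 ≤ Γ) {n : ℕ}
    (hn : 2 * growthRate d L Γ ≤ n) (hn0 : 0 < n) {s t : ℝ} (hs : s ∈ Set.Icc (0 : ℝ) 1)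
    (ht : t ∈ Set.Icc (0 : ℝ) 1) : energy ω (u t) ≤ 2 ^ n * energy ω (u s) := by
  have hn' : (0 : ℝ) < n := by exact_mod_cast hn0
  have key : ∀ m : ℕ, m ≤ n →
      energy ω (u (s + m * ((t - s) / n))) ≤ 2 ^ m * energy ω (u s) := by
    intro m
    induction m with
    | zero => simp
    | succ m ih =>
      intro hm
      have hin : ∀ i : ℕ, i ≤ n → s + i * ((t - s) / n) ∈ Set.Icc (0 : ℝ) 1 := by
        intro i hi
        have h1 : (i : ℝ) / n ≤ 1 := (div_le_one hn').2 (by exact_mod_cast hi)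
        have h2 : (0 : ℝ) ≤ i / n := by positivity
        have := (convex_Icc (0 : ℝ) 1) hs ht (sub_nonneg.2 h1) h2 (by ring)
        convert this using 1
        simp only [smul_eq_mul]
        ring
      have hsub := Set.uIcc_subset_Icc (hin m (by omega)) (hin (m + 1) hm)
      have h3 := h.energy_le_two_mul hω hΓ hsub ?_
        ((h.bddAbove_energy hω hΓ).mono (Set.image_mono hsub)) Set.left_mem_uIcc
        Set.right_mem_uIcc
      · rw [pow_succ]
        linarith [ih (by omega)]
      · rw [max_sub_min_eq_abs]
        have h4 : s + ((m + 1 : ℕ) : ℝ) * ((t - s) / n) - (s + m * ((t - s) / n)) =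
            (t - s) / n := by
          push_cast
          ring
        rw [h4, abs_div, abs_of_pos hn']
        have h5 : |t - s| ≤ 1 := abs_le.2 ⟨by linarith [hs.2, ht.1], by linarith [hs.1, ht.2]⟩
        have hC := h.growthRate_nonneg hΓ
        rw [← mul_div_assoc, div_le_iff₀ hn']
        nlinarith [abs_nonneg (t - s)]
  have := key n le_rfl
  rwa [mul_div_cancel₀ _ hn'.ne', add_sub_cancel] at this

end LatticeFlow

/-- The `ℓ¹` norm of a lattice point. -/
noncomputable def oneNorm {d : ℕ} (j : Fin d → ℤ) : ℝ := ∑ k, |(j k : ℝ)|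

theorem oneNorm_nonneg {d : ℕ} (j : Fin d → ℤ) : 0 ≤ oneNorm j :=
  Finset.sum_nonneg fun _ _ => abs_nonneg _

theorem oneNorm_add_le {d : ℕ} (i j : Fin d → ℤ) : oneNorm (i + j) ≤ oneNorm i + oneNorm j := by
  unfold oneNorm
  rw [← Finset.sum_add_distrib]
  exact Finset.sum_le_sum fun k _ => by simpa using abs_add_le (i k : ℝ) (j k)

theorem oneNorm_neg {d : ℕ} (j : Fin d → ℤ) : oneNorm (-j) = oneNorm j := by
  simp [oneNorm]

theorem oneNorm_single {d : ℕ} (k : Fin d) : oneNorm (Pi.single k 1 : Fin d → ℤ) = 1 := by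
  unfold oneNorm
  rw [Finset.sum_eq_single k]
  · simp
  · intro l _ hl
    simp [Pi.single_eq_of_ne hl]
  · simp

theorem abs_le_oneNorm {d : ℕ} (j : Fin d → ℤ) (k : Fin d) : |(j k : ℝ)| ≤ oneNorm j :=
  Finset.single_le_sum (f := fun k => |(j k : ℝ)|) (fun _ _ => abs_nonneg _) (Finset.mem_univ k)

theorem summable_exp_neg_oneNorm (d : ℕ) :
    Summable fun j : Fin d → ℤ => Real.exp (-oneNorm j) := by
  have h1 : Summable fun n : ℤ => Real.exp (-|(n : ℝ)|) := by
    refine Summable.of_nat_of_neg ?_ ?_ <;>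
    · simpa using Real.summable_exp_neg_nat
  refine summable_of_sum_le (c := ∏ _k : Fin d, ∑' n : ℤ, Real.exp (-|(n : ℝ)|))
    (fun _ => (Real.exp_pos _).le) fun A => ?_
  calc ∑ j ∈ A, Real.exp (-oneNorm j)
      ≤ ∑ j ∈ Fintype.piFinset fun k => A.image fun j => j k, Real.exp (-oneNorm j) := by
        refine Finset.sum_le_sum_of_subset_of_nonneg (fun j hj => ?_)
          fun _ _ _ => (Real.exp_pos _).le
        rw [Fintype.mem_piFinset]
        exact fun k => Finset.mem_image_of_mem (fun j : Fin d → ℤ => j k) hj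
    _ = ∏ k, ∑ n ∈ A.image (fun j : Fin d → ℤ => j k), Real.exp (-|((n : ℤ) : ℝ)|) := by
        rw [Finset.prod_univ_sum]
        refine Finset.sum_congr rfl fun j _ => ?_
        rw [oneNorm, ← Finset.sum_neg_distrib, Real.exp_sum]
    _ ≤ _ := Finset.prod_le_prod (fun k _ => Finset.sum_nonneg fun _ _ => (Real.exp_pos _).le)
        fun k _ => h1.sum_le_tsum _ fun _ _ => (Real.exp_pos _).le

theorem slowWeight_exp {d : ℕ} {β R : ℝ} (hβ : 0 ≤ β) :
    SlowWeight (fun j : Fin d → ℤ => Real.exp (β * min (oneNorm j) R)) (Real.exp β) := by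
  have key : ∀ i j : Fin d → ℤ, oneNorm (j - i) = 1 →
      Real.exp (β * min (oneNorm i) R) ≤ Real.exp β * Real.exp (β * min (oneNorm j) R) := by
    intro i j hij
    rw [← Real.exp_add, Real.exp_le_exp]
    have h1 : oneNorm i ≤ oneNorm j + 1 := by
      have := oneNorm_add_le j (-(j - i))
      rw [oneNorm_neg, hij] at this
      simpa using this
    have h2 : min (oneNorm i) R ≤ 1 + min (oneNorm j) R := by grind
    nlinarith
  refine ⟨fun j => (Real.exp_pos _).le, ⟨Real.exp (β * R), fun j => ?_⟩, fun j k => ?_,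
    fun j k => ?_⟩
  · rw [Real.exp_le_exp]
    exact mul_le_mul_of_nonneg_left (min_le_right _ _) hβ
  · exact key _ _ (by rw [add_sub_cancel_left, oneNorm_single])
  · exact key _ _ (by rw [sub_sub_cancel_left, oneNorm_neg, oneNorm_single])

namespace LatticeFlow

variable {d : ℕ} {u u' : ℝ → (Fin d → ℤ) → ℂ} {L : ℝ}

/-- Exponential decay propagates. -/
theorem exists_decay (h : LatticeFlow u u' L) {β : ℝ} (hβ : 0 ≤ β)
    (hs : Summable fun j => Real.exp (β * oneNorm j) * ‖u 0 j‖ ^ 2) :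
    ∃ K, ∀ t ∈ Set.Icc (0 : ℝ) 1, ∀ j, ‖u t j‖ ^ 2 ≤ K * Real.exp (-(β * oneNorm j)) := by
  obtain ⟨n, hn⟩ := exists_nat_gt (2 * growthRate d L (Real.exp β))
  have hC := h.growthRate_nonneg (Real.exp_pos β).le
  have hn0 : 0 < n := by
    rw [← Nat.cast_pos (α := ℝ)]
    linarith
  refine ⟨2 ^ n * ∑' j, Real.exp (β * oneNorm j) * ‖u 0 j‖ ^ 2, fun t ht j => ?_⟩
  have hω : SlowWeight (fun i : Fin d → ℤ => Real.exp (β * min (oneNorm i) (oneNorm j)))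
    (Real.exp β) := slowWeight_exp hβ
  have h0 : (0 : ℝ) ∈ Set.Icc (0 : ℝ) 1 := by simp
  have h1 := h.energy_le_pow_mul hω (Real.exp_pos β).le hn.le hn0 h0 ht
  have h2 := h.sum_le_energy hω ht {j}
  have h3 : energy (fun i : Fin d → ℤ => Real.exp (β * min (oneNorm i) (oneNorm j))) (u 0) ≤
      ∑' j, Real.exp (β * oneNorm j) * ‖u 0 j‖ ^ 2 := by
    refine (h.summable_energy hω h0).tsum_le_tsum (fun i => ?_) hs
    exact mul_le_mul_of_nonneg_right (Real.exp_le_exp.2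
      (mul_le_mul_of_nonneg_left (min_le_left _ _) hβ)) (sq_nonneg _)
  simp only [Finset.sum_singleton, min_self] at h2
  rw [Real.exp_neg, ← div_eq_mul_inv, le_div_iff₀ (Real.exp_pos _), mul_comm]
  exact h2.trans (h1.trans (by gcongr))

/-- A solution vanishing at one time vanishes identically. -/
theorem eq_zero_of_eq_zero (h : LatticeFlow u u' L) {s t : ℝ} (hs : s ∈ Set.Icc (0 : ℝ) 1)
    (ht : t ∈ Set.Icc (0 : ℝ) 1) (h0 : ∀ j, u s j = 0) (j : Fin d → ℤ) : u t j = 0 := by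
  obtain ⟨n, hn⟩ := exists_nat_gt (2 * growthRate d L 1)
  have hC := h.growthRate_nonneg zero_le_one
  have hn0 : 0 < n := by
    rw [← Nat.cast_pos (α := ℝ)]
    linarith
  have h1 := h.energy_le_pow_mul (slowWeight_one d) zero_le_one hn.le hn0 hs ht
  have h2 := h.sum_le_energy (slowWeight_one d) ht {j}
  have h3 : energy (fun _ : Fin d → ℤ => 1) (u s) = 0 := by simp [energy, h0]
  simp only [Finset.sum_singleton, one_mul] at h2
  rw [h3, mul_zero] at h1
  have h4 : ‖u t j‖ ^ 2 = 0 := le_antisymm (h2.trans h1) (sq_nonneg _)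
  simpa using h4

end LatticeFlow

/-- The real Hilbert space `ℓ²(ℤ^d; ℂ)`. -/
abbrev LatticeL2 (d : ℕ) : Type := lp (fun _ : Fin d → ℤ => ℂ) 2

namespace LatticeL2

variable {d : ℕ}

theorem norm_sq_eq (x : LatticeL2 d) : ‖x‖ ^ 2 = ∑' j, ‖x j‖ ^ 2 := by
  have := lp.norm_rpow_eq_tsum (p := 2) (by norm_num) x
  simpa using this

theorem summable_norm_sq (x : LatticeL2 d) : Summable fun j => ‖x j‖ ^ 2 := by
  have := (lp.memℓp x).summable (p := 2) (by norm_num)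
  simpa using this

theorem memlp_iff {f : (Fin d → ℤ) → ℂ} : Memℓp f 2 ↔ Summable fun j => ‖f j‖ ^ 2 := by
  rw [memℓp_gen_iff (by norm_num)]
  simp

/-- Translation by a lattice vector. -/
noncomputable def shift (v : Fin d → ℤ) : LatticeL2 d →L[ℝ] LatticeL2 d :=
  LinearIsometry.toContinuousLinearMap
    { toFun := fun x => ⟨fun j => x (j + v), memlp_iff.2
        ((summable_norm_sq x).comp_injective (add_left_injective v))⟩
      map_add' := fun _ _ => rfl
      map_smul' := fun _ _ => rfl
      norm_map' := fun x => by
        rw [← sq_eq_sq₀ (norm_nonneg _) (norm_nonneg _), norm_sq_eq, norm_sq_eq]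
        exact (Equiv.addRight v).tsum_eq fun j => ‖x j‖ ^ 2 }

/-- Multiplication by `i`. -/
noncomputable def mulI : LatticeL2 d →L[ℝ] LatticeL2 d :=
  LinearIsometry.toContinuousLinearMap
    { toFun := fun x => ⟨fun j => Complex.I * x j, memlp_iff.2
        (by simpa using summable_norm_sq x)⟩
      map_add' := fun x y => by ext j; exact mul_add _ _ _
      map_smul' := fun c x => by ext j; exact mul_smul_comm c Complex.I (x j)
      norm_map' := fun x => by
        rw [← sq_eq_sq₀ (norm_nonneg _) (norm_nonneg _), norm_sq_eq, norm_sq_eq]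
        simp }

@[simp] theorem shift_apply (v : Fin d → ℤ) (x : LatticeL2 d) (j : Fin d → ℤ) :
    shift v x j = x (j + v) := rfl

@[simp] theorem mulI_apply (x : LatticeL2 d) (j : Fin d → ℤ) : mulI x j = Complex.I * x j := rfl

theorem norm_shift_apply (v : Fin d → ℤ) (x : LatticeL2 d) : ‖shift v x‖ = ‖x‖ := by
  rw [← sq_eq_sq₀ (norm_nonneg _) (norm_nonneg _), norm_sq_eq, norm_sq_eq]
  exact (Equiv.addRight v).tsum_eq fun j => ‖x j‖ ^ 2

theorem norm_mulI_apply (x : LatticeL2 d) : ‖mulI x‖ = ‖x‖ := by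
  rw [← sq_eq_sq₀ (norm_nonneg _) (norm_nonneg _), norm_sq_eq, norm_sq_eq]
  simp

theorem inner_shift_left (v : Fin d → ℤ) (x y : LatticeL2 d) :
    inner ℝ (shift v x) y = inner ℝ x (shift (-v) y) := by
  rw [lp.inner_eq_tsum, lp.inner_eq_tsum, ← (Equiv.addRight (-v)).tsum_eq]
  simp

theorem inner_mulI_left (x y : LatticeL2 d) : inner ℝ (mulI x) y = -inner ℝ x (mulI y) := by
  rw [lp.inner_eq_tsum, lp.inner_eq_tsum, ← tsum_neg]
  refine tsum_congr fun j => ?_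
  simp only [mulI_apply, Complex.inner, map_mul, Complex.conj_I]
  simp
  ring

/-- The even part of the shifts in a coordinate direction. -/
noncomputable def shiftSum (k : Fin d) : LatticeL2 d →L[ℝ] LatticeL2 d :=
  shift (Pi.single k 1) + shift (-Pi.single k 1)

/-- The odd part of the shifts in a coordinate direction. -/
noncomputable def shiftDiff (k : Fin d) : LatticeL2 d →L[ℝ] LatticeL2 d :=
  shift (Pi.single k 1) - shift (-Pi.single k 1)

@[simp] theorem shiftSum_apply (k : Fin d) (x : LatticeL2 d) (j : Fin d → ℤ) :
    shiftSum k x j = x (j + Pi.single k 1) + x (j - Pi.single k 1) := by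
  simp [shiftSum, sub_eq_add_neg]

@[simp] theorem shiftDiff_apply (k : Fin d) (x : LatticeL2 d) (j : Fin d → ℤ) :
    shiftDiff k x j = x (j + Pi.single k 1) - x (j - Pi.single k 1) := by
  simp [shiftDiff, sub_eq_add_neg]

theorem inner_shiftSum_left (k : Fin d) (x y : LatticeL2 d) :
    inner ℝ (shiftSum k x) y = inner ℝ x (shiftSum k y) := by
  simp only [shiftSum, add_apply, inner_add_left, inner_add_right,
    inner_shift_left, neg_neg]
  ring

theorem inner_shiftDiff_left (k : Fin d) (x y : LatticeL2 d) :
    inner ℝ (shiftDiff k x) y = -inner ℝ x (shiftDiff k y) := by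
  simp only [shiftDiff, sub_apply, inner_sub_left, inner_sub_right,
    inner_shift_left, neg_neg]
  ring

theorem norm_shiftDiff_apply_le (k : Fin d) (x : LatticeL2 d) : ‖shiftDiff k x‖ ≤ 2 * ‖x‖ := by
  rw [shiftDiff, sub_apply, two_mul]
  refine (norm_sub_le _ _).trans_eq ?_
  rw [norm_shift_apply, norm_shift_apply]

/-- The symmetric part of `i Δ_d` conjugated by `e^{β j_k}`. -/
noncomputable def symmPart (k : Fin d) (β : ℝ) : LatticeL2 d →L[ℝ] LatticeL2 d :=
  (-Real.sinh β) • (mulI ∘L shiftDiff k)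

/-- The skew-symmetric part of `i Δ_d` conjugated by `e^{β j_k}`. -/
noncomputable def skewPart (k : Fin d) (β : ℝ) : LatticeL2 d →L[ℝ] LatticeL2 d :=
  mulI ∘L ((Real.cosh β - 1) • shiftSum k + (∑ l, shiftSum l) -
    (2 * d : ℝ) • ContinuousLinearMap.id ℝ _)

theorem symmPart_apply (k : Fin d) (β : ℝ) (x : LatticeL2 d) :
    symmPart k β x = (-Real.sinh β) • mulI (shiftDiff k x) := rfl

theorem skewPart_apply (k : Fin d) (β : ℝ) (x : LatticeL2 d) :
    skewPart k β x = mulI ((Real.cosh β - 1) • shiftSum k x + (∑ l, shiftSum l x) -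
      (2 * d : ℝ) • x) := by
  simp [skewPart]

theorem mulI_shiftDiff (k : Fin d) (x : LatticeL2 d) :
    shiftDiff k (mulI x) = mulI (shiftDiff k x) := by
  ext j
  simp [mul_sub]

theorem mulI_shiftSum (k : Fin d) (x : LatticeL2 d) :
    shiftSum k (mulI x) = mulI (shiftSum k x) := by
  ext j
  simp [mul_add]

theorem shiftDiff_shiftSum (k l : Fin d) (x : LatticeL2 d) :
    shiftDiff k (shiftSum l x) = shiftSum l (shiftDiff k x) := by
  ext j
  simp only [shiftDiff_apply, shiftSum_apply]
  have h1 : j + Pi.single k 1 + Pi.single l 1 = j + Pi.single l 1 + Pi.single k 1 := by abel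
  have h2 : j + Pi.single k 1 - Pi.single l 1 = j - Pi.single l 1 + Pi.single k 1 := by abel
  have h3 : j - Pi.single k 1 + Pi.single l 1 = j + Pi.single l 1 - Pi.single k 1 := by abel
  have h4 : j - Pi.single k 1 - Pi.single l 1 = j - Pi.single l 1 - Pi.single k 1 := by abel
  rw [h1, h2, h3, h4]
  ring

theorem inner_symmPart_left (k : Fin d) (β : ℝ) (x y : LatticeL2 d) :
    inner ℝ (symmPart k β x) y = inner ℝ x (symmPart k β y) := by
  simp only [symmPart_apply, real_inner_smul_left, real_inner_smul_right, inner_mulI_left,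
    inner_shiftDiff_left, mulI_shiftDiff, neg_neg]

theorem inner_skewPart_left (k : Fin d) (β : ℝ) (x y : LatticeL2 d) :
    inner ℝ (skewPart k β x) y = -inner ℝ x (skewPart k β y) := by
  simp only [skewPart_apply, inner_mulI_left, inner_sub_left, inner_add_left,
    real_inner_smul_left, inner_shiftSum_left, sum_inner, mulI_shiftSum, map_sub, map_add,
    map_smul, map_sum, inner_sub_right, inner_add_right, real_inner_smul_right, inner_sum,
    Finset.sum_neg_distrib]
  ring

theorem symmPart_skewPart (k : Fin d) (β : ℝ) (x : LatticeL2 d) :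
    symmPart k β (skewPart k β x) = skewPart k β (symmPart k β x) := by
  simp only [symmPart_apply, skewPart_apply, mulI_shiftDiff, map_sub, map_add, map_smul, map_sum,
    shiftDiff_shiftSum, mulI_shiftSum, smul_sub, smul_add, Finset.smul_sum,
    smul_comm (Real.cosh β - 1) (-Real.sinh β), smul_comm (2 * d : ℝ) (-Real.sinh β)]

theorem norm_symmPart_le (k : Fin d) (β : ℝ) : ‖symmPart k β‖ ≤ 2 * Real.sinh |β| := by
  have h0 : 0 ≤ Real.sinh |β| := Real.sinh_nonneg_iff.2 (abs_nonneg β)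
  refine ContinuousLinearMap.opNorm_le_bound _ (by positivity) fun x => ?_
  rw [symmPart_apply, norm_smul, norm_neg, norm_mulI_apply, Real.norm_eq_abs, Real.abs_sinh]
  nlinarith [norm_shiftDiff_apply_le k x]

end LatticeL2

namespace LatticeL2

variable {d : ℕ}

theorem summable_sq_of_summable {b : (Fin d → ℤ) → ℝ} (hb : Summable b) (h0 : ∀ j, 0 ≤ b j) :
    Summable fun j => b j ^ 2 := by
  refine (hb.mul_left (∑' j, b j)).of_nonneg_of_le (fun j => sq_nonneg _) fun j => ?_
  rw [sq]
  exact mul_le_mul_of_nonneg_right (hb.le_tsum j fun i _ => h0 i) (h0 j)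

theorem memlp_of_le {f : (Fin d → ℤ) → ℂ} {b : (Fin d → ℤ) → ℝ} (hb : Summable b)
    (hf : ∀ j, ‖f j‖ ≤ b j) : Memℓp f 2 := by
  have h0 : ∀ j, 0 ≤ b j := fun j => (norm_nonneg _).trans (hf j)
  refine memlp_iff.2 ((summable_sq_of_summable hb h0).of_nonneg_of_le (fun j => sq_nonneg _)
    fun j => ?_)
  gcongr
  exact hf j

/-- The element of `ℓ²(ℤ^d)` with given coordinates. -/
noncomputable def ofFun (f : (Fin d → ℤ) → ℂ) : LatticeL2 d :=
  ∑' j, lp.single 2 j (f j)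

theorem ofFun_apply {f : (Fin d → ℤ) → ℂ} (hf : Memℓp f 2) (j : Fin d → ℤ) :
    ofFun f j = f j := by
  have h := lp.hasSum_single (p := 2) (by norm_num) (⟨f, hf⟩ : LatticeL2 d)
  have h2 : ofFun f = ⟨f, hf⟩ := h.tsum_eq
  rw [h2]

theorem norm_single_le (j : Fin d → ℤ) (z : ℂ) :
    ‖(lp.single 2 j z : LatticeL2 d)‖ ≤ ‖z‖ :=
  (lp.norm_single (E := fun _ : Fin d → ℤ => ℂ) (p := 2) (by norm_num) j z).le

theorem continuousOn_ofFun {f : ℝ → (Fin d → ℤ) → ℂ} {b : (Fin d → ℤ) → ℝ} {s : Set ℝ}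
    (hb : Summable b) (hf : ∀ t ∈ s, ∀ j, ‖f t j‖ ≤ b j)
    (hc : ∀ j, ContinuousOn (fun t => f t j) s) : ContinuousOn (fun t => ofFun (f t)) s := by
  refine continuousOn_tsum (fun j => ?_) hb fun j t ht => (norm_single_le j _).trans (hf t ht j)
  exact (lp.isometry_single (E := fun _ : Fin d → ℤ => ℂ) (p := 2) j).continuous.comp_continuousOn
    (hc j)

theorem hasDerivAt_ofFun {f f' : ℝ → (Fin d → ℤ) → ℂ} {b : (Fin d → ℤ) → ℝ} {s : Set ℝ}
    (hs : IsOpen s) (hs' : IsPreconnected s) (hb : Summable b)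
    (hf : ∀ t ∈ s, ∀ j, ‖f t j‖ ≤ b j) (hf' : ∀ t ∈ s, ∀ j, ‖f' t j‖ ≤ b j)
    (hd : ∀ j, ∀ t ∈ s, HasDerivAt (fun t => f t j) (f' t j) t) {t : ℝ} (ht : t ∈ s) :
    HasDerivAt (fun t => ofFun (f t)) (ofFun (f' t)) t := by
  refine hasDerivAt_tsum_of_isPreconnected hb hs hs' (fun j x hx => ?_)
    (fun j x hx => (norm_single_le j _).trans (hf' x hx j)) ht ?_ ht
  · exact (lp.singleContinuousLinearMap ℝ (fun _ : Fin d → ℤ => ℂ) 2 j).hasFDerivAt.comp_hasDerivAt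
      x (hd j x hx)
  · exact Summable.of_norm_bounded hb fun j => (norm_single_le j _).trans (hf t ht j)

/-- Multiplication by `e^{β j_k}`. -/
noncomputable def tilt (k : Fin d) (β : ℝ) (v : (Fin d → ℤ) → ℂ) : LatticeL2 d :=
  ofFun fun j => Real.exp (β * j k) • v j

end LatticeL2

/-- Decay of a trajectory faster than any exponential, uniformly in time. -/
def SuperexpDecay {d : ℕ} (u : ℝ → (Fin d → ℤ) → ℂ) : Prop :=
  ∀ γ : ℝ, ∃ K, ∀ t ∈ Set.Icc (0 : ℝ) 1, ∀ j, ‖u t j‖ ≤ K * Real.exp (-(γ * oneNorm j))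

theorem norm_exp_smul_le {d : ℕ} (k : Fin d) (β : ℝ) {z : ℂ} {K : ℝ} {j : Fin d → ℤ}
    (hz : ‖z‖ ≤ K * Real.exp (-((|β| + 1) * oneNorm j))) :
    ‖Real.exp (β * j k) • z‖ ≤ K * Real.exp (-oneNorm j) := by
  have h1 : β * j k ≤ |β| * oneNorm j := (le_abs_self _).trans (by
    rw [abs_mul]
    exact mul_le_mul_of_nonneg_left (abs_le_oneNorm j k) (abs_nonneg β))
  have hK : 0 ≤ K := by
    have := (norm_nonneg z).trans hz
    exact nonneg_of_mul_nonneg_left this (Real.exp_pos _)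
  rw [norm_smul, Real.norm_of_nonneg (Real.exp_pos _).le]
  calc Real.exp (β * j k) * ‖z‖
      ≤ Real.exp (|β| * oneNorm j) * (K * Real.exp (-((|β| + 1) * oneNorm j))) := by gcongr
    _ = K * Real.exp (-oneNorm j) := by
      rw [mul_left_comm, ← Real.exp_add]
      ring_nf

namespace LatticeFlow

open LatticeL2

variable {d : ℕ} {u u' : ℝ → (Fin d → ℤ) → ℂ} {L : ℝ}

theorem exists_norm_deriv_le (h : LatticeFlow u u' L) (hdec : SuperexpDecay u) (γ : ℝ) :
    ∃ K, ∀ t ∈ Set.Icc (0 : ℝ) 1, ∀ j, ‖u' t j‖ ≤ K * Real.exp (-(γ * oneNorm j)) := by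
  obtain ⟨K, hK⟩ := hdec γ
  have hK0 : 0 ≤ K := nonneg_of_mul_nonneg_left
    ((norm_nonneg _).trans (hK 0 (by simp) 0)) (Real.exp_pos _)
  have hnb : ∀ t ∈ Set.Icc (0 : ℝ) 1, ∀ j e : Fin d → ℤ, oneNorm e = 1 →
      ‖u t (j + e)‖ ≤ K * Real.exp |γ| * Real.exp (-(γ * oneNorm j)) := by
    intro t ht j e he
    refine (hK t ht _).trans ?_
    rw [mul_assoc, ← Real.exp_add]
    gcongr
    have h1 := oneNorm_add_le j e
    have h2 := oneNorm_add_le (j + e) (-e)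
    rw [oneNorm_neg, add_neg_cancel_right] at h2
    rw [he] at h1 h2
    have h3 : |oneNorm j - oneNorm (j + e)| ≤ 1 := abs_le.2 ⟨by linarith, by linarith⟩
    have h4 : γ * (oneNorm j - oneNorm (j + e)) ≤ |γ| := (le_abs_self _).trans (by
      rw [abs_mul]
      exact mul_le_of_le_one_right (abs_nonneg γ) h3)
    linarith
  refine ⟨(L + 2 * d) * K + d * (2 * (K * Real.exp |γ|)), fun t ht j => ?_⟩
  refine (h.norm_deriv_le ht j).trans ?_
  have hsum : ∑ k, (‖u t (j + Pi.single k 1)‖ + ‖u t (j - Pi.single k 1)‖) ≤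
      ∑ _k : Fin d, 2 * (K * Real.exp |γ| * Real.exp (-(γ * oneNorm j))) := by
    refine Finset.sum_le_sum fun k _ => ?_
    rw [sub_eq_add_neg]
    linarith [hnb t ht j _ (oneNorm_single k),
      hnb t ht j (-Pi.single k 1) (by rw [oneNorm_neg, oneNorm_single])]
  rw [Finset.sum_const, Finset.card_univ, Fintype.card_fin, nsmul_eq_mul] at hsum
  have hL := h.nonneg
  have := mul_le_mul_of_nonneg_left (hK t ht j) (by positivity : 0 ≤ L + 2 * (d : ℝ))
  linarith

theorem memlp_tilt (hdec : SuperexpDecay u) (k : Fin d) (β : ℝ) {t : ℝ}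
    (ht : t ∈ Set.Icc (0 : ℝ) 1) : Memℓp (fun j => Real.exp (β * j k) • u t j) 2 := by
  obtain ⟨K, hK⟩ := hdec (|β| + 1)
  exact memlp_of_le ((summable_exp_neg_oneNorm d).mul_left K) fun j =>
    norm_exp_smul_le k β (hK t ht j)

theorem tilt_apply (hdec : SuperexpDecay u) (k : Fin d) (β : ℝ) {t : ℝ}
    (ht : t ∈ Set.Icc (0 : ℝ) 1) (j : Fin d → ℤ) :
    tilt k β (u t) j = Real.exp (β * j k) • u t j :=
  ofFun_apply (memlp_tilt hdec k β ht) j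

theorem norm_sq_smul_exp (x : ℝ) (z : ℂ) :
    ‖Real.exp x • z‖ ^ 2 = Real.exp (2 * x) * ‖z‖ ^ 2 := by
  rw [norm_smul, mul_pow, Real.norm_of_nonneg (Real.exp_pos _).le, ← Real.exp_nat_mul]
  norm_num

theorem hasSum_tilt (hdec : SuperexpDecay u) (k : Fin d) (β : ℝ) {t : ℝ}
    (ht : t ∈ Set.Icc (0 : ℝ) 1) :
    HasSum (fun j => Real.exp (2 * (β * j k)) * ‖u t j‖ ^ 2) (‖tilt k β (u t)‖ ^ 2) := by
  have h1 := (summable_norm_sq (tilt k β (u t))).hasSum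
  rw [← norm_sq_eq] at h1
  convert h1 using 2 with j
  rw [tilt_apply hdec k β ht, norm_sq_smul_exp]

/-- The tilted trajectory solves the conjugated equation. -/
theorem perturbedFlow (h : LatticeFlow u u' L) (hdec : SuperexpDecay u) (k : Fin d) (β : ℝ) :
    PerturbedFlow (symmPart k β) (skewPart k β) L (fun t => tilt k β (u t))
      (fun t => tilt k β (fun j => u' t j - Complex.I * discreteLap (u t) j)) := by
  obtain ⟨K, hK⟩ := hdec (|β| + 1)
  obtain ⟨K', hK'⟩ := h.exists_norm_deriv_le hdec (|β| + 1)
  set b : (Fin d → ℤ) → ℝ := fun j => max K K' * Real.exp (-oneNorm j) with hbdef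
  have hb : Summable b := (summable_exp_neg_oneNorm d).mul_left _
  have hbu : ∀ t ∈ Set.Icc (0 : ℝ) 1, ∀ j, ‖Real.exp (β * j k) • u t j‖ ≤ b j := fun t ht j =>
    (norm_exp_smul_le k β (hK t ht j)).trans
      (mul_le_mul_of_nonneg_right (le_max_left _ _) (Real.exp_pos _).le)
  have hbu' : ∀ t ∈ Set.Icc (0 : ℝ) 1, ∀ j, ‖Real.exp (β * j k) • u' t j‖ ≤ b j := fun t ht j =>
    (norm_exp_smul_le k β (hK' t ht j)).trans
      (mul_le_mul_of_nonneg_right (le_max_right _ _) (Real.exp_pos _).le)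
  have hIoo : Set.Ioo (0 : ℝ) 1 ⊆ Set.Icc 0 1 := Set.Ioo_subset_Icc_self
  have hF : ∀ t ∈ Set.Icc (0 : ℝ) 1, ∀ j, ‖Real.exp (β * j k) •
      (u' t j - Complex.I * discreteLap (u t) j)‖ ≤ L * ‖tilt k β (u t) j‖ := by
    intro t ht j
    rw [tilt_apply hdec k β ht, norm_smul, norm_smul, mul_left_comm]
    exact mul_le_mul_of_nonneg_left (h.bound t ht j) (norm_nonneg _)
  have hFmem : ∀ t ∈ Set.Icc (0 : ℝ) 1, Memℓp (fun j => Real.exp (β * j k) •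
      (u' t j - Complex.I * discreteLap (u t) j)) 2 := by
    intro t ht
    refine memlp_of_le (hb.mul_left L) fun j => (hF t ht j).trans ?_
    rw [tilt_apply hdec k β ht]
    exact mul_le_mul_of_nonneg_left (hbu t ht j) h.nonneg
  refine ⟨h.nonneg, inner_symmPart_left k β, inner_skewPart_left k β, symmPart_skewPart k β,
    continuousOn_ofFun hb hbu fun j => (h.continuousOn_coord j).fun_const_smul _, fun t ht => ?_,
    fun t ht => ?_⟩
  · have hd := hasDerivAt_ofFun isOpen_Ioo isPreconnected_Ioo hb (fun t ht => hbu t (hIoo ht))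
      (fun t ht => hbu' t (hIoo ht)) (fun j t ht =>
        (((h.deriv j t (hIoo ht)).hasDerivAt (Icc_mem_nhds ht.1 ht.2)).const_smul
          (Real.exp (β * j k)))) ht
    refine HasDerivAt.congr_deriv hd (Eq.symm ?_)
    ext j
    rw [ofFun_apply (memlp_of_le hb (hbu' t (hIoo ht)))]
    have hFj : tilt k β (fun j => u' t j - Complex.I * discreteLap (u t) j) j = _ :=
      ofFun_apply (hFmem t (hIoo ht)) j
    have hplus : ∀ l : Fin d, Real.exp (β * (j + Pi.single l 1 : Fin d → ℤ) k) =
        Real.exp (β * j k) * (if l = k then Real.cosh β + Real.sinh β else 1) := by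
      intro l
      split_ifs with hl
      · subst hl
        rw [Real.cosh_add_sinh, ← Real.exp_add]
        simp [mul_add]
      · rw [Pi.add_apply, Pi.single_eq_of_ne (Ne.symm hl)]
        simp
    have hminus : ∀ l : Fin d, Real.exp (β * (j - Pi.single l 1 : Fin d → ℤ) k) =
        Real.exp (β * j k) * (if l = k then Real.cosh β - Real.sinh β else 1) := by
      intro l
      split_ifs with hl
      · subst hl
        rw [Real.cosh_sub_sinh, ← Real.exp_add]
        simp [mul_add, sub_eq_add_neg]
      · rw [Pi.sub_apply, Pi.single_eq_of_ne (Ne.symm hl)]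
        simp
    have hsum : ∑ l, tilt k β (u t) (j + Pi.single l 1) + ∑ l, tilt k β (u t) (j - Pi.single l 1) =
        Real.exp (β * j k) * (∑ l, (u t (j + Pi.single l 1) + u t (j - Pi.single l 1)) +
          (Real.cosh β + Real.sinh β - 1) * u t (j + Pi.single k 1) +
          (Real.cosh β - Real.sinh β - 1) * u t (j - Pi.single k 1)) := by
      have hsplit : ∀ f : Fin d → ℂ, ∀ c : ℝ, ∑ l, ((if l = k then c else 1 : ℝ) : ℂ) * f l =
          ∑ l, f l + (c - 1) * f k := by
        intro f c
        rw [← Finset.add_sum_erase _ _ (Finset.mem_univ k),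
          ← Finset.add_sum_erase _ f (Finset.mem_univ k), if_pos rfl,
          Finset.sum_congr rfl fun l hl => by rw [if_neg (Finset.ne_of_mem_erase hl)]]
        push_cast
        simp only [one_mul]
        ring
      simp only [tilt_apply hdec k β (hIoo ht), hplus, hminus, Complex.real_smul,
        Complex.ofReal_mul, mul_assoc, ← Finset.mul_sum]
      rw [hsplit, hsplit, Finset.sum_add_distrib]
      push_cast
      ring
    have hcs : (Real.cosh β : ℂ) ^ 2 - (Real.sinh β : ℂ) ^ 2 = 1 := by
      exact_mod_cast Real.cosh_sq_sub_sinh_sq β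
    have hlap : discreteLap (u t) j =
        ∑ l, (u t (j + Pi.single l 1) + u t (j - Pi.single l 1)) - d * (2 * u t j) := by
      rw [discreteLap, Finset.sum_sub_distrib, Finset.sum_const, Finset.card_univ,
        Fintype.card_fin, nsmul_eq_mul]
    simp only [lp.coeFn_add, Pi.add_apply, hFj, symmPart_apply, skewPart_apply, lp.coeFn_smul,
      Pi.smul_apply, mulI_apply, lp.coeFn_sub, Pi.sub_apply, lp.coeFn_sum, Finset.sum_apply,
      shiftDiff_apply, shiftSum_apply, hlap]
    rw [Finset.sum_add_distrib, hsum]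
    simp only [tilt_apply hdec k β (hIoo ht), hplus, hminus, Complex.real_smul, if_true]
    push_cast at hcs ⊢
    linear_combination (Complex.I * Complex.exp (β * j k) *
      (u t (j + Pi.single k 1) + u t (j - Pi.single k 1))) * hcs
  · have h1 : ∀ j, ‖tilt k β (fun j => u' t j - Complex.I * discreteLap (u t) j) j‖ ^ 2 ≤
        L ^ 2 * ‖tilt k β (u t) j‖ ^ 2 := by
      intro j
      rw [← mul_pow]
      gcongr
      refine le_trans (le_of_eq ?_) (hF t (hIoo ht) j)
      rw [tilt, ofFun_apply (hFmem t (hIoo ht))]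
    rw [← sq_le_sq₀ (norm_nonneg _) (mul_nonneg h.nonneg (norm_nonneg _)), mul_pow, norm_sq_eq,
      norm_sq_eq, ← tsum_mul_left]
    exact (summable_norm_sq _).tsum_le_tsum h1 ((summable_norm_sq _).mul_left _)

end LatticeFlow

theorem mul_le_mul_exp_add {β r μ : ℝ} (hβ : 0 ≤ β) (hr : 0 ≤ r) (hμ : 0 < μ) :
    β * r ≤ β * Real.exp (β / μ) + μ * r * Real.log (r + 1) := by
  have hl : 0 ≤ Real.log (r + 1) := Real.log_nonneg (by linarith)
  rcases le_total (β / μ) (Real.log (r + 1)) with h | h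
  · rw [div_le_iff₀ hμ] at h
    have := mul_le_mul_of_nonneg_right h hr
    have h2 : 0 ≤ β * Real.exp (β / μ) := by positivity
    linarith
  · have h1 : r + 1 ≤ Real.exp (β / μ) := (Real.log_le_iff_le_exp (by linarith)).1 h
    have h2 := mul_le_mul_of_nonneg_left (by linarith : r ≤ Real.exp (β / μ)) hβ
    have h3 : 0 ≤ μ * r * Real.log (r + 1) := by positivity
    linarith

theorem latNorm_nonneg {d : ℕ} (j : Fin d → ℤ) : 0 ≤ latNorm j := Real.sqrt_nonneg _

theorem abs_le_latNorm {d : ℕ} (j : Fin d → ℤ) (k : Fin d) : |(j k : ℝ)| ≤ latNorm j := by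
  refine Real.abs_le_sqrt ?_
  exact Finset.single_le_sum (f := fun k => (j k : ℝ) ^ 2) (fun _ _ => sq_nonneg _)
    (Finset.mem_univ k)

theorem oneNorm_le {d : ℕ} (j : Fin d → ℤ) : oneNorm j ≤ d * latNorm j := by
  refine (Finset.sum_le_sum fun k _ => abs_le_latNorm j k).trans_eq ?_
  simp

/-- The weight `e^{2 μ |j| log(|j|+1)}`. -/
noncomputable def logWeight {d : ℕ} (μ : ℝ) (j : Fin d → ℤ) : ℝ :=
  Real.exp (2 * μ * latNorm j * Real.log (latNorm j + 1))

theorem logWeight_pos {d : ℕ} (μ : ℝ) (j : Fin d → ℤ) : 0 < logWeight μ j := Real.exp_pos _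

theorem exp_le_mul_logWeight {d : ℕ} {β μ x : ℝ} {j : Fin d → ℤ} (hβ : 0 ≤ β) (hμ : 0 < μ)
    (hx : x ≤ β * latNorm j) :
    Real.exp (2 * x) ≤ Real.exp (2 * (β * Real.exp (β / μ))) * logWeight μ j := by
  rw [logWeight, ← Real.exp_add, Real.exp_le_exp]
  linarith [mul_le_mul_exp_add hβ (latNorm_nonneg j) hμ]

namespace LatticeFlow

open LatticeL2

variable {d : ℕ} {u u' : ℝ → (Fin d → ℤ) → ℂ} {L μ : ℝ}

theorem superexpDecay (h : LatticeFlow u u' L) (hμ : 0 < μ)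
    (hs : Summable fun j => logWeight μ j * ‖u 0 j‖ ^ 2) : SuperexpDecay u := by
  intro γ
  set β := d * max γ 0 with hβdef
  have hγ : 0 ≤ max γ 0 := le_max_right _ _
  have hβ : 0 ≤ β := by positivity
  obtain ⟨K, hK⟩ := h.exists_decay (β := 2 * max γ 0) (by positivity)
    ((hs.mul_left (Real.exp (2 * (β * Real.exp (β / μ))))).of_nonneg_of_le
      (fun j => by positivity) fun j => by
        rw [← mul_assoc, mul_assoc 2]
        refine mul_le_mul_of_nonneg_right (exp_le_mul_logWeight hβ hμ ?_) (sq_nonneg _)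
        have := mul_le_mul_of_nonneg_left (oneNorm_le j) hγ
        linarith)
  have hK0 : 0 ≤ K := nonneg_of_mul_nonneg_left
    ((sq_nonneg _).trans (hK 0 (by simp) 0)) (Real.exp_pos _)
  refine ⟨Real.sqrt K, fun t ht j => ?_⟩
  rw [← abs_of_nonneg (norm_nonneg (u t j)), ← abs_of_nonneg
    (by positivity : 0 ≤ √K * Real.exp (-(γ * oneNorm j))), ← sq_le_sq, mul_pow,
    Real.sq_sqrt hK0, ← Real.exp_nat_mul]
  refine (hK t ht j).trans ?_
  gcongr
  have := mul_le_mul_of_nonneg_right (le_max_left γ 0) (oneNorm_nonneg j)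
  push_cast
  linarith

theorem norm_tilt_sq_le (hdec : SuperexpDecay u) (hμ : 0 < μ) (k : Fin d) (β : ℝ) {s : ℝ}
    (hs : s ∈ Set.Icc (0 : ℝ) 1) (hsum : Summable fun j => logWeight μ j * ‖u s j‖ ^ 2) :
    ‖tilt k β (u s)‖ ^ 2 ≤ Real.exp (2 * (|β| * Real.exp (|β| / μ))) *
      ∑' j, logWeight μ j * ‖u s j‖ ^ 2 := by
  refine hasSum_le (fun j => ?_) (hasSum_tilt hdec k β hs) (hsum.hasSum.mul_left _)
  rw [← mul_assoc (Real.exp (2 * (|β| * Real.exp (|β| / μ))))]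
  refine mul_le_mul_of_nonneg_right (exp_le_mul_logWeight (abs_nonneg β) hμ ?_) (sq_nonneg _)
  refine (le_abs_self _).trans ?_
  rw [abs_mul]
  exact mul_le_mul_of_nonneg_left (abs_le_latNorm j k) (abs_nonneg β)

theorem exp_mul_le_norm_tilt_sq (hdec : SuperexpDecay u) (k : Fin d) (β : ℝ) {t : ℝ}
    (ht : t ∈ Set.Icc (0 : ℝ) 1) (j : Fin d → ℤ) :
    Real.exp (2 * (β * j k)) * ‖u t j‖ ^ 2 ≤ ‖tilt k β (u t)‖ ^ 2 :=
  le_hasSum (hasSum_tilt hdec k β ht) j fun i _ => by positivity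

theorem tilt_ne_zero (h : LatticeFlow u u' L) (hdec : SuperexpDecay u) (k : Fin d) (β : ℝ)
    (hu : ∃ s ∈ Set.Icc (0 : ℝ) 1, ∃ j, u s j ≠ 0) {t : ℝ} (ht : t ∈ Set.Icc (0 : ℝ) 1) :
    tilt k β (u t) ≠ 0 := by
  intro h0
  obtain ⟨s, hs, j, hj⟩ := hu
  refine hj (h.eq_zero_of_eq_zero ht hs (fun i => ?_) j)
  have h1 := exp_mul_le_norm_tilt_sq hdec k β ht i
  rw [h0, norm_zero, zero_pow two_ne_zero] at h1
  have h2 : ‖u t i‖ ^ 2 ≤ 0 := by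
    by_contra! hcon
    exact absurd h1 (not_le.2 (mul_pos (Real.exp_pos _) hcon))
  simpa using le_antisymm h2 (sq_nonneg _)

end LatticeFlow

namespace LatticeL2

variable {d : ℕ}

theorem abs_norm_sq_sub_le {ε : ℝ} (hε : 0 < ε) (a b : ℂ) :
    |‖b‖ ^ 2 - ‖a‖ ^ 2| ≤ ε⁻¹ * ‖a - b‖ ^ 2 + ε / 2 * (‖a‖ ^ 2 + ‖b‖ ^ 2) := by
  have hab : |‖b‖ ^ 2 - ‖a‖ ^ 2| ≤ ‖a - b‖ * (‖a‖ + ‖b‖) := by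
    rw [sq_sub_sq, abs_mul, abs_of_nonneg (by positivity), mul_comm, add_comm ‖b‖]
    refine mul_le_mul_of_nonneg_right ?_ (by positivity)
    rw [abs_sub_comm]
    exact abs_norm_sub_norm_le a b
  have h3 : ε⁻¹ * ‖a - b‖ ^ 2 + ε / 4 * (‖a‖ + ‖b‖) ^ 2 - ‖a - b‖ * (‖a‖ + ‖b‖) =
      ε⁻¹ * (‖a - b‖ - ε / 2 * (‖a‖ + ‖b‖)) ^ 2 := by
    field_simp
    ring
  have h4 : 0 ≤ ε⁻¹ * (‖a - b‖ - ε / 2 * (‖a‖ + ‖b‖)) ^ 2 := by positivity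
  nlinarith [mul_nonneg hε.le (sq_nonneg (‖a‖ - ‖b‖))]

/-- An approximate eigenvector of the symmetrized shift has little mass near the hyperplane
`j_k = 0`. -/
theorem tsum_indicator_le (k : Fin d) (x : LatticeL2 d) {ε R : ℝ} (hε : 0 < ε) (hR : -1 ≤ R)
    (hx : ‖shiftDiff k x‖ ^ 2 ≤ ε ^ 2 * ‖x‖ ^ 2) :
    ∑' j, {j : Fin d → ℤ | |(j k : ℝ)| ≤ R}.indicator (fun j => ‖x j‖ ^ 2) j ≤
      (R + 1) * ε * ‖x‖ ^ 2 := by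
  set φ : ℝ → ℝ := fun r => max (-(R + 1)) (min r (R + 1)) with hφ
  have hφb : ∀ r, |φ r| ≤ R + 1 := fun r => abs_le.2
    ⟨le_max_left _ _, max_le (by linarith) (min_le_right _ _)⟩
  have hφm : ∀ r, 0 ≤ φ (r + 1) - φ (r - 1) := fun r => by
    simp only [hφ]
    grind
  have hφ2 : ∀ r, |r| ≤ R → φ (r + 1) - φ (r - 1) = 2 := fun r hr => by
    simp only [hφ]
    grind
  set e : Fin d → ℤ := Pi.single k 1 with he
  have hek : ∀ j : Fin d → ℤ, ((j + e) k : ℝ) = j k + 1 := fun j => by simp [he]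
  have hek' : ∀ j : Fin d → ℤ, ((j - e) k : ℝ) = j k - 1 := fun j => by simp [he]
  have hsx := summable_norm_sq x
  have hsφ : ∀ ψ : (Fin d → ℤ) → ℝ, (∀ j, |ψ j| ≤ R + 1) → ∀ v : Fin d → ℤ,
      Summable fun j => ψ j * ‖x (j + v)‖ ^ 2 := fun ψ hψ v =>
    Summable.of_norm_bounded ((hsx.comp_injective (add_left_injective v)).mul_left (R + 1))
      fun j => by
        rw [norm_mul, Real.norm_of_nonneg (sq_nonneg _)]
        exact mul_le_mul_of_nonneg_right (hψ j) (sq_nonneg _)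
  have hshift : ∀ v : Fin d → ℤ, ∑' j, φ (j k) * ‖x (j + v)‖ ^ 2 =
      ∑' j, φ (((j - v) k : ℤ) : ℝ) * ‖x j‖ ^ 2 := fun v => by
    rw [← (Equiv.addRight v).tsum_eq fun j => φ (((j - v) k : ℤ) : ℝ) * ‖x j‖ ^ 2]
    simp
  have hsφ0 : ∀ v : Fin d → ℤ, Summable fun j => φ (((j - v) k : ℤ) : ℝ) * ‖x j‖ ^ 2 :=
    fun v => by simpa using hsφ (fun j => φ (((j - v) k : ℤ) : ℝ)) (fun j => hφb _) 0
  have h1 : ∑' j, (φ (j k + 1) - φ (j k - 1)) * ‖x j‖ ^ 2 =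
      ∑' j, φ (j k) * (‖x (j - e)‖ ^ 2 - ‖x (j + e)‖ ^ 2) := by
    have ha := hshift (-e)
    have hb := hshift e
    have hsa := hsφ0 (-e)
    have hsb := hsφ0 e
    simp only [sub_neg_eq_add, hek, hek', ← sub_eq_add_neg] at ha hb hsa hsb
    have hc := hsφ (fun j => φ (j k)) (fun j => hφb _) (-e)
    simp only [← sub_eq_add_neg] at hc
    simp only [sub_mul, mul_sub]
    rw [hsa.tsum_sub hsb, hc.tsum_sub (hsφ (fun j => φ (j k)) (fun j => hφb _) e), ha, hb]
  have hpt : ∀ j, φ (j k) * (‖x (j - e)‖ ^ 2 - ‖x (j + e)‖ ^ 2) ≤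
      (R + 1) * (ε⁻¹ * ‖shiftDiff k x j‖ ^ 2 + ε / 2 * (‖x (j + e)‖ ^ 2 + ‖x (j - e)‖ ^ 2)) := by
    intro j
    rw [shiftDiff_apply, ← he]
    refine (le_abs_self _).trans ?_
    rw [abs_mul]
    exact mul_le_mul (hφb _) (abs_norm_sq_sub_le hε _ _) (abs_nonneg _) (by linarith)
  have hplus : HasSum (fun j => ‖x (j + e)‖ ^ 2) (‖x‖ ^ 2) := by
    rw [norm_sq_eq]
    exact ((Equiv.addRight e).hasSum_iff (f := fun j => ‖x j‖ ^ 2)).2 hsx.hasSum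
  have hminus : HasSum (fun j => ‖x (j - e)‖ ^ 2) (‖x‖ ^ 2) := by
    rw [norm_sq_eq]
    exact ((Equiv.subRight e).hasSum_iff (f := fun j => ‖x j‖ ^ 2)).2 hsx.hasSum
  have hdiff : HasSum (fun j => ‖shiftDiff k x j‖ ^ 2) (‖shiftDiff k x‖ ^ 2) := by
    rw [norm_sq_eq]
    exact (summable_norm_sq _).hasSum
  have hright := ((hdiff.mul_left ε⁻¹).add ((hplus.add hminus).mul_left (ε / 2))).mul_left (R + 1)
  have hsl : Summable fun j => φ (j k) * (‖x (j - e)‖ ^ 2 - ‖x (j + e)‖ ^ 2) := by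
    simp only [mul_sub]
    have hc := hsφ (fun j => φ (j k)) (fun j => hφb _) (-e)
    simp only [← sub_eq_add_neg] at hc
    exact hc.sub (hsφ (fun j => φ (j k)) (fun j => hφb _) e)
  have h2 := hasSum_le hpt hsl.hasSum hright
  have h3 : 2 * ∑' j, {j : Fin d → ℤ | |(j k : ℝ)| ≤ R}.indicator (fun j => ‖x j‖ ^ 2) j ≤
      ∑' j, (φ (j k + 1) - φ (j k - 1)) * ‖x j‖ ^ 2 := by
    rw [← tsum_mul_left]
    refine Summable.tsum_le_tsum (fun j => ?_) ((hsx.indicator _).mul_left 2) ?_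
    · by_cases hj : |(j k : ℝ)| ≤ R
      · rw [Set.indicator_of_mem (by exact hj), hφ2 _ hj]
      · rw [Set.indicator_of_notMem (by exact hj), mul_zero]
        exact mul_nonneg (hφm _) (sq_nonneg _)
    · have hsa := hsφ0 (-e)
      have hsb := hsφ0 e
      simp only [sub_neg_eq_add, hek, hek'] at hsa hsb
      simp only [sub_mul]
      exact hsa.sub hsb
  rw [h1] at h3
  have h4 : ε⁻¹ * ‖shiftDiff k x‖ ^ 2 ≤ ε * ‖x‖ ^ 2 := by
    rw [inv_mul_le_iff₀ hε]
    linarith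
  have h5 := mul_le_mul_of_nonneg_left h4 (by linarith : 0 ≤ R + 1)
  linarith

end LatticeL2

theorem exists_mul_sq_lt_exp (K : ℝ) : ∃ β : ℝ, 1 ≤ β ∧ K * β ^ 2 < Real.exp (β / 2) := by
  set β := 64 * (|K| + 1) with hβ
  have hK := abs_nonneg K
  have hβ1 : 64 ≤ β := by linarith
  refine ⟨β, by linarith, ?_⟩
  have h1 : β / 8 < Real.exp (β / 8) := by linarith [Real.add_one_le_exp (β / 8)]
  have h2 : Real.exp (β / 2) = Real.exp (β / 8) ^ 4 := by
    rw [← Real.exp_nat_mul]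
    congr 1
    push_cast
    ring
  have h3 : (β / 8) ^ 4 < Real.exp (β / 8) ^ 4 := pow_lt_pow_left₀ h1 (by positivity) (by norm_num)
  have h4 : K * β ^ 2 ≤ (β / 8) ^ 4 := by
    have h5 : (β / 8) ^ 4 = (|K| + 1) ^ 2 * β ^ 2 := by
      rw [hβ]
      ring
    rw [h5]
    refine mul_le_mul_of_nonneg_right ?_ (sq_nonneg _)
    nlinarith [le_abs_self K]
  rw [h2]
  linarith

namespace LatticeFlow

open LatticeL2

variable {d : ℕ} {u u' : ℝ → (Fin d → ℤ) → ℂ} {L μ : ℝ}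

theorem exists_lower_bound (h : LatticeFlow u u' L)
    (hu : ∃ s ∈ Set.Icc (0 : ℝ) 1, ∃ j, u s j ≠ 0) :
    ∃ a b η : ℝ, 0 < a ∧ a < b ∧ b < 1 ∧ 0 < η ∧ η ≤ 1 ∧
      ∃ j, ∀ t ∈ Set.Icc a b, η ≤ ‖u t j‖ ^ 2 := by
  have hhalf : (1 / 2 : ℝ) ∈ Set.Icc (0 : ℝ) 1 := by constructor <;> norm_num
  obtain ⟨j, hj⟩ : ∃ j, u (1 / 2) j ≠ 0 := by
    by_contra! hcon
    obtain ⟨s, hs, j, hj⟩ := hu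
    exact hj (h.eq_zero_of_eq_zero hhalf hs hcon j)
  have hc : ContinuousAt (fun t => ‖u t j‖ ^ 2) (1 / 2) :=
    (((h.continuousOn_coord j).continuousAt (Icc_mem_nhds (by norm_num) (by norm_num))).norm).pow 2
  have hpos : 0 < ‖u (1 / 2) j‖ ^ 2 := by positivity
  have hev := hc.eventually (lt_mem_nhds (half_lt_self hpos))
  obtain ⟨δ, hδ, hball⟩ := Metric.eventually_nhds_iff.1 hev
  set r := min (δ / 2) (1 / 4) with hr
  have hr0 : 0 < r := lt_min (half_pos hδ) (by norm_num)
  have hr1 : r ≤ 1 / 4 := min_le_right _ _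
  have hr2 : r ≤ δ / 2 := min_le_left _ _
  refine ⟨1 / 2 - r, 1 / 2 + r, min (‖u (1 / 2) j‖ ^ 2 / 2) 1, by linarith, by linarith,
    by linarith, lt_min (half_pos hpos) one_pos, min_le_right _ _, j, fun t ht => ?_⟩
  refine (min_le_left _ _).trans (hball ?_).le
  rw [Real.dist_eq, abs_lt]
  constructor <;> linarith [ht.1, ht.2]

/-- For some intermediate time the tilted solution is nearly in the kernel of the symmetric
part of the conjugated operator. -/
theorem exists_norm_symmPart_le (h : LatticeFlow u u' L) (hdec : SuperexpDecay u) (hμ : 0 < μ)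
    (k : Fin d) (h0 : Summable fun j => logWeight μ j * ‖u 0 j‖ ^ 2)
    (h1 : Summable fun j => logWeight μ j * ‖u 1 j‖ ^ 2) {a b η : ℝ} (ha : 0 < a) (hab : a < b)
    (hb : b < 1) (hη : 0 < η) (hη1 : η ≤ 1) {i : Fin d → ℤ}
    (hi : ∀ t ∈ Set.Icc a b, η ≤ ‖u t i‖ ^ 2) :
    ∃ C : ℝ, 0 < C ∧ ∀ β : ℝ, 1 ≤ β → ∃ t ∈ Set.Ioo a b,
      ‖symmPart k β (tilt k β (u t))‖ ^ 2 ≤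
        (C * (β * Real.exp (β / μ))) ^ 2 * ‖tilt k β (u t)‖ ^ 2 := by
  have hL := h.nonneg
  set D := ∑' j, logWeight μ j * ‖u 0 j‖ ^ 2 + ∑' j, logWeight μ j * ‖u 1 j‖ ^ 2 + 1 with hD
  have hD0 : 0 ≤ ∑' j, logWeight μ j * ‖u 0 j‖ ^ 2 :=
    tsum_nonneg fun j => mul_nonneg (logWeight_pos μ j).le (sq_nonneg _)
  have hD1 : 0 ≤ ∑' j, logWeight μ j * ‖u 1 j‖ ^ 2 :=
    tsum_nonneg fun j => mul_nonneg (logWeight_pos μ j).le (sq_nonneg _)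
  have hDge : 1 ≤ D := by linarith
  set m := |(i k : ℝ)| with hm
  have hm0 : 0 ≤ m := abs_nonneg _
  have hlogD : 0 ≤ Real.log D := Real.log_nonneg hDge
  have hlogη : Real.log η ≤ 0 := Real.log_nonpos hη.le hη1
  set C₁ := (2 + Real.log D - Real.log η + 2 * m) / min a (1 - b) with hC₁
  have hmin : 0 < min a (1 - b) := lt_min ha (by linarith)
  have hC₁0 : 0 ≤ C₁ := div_nonneg (by linarith) hmin.le
  set C₂ := C₁ + L ^ 2 + 2 * L with hC₂
  have hC₂0 : 0 ≤ C₂ := by positivity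
  set C := L ^ 2 + 2 * C₂ / (b - a) + 2 * C₂ ^ 2 + 2 * L * C₂ with hC
  have hba : 0 < b - a := by linarith
  have hC0 : 0 ≤ C := by positivity
  refine ⟨Real.sqrt C + 1, by positivity, fun β hβ => ?_⟩
  set y := β * Real.exp (β / μ) with hy
  have hexp : 1 ≤ Real.exp (β / μ) := Real.one_le_exp (by positivity)
  have hβy : β ≤ y := le_mul_of_one_le_right (by linarith) hexp
  have hy1 : 1 ≤ y := hβ.trans hβy
  have hu : ∃ s ∈ Set.Icc (0 : ℝ) 1, ∃ j, u s j ≠ 0 := by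
    refine ⟨a, ⟨ha.le, by linarith⟩, i, fun h0 => ?_⟩
    have := hi a ⟨le_rfl, hab.le⟩
    rw [h0, norm_zero] at this
    norm_num at this
    linarith
  have hne : ∀ t ∈ Set.Icc (0 : ℝ) 1, tilt k β (u t) ≠ 0 := fun t ht =>
    h.tilt_ne_zero hdec k β hu ht
  have hupper : ∀ s ∈ Set.Icc (0 : ℝ) 1, (Summable fun j => logWeight μ j * ‖u s j‖ ^ 2) →
      ∑' j, logWeight μ j * ‖u s j‖ ^ 2 ≤ D →
      Real.log (‖tilt k β (u s)‖ ^ 2) ≤ 2 * y + Real.log D := by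
    intro s hs hsum hle
    have hpos : 0 < ‖tilt k β (u s)‖ ^ 2 := by
      have := norm_pos_iff.2 (hne s hs)
      positivity
    have h2 := norm_tilt_sq_le hdec hμ k β hs hsum
    rw [abs_of_nonneg (by linarith : 0 ≤ β), ← hy] at h2
    have h3 := Real.log_le_log hpos (h2.trans (mul_le_mul_of_nonneg_left hle (Real.exp_pos _).le))
    rwa [Real.log_mul (Real.exp_pos _).ne' (by linarith), Real.log_exp] at h3
  have hlower : ∀ t ∈ Set.Icc a b, Real.log η - 2 * (β * m) ≤
      Real.log (‖tilt k β (u t)‖ ^ 2) := by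
    intro t ht
    have htI : t ∈ Set.Icc (0 : ℝ) 1 := ⟨by linarith [ht.1], by linarith [ht.2]⟩
    have h2 := exp_mul_le_norm_tilt_sq hdec k β htI i
    have h3 : Real.exp (-(2 * (β * m))) * η ≤ ‖tilt k β (u t)‖ ^ 2 := by
      refine le_trans (mul_le_mul ?_ (hi t ht) hη.le (Real.exp_pos _).le) h2
      rw [Real.exp_le_exp]
      have := mul_le_mul_of_nonneg_left (neg_abs_le (i k : ℝ)) (by linarith : 0 ≤ β)
      linarith
    have h4 := Real.log_le_log (by positivity) h3
    rw [Real.log_mul (Real.exp_pos _).ne' hη.ne', Real.log_exp] at h4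
    linarith
  have hΛ : ∀ s ∈ Set.Icc (0 : ℝ) 1, (Summable fun j => logWeight μ j * ‖u s j‖ ^ 2) →
      ∑' j, logWeight μ j * ‖u s j‖ ^ 2 ≤ D → ∀ t ∈ Set.Icc a b, ∀ τ, min a (1 - b) ≤ τ →
      (Real.log (‖tilt k β (u s)‖ ^ 2) - Real.log (‖tilt k β (u t)‖ ^ 2)) / τ ≤ C₁ * y := by
    intro s hs hsum hle t ht τ hτ
    have h2 := hupper s hs hsum hle
    have h3 := hlower t ht
    rw [div_le_iff₀ (hmin.trans_le hτ)]
    have h4 : C₁ * min a (1 - b) = 2 + Real.log D - Real.log η + 2 * m :=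
      div_mul_cancel₀ _ hmin.ne'
    have h5 : C₁ * y * min a (1 - b) ≤ C₁ * y * τ := by gcongr
    have h6 := mul_le_mul_of_nonneg_right hβy hm0
    have h7 := mul_le_mul_of_nonneg_left hy1 (by linarith : 0 ≤ Real.log D - Real.log η)
    have h8 : C₁ * y * min a (1 - b) = (2 + Real.log D - Real.log η + 2 * m) * y := by
      rw [← h4]
      ring
    linarith
  obtain ⟨t, ht, hle⟩ := (h.perturbedFlow hdec k β).exists_norm_symm_le hne ha hab hb
    (Λ := C₁ * y) (fun t ht => hΛ 0 (by simp) h0 (by linarith) t ht t ((min_le_left _ _).trans ht.1))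
    (fun t ht => hΛ 1 (by simp) h1 (by linarith) t ht (1 - t)
      ((min_le_right _ _).trans (by linarith [ht.2])))
  refine ⟨t, ht, hle.trans (mul_le_mul_of_nonneg_right ?_ (sq_nonneg _))⟩
  have hY : C₁ * y + L ^ 2 + 2 * L ≤ C₂ * y := by
    have := mul_le_mul_of_nonneg_left hy1 (by positivity : 0 ≤ L ^ 2 + 2 * L)
    rw [hC₂]
    linarith
  have hY0 : 0 ≤ C₁ * y + L ^ 2 + 2 * L := by positivity
  have hyy : y ≤ y ^ 2 := by nlinarith
  calc L ^ 2 + 2 * (C₁ * y + L ^ 2 + 2 * L) / (b - a) + 2 * (C₁ * y + L ^ 2 + 2 * L) ^ 2 +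
        2 * L * (C₁ * y + L ^ 2 + 2 * L)
      ≤ L ^ 2 * y ^ 2 + 2 * (C₂ * y ^ 2) / (b - a) + 2 * (C₂ * y) ^ 2 + 2 * L * (C₂ * y ^ 2) := by
        have h2 : C₁ * y + L ^ 2 + 2 * L ≤ C₂ * y ^ 2 :=
          hY.trans (mul_le_mul_of_nonneg_left hyy hC₂0)
        have h3 : L ^ 2 ≤ L ^ 2 * y ^ 2 := le_mul_of_one_le_right (sq_nonneg _) (by linarith)
        gcongr
    _ = (Real.sqrt C) ^ 2 * y ^ 2 := by
        rw [Real.sq_sqrt hC0, hC]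
        ring
    _ ≤ ((Real.sqrt C + 1) * y) ^ 2 := by
        rw [mul_pow (Real.sqrt C + 1) y]
        exact mul_le_mul_of_nonneg_right
          (pow_le_pow_left₀ (Real.sqrt_nonneg _) (by linarith) 2) (sq_nonneg _)

end LatticeFlow

theorem exp_div_four_le_sinh {β : ℝ} (hβ : 1 ≤ β) : Real.exp β / 4 ≤ Real.sinh β := by
  have h1 : Real.exp (-β) ≤ 1 := Real.exp_le_one_iff.2 (by linarith)
  have h2 := Real.add_one_le_exp β
  rw [Real.sinh_eq]
  linarith

theorem exp_le_exp_two_mul_add_exp_neg {r R : ℝ} (h : R ≤ |r|) :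
    Real.exp (2 * R) ≤ Real.exp (2 * r) + Real.exp (-(2 * r)) := by
  have h1 := Real.exp_pos (2 * r)
  have h2 := Real.exp_pos (-(2 * r))
  rcases le_abs.1 h with h | h
  · have : Real.exp (2 * R) ≤ Real.exp (2 * r) := Real.exp_le_exp.2 (by linarith)
    linarith
  · have : Real.exp (2 * R) ≤ Real.exp (-(2 * r)) := Real.exp_le_exp.2 (by linarith)
    linarith

namespace LatticeFlow

open LatticeL2

variable {d : ℕ} {u u' : ℝ → (Fin d → ℤ) → ℂ} {L μ : ℝ}

/-- If the tilted solution is nearly invariant under translation, it has to be spread out, so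
that changing the tilt increases the norm a lot. -/
theorem exp_mul_norm_sq_le (hdec : SuperexpDecay u) (k : Fin d) {β ε t : ℝ} (hε : 0 < ε)
    (ht : t ∈ Set.Icc (0 : ℝ) 1)
    (hx : ‖shiftDiff k (tilt k β (u t))‖ ^ 2 ≤ ε ^ 2 * ‖tilt k β (u t)‖ ^ 2) :
    Real.exp (1 / ε - 2) * (‖tilt k β (u t)‖ ^ 2 / 2) ≤
      ‖tilt k (β + 1) (u t)‖ ^ 2 + ‖tilt k (β - 1) (u t)‖ ^ 2 := by
  set x := tilt k β (u t) with hxdef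
  set R := 1 / (2 * ε) - 1 with hR
  have hR1 : -1 ≤ R := by
    have : 0 < 1 / (2 * ε) := by positivity
    linarith
  have hmass := tsum_indicator_le k x hε hR1 hx
  have hRε : (R + 1) * ε = 1 / 2 := by
    rw [hR]
    field_simp
    ring
  have hR2 : 1 / ε - 2 = 2 * R := by
    rw [hR]
    field_simp
  rw [hRε] at hmass
  have hs := summable_norm_sq x
  have hind := hs.indicator {j : Fin d → ℤ | |(j k : ℝ)| ≤ R}
  have h1 := ((hs.hasSum.sub hind.hasSum).mul_left (Real.exp (2 * R)))
  rw [← norm_sq_eq] at h1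
  have h2 := hasSum_le (fun j => ?_) h1
    ((hasSum_tilt hdec k (β + 1) ht).add (hasSum_tilt hdec k (β - 1) ht))
  · rw [hR2]
    refine le_trans (mul_le_mul_of_nonneg_left ?_ (Real.exp_pos _).le) h2
    linarith
  · by_cases hj : |(j k : ℝ)| ≤ R
    · rw [Set.indicator_of_mem (show j ∈ {j : Fin d → ℤ | |(j k : ℝ)| ≤ R} from hj), sub_self,
        mul_zero]
      positivity
    · rw [Set.indicator_of_notMem (show j ∉ {j : Fin d → ℤ | |(j k : ℝ)| ≤ R} from hj), sub_zero,
        hxdef, tilt_apply hdec k β ht, norm_sq_smul_exp, ← add_mul, ← mul_assoc]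
      refine mul_le_mul_of_nonneg_right ?_ (sq_nonneg _)
      have h3 := mul_le_mul_of_nonneg_right
        (exp_le_exp_two_mul_add_exp_neg (r := j k) (not_le.1 hj).le)
        (Real.exp_pos (2 * (β * j k))).le
      refine h3.trans (le_of_eq ?_)
      rw [add_mul, ← Real.exp_add, ← Real.exp_add]
      congr 2 <;> ring

theorem norm_tilt_sq_le_of_endpoints (h : LatticeFlow u u' L) (hdec : SuperexpDecay u)
    (hμ : 0 < μ) (k : Fin d) (hu : ∃ s ∈ Set.Icc (0 : ℝ) 1, ∃ j, u s j ≠ 0)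
    (h0 : Summable fun j => logWeight μ j * ‖u 0 j‖ ^ 2)
    (h1 : Summable fun j => logWeight μ j * ‖u 1 j‖ ^ 2) {D : ℝ}
    (hD0 : ∑' j, logWeight μ j * ‖u 0 j‖ ^ 2 ≤ D) (hD1 : ∑' j, logWeight μ j * ‖u 1 j‖ ^ 2 ≤ D)
    (β : ℝ) {t : ℝ} (ht : t ∈ Set.Icc (0 : ℝ) 1) :
    ‖tilt k β (u t)‖ ^ 2 ≤
      Real.exp (L + L ^ 2) * (Real.exp (2 * (|β| * Real.exp (|β| / μ))) * D) := by
  refine ((h.perturbedFlow hdec k β).norm_sq_le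
    (fun t ht => h.tilt_ne_zero hdec k β hu ht) ht).trans
    (mul_le_mul_of_nonneg_left ?_ (Real.exp_pos _).le)
  have h2 := (norm_tilt_sq_le hdec hμ k β (by simp) h0).trans
    (mul_le_mul_of_nonneg_left hD0 (Real.exp_pos _).le)
  have h3 := (norm_tilt_sq_le hdec hμ k β (by simp) h1).trans
    (mul_le_mul_of_nonneg_left hD1 (Real.exp_pos _).le)
  nlinarith [mul_le_mul_of_nonneg_left h2 (sub_nonneg.2 ht.2), mul_le_mul_of_nonneg_left h3 ht.1]

/-- A solution decaying faster than `exp (-4 |j| log |j|)` at both endpoints vanishes. -/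
theorem eq_zero_of_four_le (h : LatticeFlow u u' L) (hμ : 4 ≤ μ) (k : Fin d)
    (h0 : Summable fun j => logWeight μ j * ‖u 0 j‖ ^ 2)
    (h1 : Summable fun j => logWeight μ j * ‖u 1 j‖ ^ 2) :
    ∀ t ∈ Set.Icc (0 : ℝ) 1, ∀ j, u t j = 0 := by
  by_contra! hu
  have hμ0 : 0 < μ := by linarith
  have hdec := h.superexpDecay hμ0 h0
  obtain ⟨a, b, η, ha, hab, hb, hη, hη1, i, hi⟩ := h.exists_lower_bound hu
  obtain ⟨C, hC, hlow⟩ := h.exists_norm_symmPart_le hdec hμ0 k h0 h1 ha hab hb hη hη1 hi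
  set D := ∑' j, logWeight μ j * ‖u 0 j‖ ^ 2 + ∑' j, logWeight μ j * ‖u 1 j‖ ^ 2 + 1 with hD
  have hD0 : 0 ≤ ∑' j, logWeight μ j * ‖u 0 j‖ ^ 2 :=
    tsum_nonneg fun j => mul_nonneg (logWeight_pos μ j).le (sq_nonneg _)
  have hD1 : 0 ≤ ∑' j, logWeight μ j * ‖u 1 j‖ ^ 2 :=
    tsum_nonneg fun j => mul_nonneg (logWeight_pos μ j).le (sq_nonneg _)
  set m := |(i k : ℝ)| with hm
  have hm0 : 0 ≤ m := abs_nonneg _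
  set K₀ := Real.log (4 * Real.exp (L + L ^ 2) * D / η) with hK₀
  obtain ⟨β, hβ, hβK⟩ := exists_mul_sq_lt_exp (4 * C * (|K₀| + 10 + 2 * m))
  obtain ⟨t, ht, hsym⟩ := hlow β hβ
  have htI : t ∈ Set.Icc (0 : ℝ) 1 := ⟨by linarith [ht.1], by linarith [ht.2]⟩
  set y := β * Real.exp (β / μ) with hy
  set y' := (β + 1) * Real.exp ((β + 1) / μ) with hy'
  have hypos : 0 < y := by positivity
  set ε := 4 * C * y / Real.exp β with hε
  have hε0 : 0 < ε := by positivity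
  have hx : ‖shiftDiff k (tilt k β (u t))‖ ^ 2 ≤ ε ^ 2 * ‖tilt k β (u t)‖ ^ 2 := by
    rw [symmPart_apply, norm_smul, norm_neg, norm_mulI_apply, mul_pow, Real.norm_eq_abs,
      sq_abs] at hsym
    have h2 := pow_le_pow_left₀ (by positivity) (exp_div_four_le_sinh hβ) 2
    have h3 := (mul_le_mul_of_nonneg_right h2
      (sq_nonneg ‖shiftDiff k (tilt k β (u t))‖)).trans hsym
    have h4 : ε ^ 2 * ‖tilt k β (u t)‖ ^ 2 =
        (C * y) ^ 2 * ‖tilt k β (u t)‖ ^ 2 / (Real.exp β / 4) ^ 2 := by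
      rw [hε]
      field_simp
    rw [h4, le_div_iff₀ (by positivity)]
    linarith
  have hmain := exp_mul_norm_sq_le hdec k hε0 htI hx
  have hup : ∀ γ, |γ| ≤ β + 1 → ‖tilt k γ (u t)‖ ^ 2 ≤
      Real.exp (L + L ^ 2) * (Real.exp (2 * y') * D) := by
    intro γ hγ
    refine (h.norm_tilt_sq_le_of_endpoints hdec hμ0 k hu h0 h1 (D := D) (by linarith)
      (by linarith) γ htI).trans ?_
    rw [hy']
    have h0D : 0 ≤ D := by linarith
    have hb0 : 0 ≤ β + 1 := by linarith
    gcongr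
  have hlo : Real.exp (-(2 * (β * m))) * η ≤ ‖tilt k β (u t)‖ ^ 2 := by
    refine le_trans (mul_le_mul ?_ (hi t ⟨ht.1.le, ht.2.le⟩) hη.le (Real.exp_pos _).le)
      (exp_mul_le_norm_tilt_sq hdec k β htI i)
    rw [Real.exp_le_exp]
    have := mul_le_mul_of_nonneg_left (neg_abs_le (i k : ℝ)) (by linarith : 0 ≤ β)
    linarith
  have hK : Real.exp (1 / ε - 2) ≤ Real.exp (K₀ + 2 * (β * m) + 2 * y') := by
    have h2 := hup (β + 1) (abs_of_nonneg (by linarith)).le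
    have h3 := hup (β - 1) (abs_le.2 ⟨by linarith, by linarith⟩)
    have h4 := mul_le_mul_of_nonneg_left hlo (Real.exp_pos (1 / ε - 2)).le
    have h5 : Real.exp (-(2 * (β * m))) * Real.exp (2 * (β * m)) = 1 := by
      rw [← Real.exp_add, neg_add_cancel, Real.exp_zero]
    rw [Real.exp_add, Real.exp_add, hK₀, Real.exp_log (by positivity)]
    have h6 : Real.exp (1 / ε - 2) * (Real.exp (-(2 * (β * m))) * η) ≤
        4 * Real.exp (L + L ^ 2) * D * Real.exp (2 * y') := by linarith
    have h7 := mul_le_mul_of_nonneg_right h6 (Real.exp_pos (2 * (β * m))).le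
    have h8 : Real.exp (1 / ε - 2) * (Real.exp (-(2 * (β * m))) * η) * Real.exp (2 * (β * m)) =
        Real.exp (1 / ε - 2) * η := by linear_combination Real.exp (1 / ε - 2) * η * h5
    rw [h8, ← le_div_iff₀ hη] at h7
    refine h7.trans (le_of_eq ?_)
    ring
  rw [Real.exp_le_exp] at hK
  set E := Real.exp (β / 4) with hE
  have hE1 : 1 ≤ E := Real.one_le_exp (by positivity)
  have hy'E : y' ≤ 4 * (β * E) := by
    have h2 : Real.exp ((β + 1) / μ) ≤ 2 * E := by
      have h3 : Real.exp ((β + 1) / μ) ≤ Real.exp ((β + 1) / 4) :=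
        Real.exp_le_exp.2 (div_le_div_of_nonneg_left (by linarith) (by norm_num) hμ)
      have h4 : Real.exp (1 / 4) ≤ 2 := by
        have h5 : Real.exp (1 / 4) ≤ Real.exp (Real.log 2) :=
          Real.exp_le_exp.2 (by linarith [Real.log_two_gt_d9])
        rwa [Real.exp_log two_pos] at h5
      have h5 : Real.exp ((β + 1) / 4) = Real.exp (1 / 4) * E := by
        rw [hE, ← Real.exp_add]
        congr 1
        ring
      rw [h5] at h3
      exact h3.trans (mul_le_mul_of_nonneg_right h4 (by positivity))
    calc y' ≤ (2 * β) * (2 * E) := by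
          rw [hy']
          gcongr
          linarith
      _ = 4 * (β * E) := by ring
  have hyE : y ≤ β * E := by
    rw [hy, hE]
    gcongr
  have hinv : 1 / ε = Real.exp (β / 2) * E * E / (4 * C * y) := by
    rw [hε, one_div_div, hE, ← Real.exp_add, ← Real.exp_add]
    congr 2
    ring
  have hβE : 1 ≤ β * E := by nlinarith
  have hβE' : β ≤ β * E := le_mul_of_one_le_right (by linarith) hE1
  have hbound : 1 / ε ≤ (|K₀| + 10 + 2 * m) * (β * E) := by
    have h2 := mul_le_mul_of_nonneg_left hβE (by positivity : 0 ≤ |K₀| + 2)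
    have h3 := mul_le_mul_of_nonneg_right hβE' hm0
    have h4 := le_abs_self K₀
    linarith
  rw [hinv, div_le_iff₀ (by positivity)] at hbound
  have hq : 0 ≤ |K₀| + 10 + 2 * m := by positivity
  have h9 : Real.exp (β / 2) * E * E ≤
      (|K₀| + 10 + 2 * m) * (β * E) * (4 * C * (β * E)) := by
    refine hbound.trans ?_
    gcongr
  have h10 : Real.exp (β / 2) * (E * E) ≤
      4 * C * (|K₀| + 10 + 2 * m) * β ^ 2 * (E * E) := by linarith
  have h11 := le_of_mul_le_mul_right h10 (by positivity)
  linarith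

end LatticeFlow

/-- The exponential distribution with rate `r`. -/
noncomputable def expLaw (r : ℝ) : Measure ℝ :=
  (volume.restrict (Set.Ioi 0)).withDensity fun y => ENNReal.ofReal (r * Real.exp (-(r * y)))

theorem setLIntegral_exp_Ioi {r b : ℝ} (hr : 0 ≤ r) (hb : 0 < b) (a : ℝ) :
    ∫⁻ y in Set.Ioi a, ENNReal.ofReal (r * Real.exp (-(b * y))) =
      ENNReal.ofReal (r * (Real.exp (-(b * a)) / b)) := by
  have h1 := (integrableOn_exp_mul_Ioi (neg_lt_zero.2 hb) a).const_mul r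
  have h2 := integral_exp_mul_Ioi (neg_lt_zero.2 hb) a
  simp only [neg_mul] at h1 h2
  rw [← ofReal_integral_eq_lintegral_ofReal h1
    (Filter.Eventually.of_forall fun y => by positivity), integral_const_mul, h2, neg_div_neg_eq]

theorem lintegral_exp_expLaw {r c : ℝ} (hr : 0 < r) (hc : c < r) :
    ∫⁻ y, ENNReal.ofReal (Real.exp (c * y)) ∂expLaw r = ENNReal.ofReal (r / (r - c)) := by
  rw [expLaw, lintegral_withDensity_eq_lintegral_mul _ (by fun_prop) (by fun_prop)]
  have h1 := setLIntegral_exp_Ioi hr.le (sub_pos.2 hc) 0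
  rw [mul_zero, neg_zero, Real.exp_zero, mul_one_div] at h1
  rw [← h1]
  refine lintegral_congr fun y => ?_
  rw [Pi.mul_apply, ← ENNReal.ofReal_mul (by positivity), mul_assoc, ← Real.exp_add]
  congr 3
  ring

theorem expLaw_Ioi {r a : ℝ} (hr : 0 < r) (ha : 0 ≤ a) :
    expLaw r (Set.Ioi a) = ENNReal.ofReal (Real.exp (-(r * a))) := by
  rw [expLaw, withDensity_apply _ measurableSet_Ioi, Measure.restrict_restrict measurableSet_Ioi,
    Set.inter_eq_left.2 (Set.Ioi_subset_Ioi ha), setLIntegral_exp_Ioi hr.le hr]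
  congr 1
  field_simp

theorem isProbabilityMeasure_expLaw {r : ℝ} (hr : 0 < r) : IsProbabilityMeasure (expLaw r) := by
  constructor
  have h := lintegral_exp_expLaw (c := 0) hr hr
  simpa [hr.ne'] using h

theorem ae_expLaw_pos (r : ℝ) : ∀ᵐ y ∂expLaw r, 0 < y :=
  (withDensity_absolutelyContinuous _ _).ae_le (ae_restrict_mem measurableSet_Ioi)

theorem cosh_le_exp_of_nonneg {x : ℝ} (hx : 0 ≤ x) : Real.cosh x ≤ Real.exp x := by
  have : Real.exp (-x) ≤ Real.exp x := Real.exp_le_exp.2 (by linarith)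
  rw [Real.cosh_eq]
  linarith

theorem cosh_le_one_add_cosh_mul_div_sq {p : ℝ} (hp : 1 ≤ p) (x : ℝ) :
    Real.cosh x ≤ 1 + Real.cosh (p * x) / p ^ 2 := by
  refine hasSum_le (fun n => ?_) (Real.hasSum_cosh x)
    ((hasSum_ite_eq 0 1).add ((Real.hasSum_cosh (p * x)).div_const (p ^ 2)))
  rcases Nat.eq_zero_or_pos n with rfl | hn
  · simp
    positivity
  · rw [if_neg hn.ne', zero_add, le_div_iff₀ (by positivity), mul_pow, pow_mul x, pow_mul p,
      mul_div_assoc, mul_comm]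
    have h1 : p ^ 2 ≤ (p ^ 2) ^ n := le_self_pow₀ (one_le_pow₀ hp) hn.ne'
    exact mul_le_mul_of_nonneg_right h1 (by positivity)

theorem mul_log_one_add_le {n y : ℝ} (hn : 0 ≤ n) (hy : 0 ≤ y) :
    n * Real.log (1 + y) ≤ n * Real.log (n + 1) + y := by
  have h1 : Real.log ((1 + y) / (n + 1)) ≤ (1 + y) / (n + 1) - 1 :=
    Real.log_le_sub_one_of_pos (by positivity)
  rw [Real.log_div (by positivity) (by positivity)] at h1
  have h2 := mul_le_mul_of_nonneg_left h1 hn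
  have h3 : n * ((1 + y) / (n + 1) - 1) ≤ y := by
    have h4 : n * ((1 + y) / (n + 1) - 1) = n * (y - n) / (n + 1) := by
      field_simp
      ring
    rw [h4, div_le_iff₀ (by positivity)]
    nlinarith
  linarith

/-- The average of `cosh (2 β n)` over the tilts `β = κ log (1 + y)`, where `y` is exponentially
distributed with rate `8 κ`. -/
noncomputable def logAvg (κ n : ℝ) : ℝ≥0∞ :=
  ∫⁻ y, ENNReal.ofReal (Real.cosh (2 * (κ * Real.log (1 + y) * n))) ∂expLaw (8 * κ)

section logAvg

variable {κ n : ℝ}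

theorem cosh_tilt_le (hκ : 0 < κ) (hn : 0 ≤ n) {y : ℝ} (hy : 0 < y) :
    Real.cosh (2 * (κ * Real.log (1 + y) * n)) ≤
      Real.exp (2 * (κ * (n * Real.log (n + 1)))) * Real.exp (2 * κ * y) := by
  have hlog : 0 ≤ Real.log (1 + y) := Real.log_nonneg (by linarith)
  refine (cosh_le_exp_of_nonneg (by positivity)).trans ?_
  rw [← Real.exp_add, Real.exp_le_exp]
  have := mul_le_mul_of_nonneg_left (mul_log_one_add_le hn hy.le) hκ.le
  linarith

theorem logAvg_le (hκ : 0 < κ) (hn : 0 ≤ n) :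
    logAvg κ n ≤ ENNReal.ofReal (4 / 3 * Real.exp (2 * (κ * (n * Real.log (n + 1))))) := by
  calc logAvg κ n
      ≤ ∫⁻ y, ENNReal.ofReal (Real.exp (2 * (κ * (n * Real.log (n + 1))))) *
          ENNReal.ofReal (Real.exp (2 * κ * y)) ∂expLaw (8 * κ) := by
        refine lintegral_mono_ae ((ae_expLaw_pos _).mono fun y hy => ?_)
        rw [← ENNReal.ofReal_mul (Real.exp_pos _).le]
        exact ENNReal.ofReal_le_ofReal (cosh_tilt_le hκ hn hy)
    _ = _ := by
        rw [lintegral_const_mul _ (by fun_prop), lintegral_exp_expLaw (by linarith) (by linarith),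
          ← ENNReal.ofReal_mul (Real.exp_pos _).le]
        congr 1
        have : 8 * κ / (8 * κ - 2 * κ) = 4 / 3 := by
          field_simp
          norm_num
        rw [this, mul_comm]

theorem sinh_mul_log_le (hκ : 0 < κ) (hκ1 : κ ≤ 1) {y : ℝ} (hy : 0 < y) :
    4 * Real.sinh (κ * Real.log (1 + y)) ≤ 2 + 2 * κ * y := by
  have h1 : Real.exp (κ * Real.log (1 + y)) ≤ 1 + κ * y := by
    rw [mul_comm κ, ← Real.rpow_def_of_pos (by linarith)]
    exact rpow_one_add_le_one_add_mul_self (by linarith) hκ.le hκ1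
  have h2 := Real.exp_pos (-(κ * Real.log (1 + y)))
  rw [Real.sinh_eq]
  linarith

theorem lintegral_exp_sinh_mul_cosh_le (hκ : 0 < κ) (hκ1 : κ ≤ 1) (hn : 0 ≤ n) :
    ∫⁻ y, ENNReal.ofReal (Real.exp (4 * Real.sinh (κ * Real.log (1 + y))) *
        Real.cosh (2 * (κ * Real.log (1 + y) * n))) ∂expLaw (8 * κ) ≤
      ENNReal.ofReal (2 * Real.exp 2 * Real.exp (2 * (κ * (n * Real.log (n + 1))))) := by
  calc _ ≤ ∫⁻ y, ENNReal.ofReal (Real.exp 2 * Real.exp (2 * (κ * (n * Real.log (n + 1))))) *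
          ENNReal.ofReal (Real.exp (4 * κ * y)) ∂expLaw (8 * κ) := by
        refine lintegral_mono_ae ((ae_expLaw_pos _).mono fun y hy => ?_)
        rw [← ENNReal.ofReal_mul (by positivity)]
        refine ENNReal.ofReal_le_ofReal ?_
        refine (mul_le_mul (Real.exp_le_exp.2 (sinh_mul_log_le hκ hκ1 hy)) (cosh_tilt_le hκ hn hy)
          (Real.cosh_pos _).le (Real.exp_pos _).le).trans (le_of_eq ?_)
        simp only [← Real.exp_add]
        congr 1
        ring
    _ = _ := by
        rw [lintegral_const_mul _ (by fun_prop), lintegral_exp_expLaw (by linarith) (by linarith),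
          ← ENNReal.ofReal_mul (by positivity)]
        congr 1
        have : 8 * κ / (8 * κ - 4 * κ) = 2 := by
          field_simp
          norm_num
        rw [this]
        ring

theorem one_le_logAvg (hκ : 0 < κ) (n : ℝ) : 1 ≤ logAvg κ n := by
  have := isProbabilityMeasure_expLaw (r := 8 * κ) (by linarith)
  calc (1 : ℝ≥0∞) = ∫⁻ _, 1 ∂expLaw (8 * κ) := by simp
    _ ≤ _ := lintegral_mono fun y => ENNReal.one_le_ofReal.2 (Real.one_le_cosh _)

theorem le_logAvg (hκ : 0 < κ) (hn : 0 ≤ n) :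
    ENNReal.ofReal (1 / 2 * Real.exp (2 * (κ * (n * Real.log (n + 1))) - 8 * κ * n)) ≤
      logAvg κ n := by
  calc _ = ENNReal.ofReal (1 / 2 * Real.exp (2 * (κ * (n * Real.log (n + 1))))) *
        expLaw (8 * κ) (Set.Ioi n) := by
        rw [expLaw_Ioi (by linarith) hn, ← ENNReal.ofReal_mul (by positivity), mul_assoc (1 / 2),
          ← Real.exp_add, sub_eq_add_neg]
    _ ≤ ∫⁻ y in Set.Ioi n, ENNReal.ofReal (Real.cosh (2 * (κ * Real.log (1 + y) * n)))
        ∂expLaw (8 * κ) := by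
        rw [← setLIntegral_const]
        refine setLIntegral_mono' measurableSet_Ioi fun y hy => ENNReal.ofReal_le_ofReal ?_
        have hy : n < y := hy
        have h1 : Real.exp (2 * (κ * (n * Real.log (n + 1)))) ≤
            Real.exp (2 * (κ * Real.log (1 + y) * n)) := by
          rw [Real.exp_le_exp]
          have h2 : Real.log (n + 1) ≤ Real.log (1 + y) :=
            Real.log_le_log (by linarith) (by linarith)
          have h3 := mul_le_mul_of_nonneg_left (mul_le_mul_of_nonneg_left h2 hn) hκ.le
          linarith
        have h4 := Real.exp_pos (-(2 * (κ * Real.log (1 + y) * n)))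
        rw [Real.cosh_eq]
        linarith
    _ ≤ logAvg κ n := setLIntegral_le_lintegral _ _

/-- The averaged weight dominates a multiple of the logarithmic weight. -/
theorem exp_le_one_add_logAvg (hκ : 0 < κ) (hκ1 : κ ≤ 1 / 5) (hn : 0 ≤ n) :
    ENNReal.ofReal (Real.exp (2 * (Real.exp (-8) / 8 * κ * (n * Real.log (n + 1))))) ≤
      1 + logAvg κ n := by
  have he : Real.exp (-8) ≤ 1 := Real.exp_le_one_iff.2 (by norm_num)
  have hlog : 0 ≤ Real.log (n + 1) := Real.log_nonneg (by linarith)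
  rcases lt_or_ge (Real.log (n + 1)) 8 with h8 | h8
  · have h1 : n ≤ Real.exp 8 := by
      have := Real.lt_exp_of_log_lt h8
      linarith
    have h2 : n * Real.log (n + 1) ≤ Real.exp 8 * 8 := mul_le_mul h1 h8.le hlog (Real.exp_pos _).le
    have h3 : Real.exp (-8) * Real.exp 8 = 1 := by rw [← Real.exp_add]; norm_num
    have h4 : 2 * (Real.exp (-8) / 8 * κ * (n * Real.log (n + 1))) ≤ Real.log 2 := by
      have h5 : Real.exp (-8) / 8 * κ * (n * Real.log (n + 1)) ≤
          Real.exp (-8) / 8 * κ * (Real.exp 8 * 8) := mul_le_mul_of_nonneg_left h2 (by positivity)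
      have h6 : Real.exp (-8) / 8 * κ * (Real.exp 8 * 8) = κ := by linear_combination κ * h3
      linarith [Real.log_two_gt_d9]
    calc _ ≤ ENNReal.ofReal 2 := by
          refine ENNReal.ofReal_le_ofReal ?_
          exact (Real.exp_le_exp.2 h4).trans_eq (Real.exp_log two_pos)
      _ = 1 + 1 := by norm_num
      _ ≤ _ := by
        gcongr
        exact one_le_logAvg hκ n
  · set X := Real.exp (κ * (n * Real.log (n + 1)) / 2) with hX
    have hf : 0 ≤ n * Real.log (n + 1) := mul_nonneg hn hlog
    have h1 : Real.exp (2 * (Real.exp (-8) / 8 * κ * (n * Real.log (n + 1)))) ≤ X := by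
      rw [hX, Real.exp_le_exp]
      have := mul_le_mul_of_nonneg_right he (mul_nonneg hκ.le hf)
      linarith [mul_nonneg hκ.le hf]
    have h2 : X ^ 2 ≤ Real.exp (2 * (κ * (n * Real.log (n + 1))) - 8 * κ * n) := by
      rw [hX, ← Real.exp_nat_mul, Real.exp_le_exp]
      have := mul_le_mul_of_nonneg_left (mul_le_mul_of_nonneg_left h8 hn) hκ.le
      push_cast
      linarith
    calc _ ≤ ENNReal.ofReal (1 + 1 / 2 * Real.exp (2 * (κ * (n * Real.log (n + 1))) - 8 * κ * n)) :=
          ENNReal.ofReal_le_ofReal (by nlinarith [sq_nonneg (X - 1)])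
      _ = 1 + ENNReal.ofReal
          (1 / 2 * Real.exp (2 * (κ * (n * Real.log (n + 1))) - 8 * κ * n)) := by
        rw [ENNReal.ofReal_add one_pos.le (by positivity), ENNReal.ofReal_one]
      _ ≤ _ := by
        gcongr
        exact le_logAvg hκ hn

theorem logAvg_le_one_add (hκ : 0 < κ) {p : ℝ} (hp : 1 ≤ p) (n : ℝ) :
    logAvg κ n ≤ 1 + ENNReal.ofReal (1 / p ^ 2) * logAvg κ (p * n) := by
  have := isProbabilityMeasure_expLaw (r := 8 * κ) (by linarith)
  have hm : Measurable fun y : ℝ =>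
      ENNReal.ofReal (Real.cosh (2 * (κ * Real.log (1 + y) * (p * n)))) :=
    ENNReal.measurable_ofReal.comp (Real.measurable_cosh.comp (by fun_prop))
  calc logAvg κ n ≤ ∫⁻ y, (1 + ENNReal.ofReal (1 / p ^ 2) *
        ENNReal.ofReal (Real.cosh (2 * (κ * Real.log (1 + y) * (p * n))))) ∂expLaw (8 * κ) := by
        refine lintegral_mono fun y => ?_
        rw [← ENNReal.ofReal_mul (by positivity), ← ENNReal.ofReal_one,
          ← ENNReal.ofReal_add one_pos.le (by positivity)]
        refine ENNReal.ofReal_le_ofReal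
          ((cosh_le_one_add_cosh_mul_div_sq hp _).trans (le_of_eq ?_))
        rw [show p * (2 * (κ * Real.log (1 + y) * n)) = 2 * (κ * Real.log (1 + y) * (p * n)) by ring]
        ring
    _ = _ := by
        rw [lintegral_add_left measurable_const, lintegral_const_mul _ hm]
        simp [logAvg]

/-- The averaged weight is dominated by the logarithmic weight. -/
theorem logAvg_le_exp {μ : ℝ} (hμ : 0 < μ) (hn : 1 ≤ n) :
    logAvg (μ / 20) n ≤ ENNReal.ofReal (Real.exp (2 * (μ * (n * Real.log (n + 1))))) := by
  set y := μ * (n * Real.log (n + 1)) with hy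
  have hlog2 : Real.log 2 ≤ Real.log (n + 1) := Real.log_le_log two_pos (by linarith)
  have hl2 := Real.log_two_gt_d9
  have hlog : 0 < Real.log (n + 1) := by linarith
  have hy0 : 0 < y := by positivity
  rcases le_or_gt 4 y with h4 | h4
  · refine (logAvg_le (by positivity) (by linarith)).trans (ENNReal.ofReal_le_ofReal ?_)
    rw [show 2 * (μ / 20 * (n * Real.log (n + 1))) = y / 10 by rw [hy]; ring]
    have h1 : 4 / 3 ≤ Real.exp y := by linarith [Real.add_one_le_exp y]
    calc 4 / 3 * Real.exp (y / 10) ≤ Real.exp y * Real.exp y :=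
          mul_le_mul h1 (Real.exp_le_exp.2 (by linarith)) (Real.exp_pos _).le (Real.exp_pos _).le
      _ = _ := by rw [← Real.exp_add]; congr 1; ring
  · set s := Real.sqrt y with hs
    have hs0 : 0 < s := Real.sqrt_pos.2 hy0
    have hsq : s ^ 2 = y := Real.sq_sqrt hy0.le
    have hs2 : s ≤ 2 := by nlinarith
    set p := 2 / s with hpdef
    have hp : 1 ≤ p := by rw [hpdef, le_div_iff₀ hs0]; linarith
    have hps : p * s = 2 := div_mul_cancel₀ _ hs0.ne'
    have hp2 : p ^ 2 * y = 4 := by rw [← hsq, ← mul_pow, hps]; norm_num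
    have hp2' : 1 / p ^ 2 = y / 4 := by
      rw [div_eq_div_iff (by positivity) (by norm_num)]
      linarith
    have hexp : 2 * (μ / 20 * (p * n * Real.log (p * n + 1))) ≤ 1 := by
      have h1 : Real.log (p * n + 1) ≤ Real.log p + Real.log (n + 1) := by
        rw [← Real.log_mul (by positivity) (by positivity)]
        exact Real.log_le_log (by positivity) (by linarith)
      have h2 : Real.log p ≤ p := by linarith [Real.log_le_sub_one_of_pos (by positivity : 0 < p)]
      have h3 : μ * n * (693 / 1000) ≤ y := by
        rw [hy, ← mul_assoc]
        exact mul_le_mul_of_nonneg_left (by linarith) (by positivity)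
      have h4 : μ * n * p * p * (693 / 1000) ≤ 4 := by
        have := mul_le_mul_of_nonneg_right h3 (sq_nonneg p)
        linarith
      have h5 : p * y ≤ 4 := by
        have : p * y = 2 * s := by rw [← hsq]; linear_combination s * hps
        linarith
      have h6 : μ * n * p * Real.log (p * n + 1) ≤ μ * n * p * (p + Real.log (n + 1)) :=
        mul_le_mul_of_nonneg_left (by linarith) (by positivity)
      have h7 : μ * n * p * (p + Real.log (n + 1)) = μ * n * p * p + p * y := by
        rw [hy]
        ring
      linarith
    calc logAvg (μ / 20) n
        ≤ 1 + ENNReal.ofReal (1 / p ^ 2) * logAvg (μ / 20) (p * n) :=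
          logAvg_le_one_add (by positivity) hp n
      _ ≤ 1 + ENNReal.ofReal (1 / p ^ 2) * ENNReal.ofReal (4 / 3 * Real.exp 1) := by
          gcongr
          refine (logAvg_le (by positivity) (by positivity)).trans (ENNReal.ofReal_le_ofReal ?_)
          gcongr
      _ = ENNReal.ofReal (1 + 1 / p ^ 2 * (4 / 3 * Real.exp 1)) := by
          rw [ENNReal.ofReal_add one_pos.le (by positivity), ENNReal.ofReal_one,
            ENNReal.ofReal_mul (p := 1 / p ^ 2) (by positivity)]
      _ ≤ _ := by
          refine ENNReal.ofReal_le_ofReal ?_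
          have h1 := Real.exp_one_lt_d9
          have h2 : 1 / p ^ 2 * (4 / 3 * Real.exp 1) ≤ 2 * y := by
            rw [hp2']
            nlinarith
          linarith [Real.add_one_le_exp (2 * y)]

theorem logAvg_abs_le (μ : ℝ) (hμ : 0 < μ) (m : ℤ) :
    logAvg (μ / 20) |(m : ℝ)| ≤
      ENNReal.ofReal (Real.exp (2 * (μ * (|(m : ℝ)| * Real.log (|(m : ℝ)| + 1))))) := by
  have := isProbabilityMeasure_expLaw (r := 8 * (μ / 20)) (by positivity)
  rcases eq_or_ne m 0 with rfl | hm
  · simp [logAvg]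
  · refine logAvg_le_exp hμ ?_
    exact_mod_cast Int.one_le_abs hm

end logAvg

theorem mul_log_latNorm_le {d : ℕ} (hd : 1 ≤ d) {j : Fin d → ℤ} {N : ℝ}
    (hN : ∀ k, |(j k : ℝ)| ≤ N) :
    latNorm j * Real.log (latNorm j + 1) ≤ d ^ 2 * (N * Real.log (N + 1)) := by
  have hN0 : 0 ≤ N := (abs_nonneg _).trans (hN ⟨0, hd⟩)
  have hd1 : (1 : ℝ) ≤ d := by exact_mod_cast hd
  have hr : latNorm j ≤ d * N := by
    refine Real.sqrt_le_iff.2 ⟨by positivity, ?_⟩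
    calc ∑ k, (j k : ℝ) ^ 2 ≤ ∑ _k : Fin d, N ^ 2 :=
          Finset.sum_le_sum fun k _ => sq_le_sq' (by linarith [neg_abs_le (j k : ℝ), hN k])
            ((le_abs_self _).trans (hN k))
      _ = d * N ^ 2 := by simp
      _ ≤ (d * N) ^ 2 := by
        rw [mul_pow]
        exact mul_le_mul_of_nonneg_right (le_self_pow₀ hd1 two_ne_zero) (sq_nonneg _)
  have hr0 := latNorm_nonneg j
  have hlog : Real.log (latNorm j + 1) ≤ d * Real.log (N + 1) := by
    rw [← Real.log_pow]
    refine Real.log_le_log (by positivity) ?_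
    have := one_add_mul_le_pow (by linarith : (-2 : ℝ) ≤ N) d
    rw [add_comm N 1]
    linarith
  have hlogN : 0 ≤ Real.log (N + 1) := Real.log_nonneg (by linarith)
  calc latNorm j * Real.log (latNorm j + 1) ≤ (d * N) * (d * Real.log (N + 1)) :=
        mul_le_mul hr hlog (Real.log_nonneg (by linarith)) (by positivity)
    _ = _ := by ring

theorem mul_exp_div_le {d : ℕ} (hd : 1 ≤ d) (z : ℝ) :
    d * Real.exp (z / d) ≤ d - 1 + Real.exp z := by
  have hd1 : (0 : ℝ) < d := by exact_mod_cast hd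
  have h1 := one_add_mul_le_pow (by linarith [Real.exp_pos (z / d)] :
    -2 ≤ Real.exp (z / d) - 1) d
  rw [add_sub_cancel, ← Real.exp_nat_mul, mul_div_cancel₀ _ hd1.ne'] at h1
  linarith

/-- The loss in the exponent. -/
noncomputable def logRate (d : ℕ) : ℝ := Real.exp (-8) / (160 * d ^ 3)

theorem mul_logWeight_le {d : ℕ} (hd : 1 ≤ d) {μ : ℝ} (hμ : 0 < μ) (hμ4 : μ ≤ 4)
    (j : Fin d → ℤ) :
    d * ENNReal.ofReal (logWeight (μ * logRate d) j) ≤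
      ∑ k, (1 + logAvg (μ / 20) |(j k : ℝ)|) := by
  have hd0 : (0 : ℝ) < d := by exact_mod_cast hd
  have hne : (Finset.univ : Finset (Fin d)).Nonempty := ⟨⟨0, hd⟩, Finset.mem_univ _⟩
  obtain ⟨k, -, hk⟩ := Finset.exists_max_image Finset.univ (fun k => |(j k : ℝ)|) hne
  have hN0 := abs_nonneg (j k : ℝ)
  set N := |(j k : ℝ)| with hN
  set z := 2 * (Real.exp (-8) / 8 * (μ / 20) * (N * Real.log (N + 1))) with hz
  have h1 : logWeight (μ * logRate d) j ≤ Real.exp (z / d) := by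
    rw [logWeight, Real.exp_le_exp, le_div_iff₀ hd0]
    have h2 := mul_log_latNorm_le hd fun l => hk l (Finset.mem_univ _)
    have h3 := mul_le_mul_of_nonneg_left h2 (by positivity : 0 ≤ 2 * μ * Real.exp (-8) / (160 * d ^ 2))
    have h4 : 2 * (μ * logRate d) * latNorm j * Real.log (latNorm j + 1) * d =
        2 * μ * Real.exp (-8) / (160 * d ^ 2) * (latNorm j * Real.log (latNorm j + 1)) := by
      rw [logRate]
      field_simp
    have h5 : 2 * μ * Real.exp (-8) / (160 * d ^ 2) * (d ^ 2 * (N * Real.log (N + 1))) = z := by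
      rw [hz]
      field_simp
      ring
    linarith
  have h2 : (0 : ℝ) ≤ d - 1 := by
    have : (1 : ℝ) ≤ d := by exact_mod_cast hd
    linarith
  calc (d : ℝ≥0∞) * ENNReal.ofReal (logWeight (μ * logRate d) j)
      = ENNReal.ofReal (d * logWeight (μ * logRate d) j) := by
        rw [ENNReal.ofReal_mul hd0.le, ENNReal.ofReal_natCast]
    _ ≤ ENNReal.ofReal (d - 1 + Real.exp z) := ENNReal.ofReal_le_ofReal
        ((mul_le_mul_of_nonneg_left h1 hd0.le).trans (mul_exp_div_le hd z))
    _ = ENNReal.ofReal (d - 1) + ENNReal.ofReal (Real.exp z) :=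
        ENNReal.ofReal_add h2 (Real.exp_pos _).le
    _ ≤ ENNReal.ofReal (d - 1) + (1 + logAvg (μ / 20) N) := by
        gcongr
        exact exp_le_one_add_logAvg (by positivity) (by linarith) hN0
    _ = d + logAvg (μ / 20) N := by
        rw [← add_assoc, ← ENNReal.ofReal_one, ← ENNReal.ofReal_add h2 one_pos.le, sub_add_cancel,
          ENNReal.ofReal_natCast]
    _ ≤ d + ∑ k, logAvg (μ / 20) |(j k : ℝ)| := by
        gcongr
        exact Finset.single_le_sum (f := fun k => logAvg (μ / 20) |(j k : ℝ)|)
          (fun _ _ => zero_le) (Finset.mem_univ k)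
    _ = _ := by simp [Finset.sum_add_distrib]

/-- The squared `ℓ²` norm of `v` with weight `w`. -/
noncomputable def weightedSum {d : ℕ} (w : (Fin d → ℤ) → ℝ≥0∞) (v : (Fin d → ℤ) → ℂ) : ℝ≥0∞ :=
  ∑' j, w j * ENNReal.ofReal (‖v j‖ ^ 2)

section weightedSum

variable {d : ℕ}

theorem weightedSum_mono {w w' : (Fin d → ℤ) → ℝ≥0∞} (h : ∀ j, w j ≤ w' j)
    (v : (Fin d → ℤ) → ℂ) : weightedSum w v ≤ weightedSum w' v :=
  ENNReal.tsum_le_tsum fun j => mul_le_mul_left (h j) _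

theorem weightedSum_add (w w' : (Fin d → ℤ) → ℝ≥0∞) (v : (Fin d → ℤ) → ℂ) :
    weightedSum (fun j => w j + w' j) v = weightedSum w v + weightedSum w' v := by
  simp only [weightedSum, add_mul, ENNReal.tsum_add]

theorem weightedSum_const_mul (c : ℝ≥0∞) (w : (Fin d → ℤ) → ℝ≥0∞) (v : (Fin d → ℤ) → ℂ) :
    weightedSum (fun j => c * w j) v = c * weightedSum w v := by
  simp only [weightedSum, mul_assoc, ENNReal.tsum_mul_left]

theorem weightedSum_finsetSum {ι : Type*} (s : Finset ι) (w : ι → (Fin d → ℤ) → ℝ≥0∞)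
    (v : (Fin d → ℤ) → ℂ) :
    weightedSum (fun j => ∑ i ∈ s, w i j) v = ∑ i ∈ s, weightedSum (w i) v := by
  simp only [weightedSum, Finset.sum_mul]
  exact Summable.tsum_finsetSum fun _ _ => ENNReal.summable

/-- The weight `cosh (2 β j_k)`. -/
noncomputable def coshWeight (k : Fin d) (β : ℝ) (j : Fin d → ℤ) : ℝ≥0∞ :=
  ENNReal.ofReal (Real.cosh (2 * (β * |(j k : ℝ)|)))

theorem measurable_coshWeight (k : Fin d) (κ : ℝ) (j : Fin d → ℤ) :
    Measurable fun y : ℝ => coshWeight k (κ * Real.log (1 + y)) j :=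
  ENNReal.measurable_ofReal.comp (Real.measurable_cosh.comp (by fun_prop))

theorem measurable_weightedSum_coshWeight (k : Fin d) (κ : ℝ) (v : (Fin d → ℤ) → ℂ) :
    Measurable fun y : ℝ => weightedSum (coshWeight k (κ * Real.log (1 + y))) v :=
  Measurable.tsum fun j => (measurable_coshWeight k κ j).mul_const _

theorem weightedSum_logAvg (k : Fin d) (κ : ℝ) (v : (Fin d → ℤ) → ℂ) :
    weightedSum (fun j => logAvg κ |(j k : ℝ)|) v =
      ∫⁻ y, weightedSum (coshWeight k (κ * Real.log (1 + y))) v ∂expLaw (8 * κ) := by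
  simp only [weightedSum]
  rw [lintegral_tsum fun j => ((measurable_coshWeight k κ j).mul_const _).aemeasurable]
  refine tsum_congr fun j => ?_
  rw [lintegral_mul_const _ (measurable_coshWeight k κ j)]
  rfl

end weightedSum

namespace LatticeFlow

open LatticeL2

variable {d : ℕ} {u u' : ℝ → (Fin d → ℤ) → ℂ} {L μ : ℝ}

theorem weightedSum_coshWeight (hdec : SuperexpDecay u) (k : Fin d) (β : ℝ) {t : ℝ}
    (ht : t ∈ Set.Icc (0 : ℝ) 1) :
    weightedSum (coshWeight k β) (u t) =
      ENNReal.ofReal ((‖tilt k β (u t)‖ ^ 2 + ‖tilt k (-β) (u t)‖ ^ 2) / 2) := by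
  have h1 := ((hasSum_tilt hdec k β ht).add (hasSum_tilt hdec k (-β) ht)).div_const 2
  rw [← h1.tsum_eq, ENNReal.ofReal_tsum_of_nonneg (fun j => by positivity) h1.summable]
  refine tsum_congr fun j => ?_
  rw [coshWeight, ← ENNReal.ofReal_mul (Real.cosh_pos _).le, ← add_mul]
  congr 1
  have h2 : Real.cosh (2 * (β * |(j k : ℝ)|)) = Real.cosh (2 * (β * j k)) := by
    rw [← Real.cosh_abs, abs_mul, abs_mul, abs_abs, ← abs_mul, ← abs_mul, Real.cosh_abs]
  rw [h2, Real.cosh_eq, neg_mul, mul_neg]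
  ring

theorem weightedSum_coshWeight_le (h : LatticeFlow u u' L) (hdec : SuperexpDecay u) (k : Fin d)
    (hu : ∃ s ∈ Set.Icc (0 : ℝ) 1, ∃ j, u s j ≠ 0) (β : ℝ) {t : ℝ}
    (ht : t ∈ Set.Icc (0 : ℝ) 1) :
    weightedSum (coshWeight k β) (u t) ≤ ENNReal.ofReal (Real.exp (L + L ^ 2)) *
      (ENNReal.ofReal (1 - t) * weightedSum (coshWeight k β) (u 0) +
        ENNReal.ofReal t * weightedSum (coshWeight k β) (u 1)) := by
  have ht0 : 0 ≤ t := ht.1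
  have ht1 : 0 ≤ 1 - t := sub_nonneg.2 ht.2
  rw [weightedSum_coshWeight hdec k β ht, weightedSum_coshWeight hdec k β (by simp),
    weightedSum_coshWeight hdec k β (by simp), ← ENNReal.ofReal_mul ht1, ← ENNReal.ofReal_mul ht0,
    ← ENNReal.ofReal_add (by positivity) (by positivity), ← ENNReal.ofReal_mul (Real.exp_pos _).le]
  refine ENNReal.ofReal_le_ofReal ?_
  have h1 := fun γ => (h.perturbedFlow hdec k γ).norm_sq_le
    (fun t ht => h.tilt_ne_zero hdec k γ hu ht) ht
  linarith [h1 β, h1 (-β)]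

theorem weightedSum_coshWeight_le_exp (h : LatticeFlow u u' L) (hdec : SuperexpDecay u)
    (k : Fin d) {β : ℝ} (hβ : 0 ≤ β) {s t : ℝ} (hs : s ∈ Set.Icc (0 : ℝ) 1)
    (ht : t ∈ Set.Icc (0 : ℝ) 1) :
    weightedSum (coshWeight k β) (u t) ≤ ENNReal.ofReal (Real.exp (4 * Real.sinh β + 2 * L)) *
      weightedSum (coshWeight k β) (u s) := by
  rw [weightedSum_coshWeight hdec k β ht, weightedSum_coshWeight hdec k β hs,
    ← ENNReal.ofReal_mul (Real.exp_pos _).le]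
  refine ENNReal.ofReal_le_ofReal ?_
  have h1 : ∀ γ, |γ| = β → ‖tilt k γ (u t)‖ ^ 2 ≤
      Real.exp (4 * Real.sinh β + 2 * L) * ‖tilt k γ (u s)‖ ^ 2 := by
    intro γ hγ
    refine ((h.perturbedFlow hdec k γ).norm_sq_le_exp hs ht).trans
      (mul_le_mul_of_nonneg_right (Real.exp_le_exp.2 ?_) (sq_nonneg _))
    have := norm_symmPart_le k γ
    rw [hγ] at this
    linarith
  linarith [h1 β (abs_of_nonneg hβ), h1 (-β) (by rw [abs_neg, abs_of_nonneg hβ])]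

theorem weightedSum_one_le (h : LatticeFlow u u' L) (hdec : SuperexpDecay u) (k : Fin d) {s t : ℝ}
    (hs : s ∈ Set.Icc (0 : ℝ) 1) (ht : t ∈ Set.Icc (0 : ℝ) 1) :
    weightedSum (fun _ => 1) (u t) ≤
      ENNReal.ofReal (Real.exp (2 * L)) * weightedSum (fun _ => 1) (u s) := by
  have h1 := h.weightedSum_coshWeight_le_exp hdec k le_rfl hs ht
  have h2 : coshWeight k 0 = fun _ => 1 := by
    funext j
    simp [coshWeight]
  rwa [h2, Real.sinh_zero, mul_zero, zero_add] at h1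

end LatticeFlow

theorem logWeight_mono {d : ℕ} {μ x : ℝ} {j : Fin d → ℤ} (hμ : 0 ≤ μ) (hx : 0 ≤ x)
    (hxj : x ≤ latNorm j) : Real.exp (2 * (μ * (x * Real.log (x + 1)))) ≤ logWeight μ j := by
  rw [logWeight, Real.exp_le_exp]
  have h1 := mul_le_mul hxj (Real.log_le_log (by linarith) (by linarith : x + 1 ≤ latNorm j + 1))
    (Real.log_nonneg (by linarith)) (latNorm_nonneg j)
  have h2 := mul_le_mul_of_nonneg_left h1 hμ
  linarith

theorem one_le_logWeight {d : ℕ} {μ : ℝ} (hμ : 0 ≤ μ) (j : Fin d → ℤ) : 1 ≤ logWeight μ j := by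
  simpa using logWeight_mono hμ le_rfl (latNorm_nonneg j)

theorem logAvg_le_logWeight {d : ℕ} {μ : ℝ} (hμ : 0 < μ) (j : Fin d → ℤ) (k : Fin d) :
    logAvg (μ / 20) |(j k : ℝ)| ≤ ENNReal.ofReal (logWeight μ j) :=
  (logAvg_abs_le μ hμ (j k)).trans
    (ENNReal.ofReal_le_ofReal (logWeight_mono hμ.le (abs_nonneg _) (abs_le_latNorm j k)))

theorem one_add_two_mul_exp_two_le : 1 + 2 * Real.exp 2 ≤ Real.exp 3 := by
  have h1 := Real.exp_one_gt_d9
  have h2 : Real.exp 2 = Real.exp 1 ^ 2 := by rw [← Real.exp_nat_mul]; norm_num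
  have h3 : Real.exp 3 = Real.exp 1 ^ 3 := by rw [← Real.exp_nat_mul]; norm_num
  rw [h2, h3]
  nlinarith [sq_nonneg (Real.exp 1 - 2)]

namespace LatticeFlow

variable {d : ℕ} {u u' : ℝ → (Fin d → ℤ) → ℂ} {L μ : ℝ}

theorem weightedSum_one_add_logAvg_le_of_le_one (h : LatticeFlow u u' L) (hL : L ≤ 1)
    (hdec : SuperexpDecay u) (hμ : 0 < μ) (k : Fin d)
    (hu : ∃ s ∈ Set.Icc (0 : ℝ) 1, ∃ j, u s j ≠ 0) {t : ℝ} (ht : t ∈ Set.Icc (0 : ℝ) 1) :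
    weightedSum (fun j => 1 + logAvg (μ / 20) |(j k : ℝ)|) (u t) ≤
      ENNReal.ofReal (Real.exp (2 * L)) *
        (weightedSum (fun j => ENNReal.ofReal (logWeight μ j)) (u 0) +
          weightedSum (fun j => ENNReal.ofReal (logWeight μ j)) (u 1)) := by
  have hL0 := h.nonneg
  set P := weightedSum (fun j => ENNReal.ofReal (logWeight μ j)) (u 0) with hP
  set Q := weightedSum (fun j => ENNReal.ofReal (logWeight μ j)) (u 1) with hQ
  set E := ENNReal.ofReal (Real.exp (2 * L)) with hE
  set a := ENNReal.ofReal (1 - t) with ha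
  set b := ENNReal.ofReal t with hb
  have hab : a + b = 1 := by
    rw [ha, hb, ← ENNReal.ofReal_add (sub_nonneg.2 ht.2) ht.1, sub_add_cancel, ENNReal.ofReal_one]
  have hone : ∀ s ∈ Set.Icc (0 : ℝ) 1, weightedSum (fun _ => 1) (u t) ≤
      E * weightedSum (fun j => ENNReal.ofReal (logWeight μ j)) (u s) := fun s hs =>
    (h.weightedSum_one_le hdec k hs ht).trans (by
      gcongr
      exact weightedSum_mono (fun j => ENNReal.one_le_ofReal.2 (one_le_logWeight hμ.le j)) _)
  have hmass : weightedSum (fun _ => 1) (u t) ≤ E * (b * P + a * Q) := by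
    calc weightedSum (fun _ => 1) (u t)
        = b * weightedSum (fun _ => 1) (u t) + a * weightedSum (fun _ => 1) (u t) := by
          rw [← add_mul, add_comm b, hab, one_mul]
      _ ≤ b * (E * P) + a * (E * Q) := by
          gcongr
          · exact hone 0 (by simp)
          · exact hone 1 (by simp)
      _ = _ := by ring
  have hE' : ENNReal.ofReal (Real.exp (L + L ^ 2)) ≤ E :=
    ENNReal.ofReal_le_ofReal (Real.exp_le_exp.2 (by nlinarith))
  have havg : weightedSum (fun j => logAvg (μ / 20) |(j k : ℝ)|) (u t) ≤ E * (a * P + b * Q) := by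
    have hm := measurable_weightedSum_coshWeight k (μ / 20)
    calc weightedSum (fun j => logAvg (μ / 20) |(j k : ℝ)|) (u t)
        ≤ ∫⁻ y, E * (a * weightedSum (coshWeight k (μ / 20 * Real.log (1 + y))) (u 0) +
            b * weightedSum (coshWeight k (μ / 20 * Real.log (1 + y))) (u 1))
            ∂expLaw (8 * (μ / 20)) := by
          rw [weightedSum_logAvg]
          refine lintegral_mono fun y => (h.weightedSum_coshWeight_le hdec k hu _ ht).trans ?_
          gcongr
      _ = E * (a * weightedSum (fun j => logAvg (μ / 20) |(j k : ℝ)|) (u 0) +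
            b * weightedSum (fun j => logAvg (μ / 20) |(j k : ℝ)|) (u 1)) := by
          rw [lintegral_const_mul _ (by exact ((hm _).const_mul _).add ((hm _).const_mul _)),
            lintegral_add_left ((hm _).const_mul _), lintegral_const_mul _ (hm _),
            lintegral_const_mul _ (hm _), ← weightedSum_logAvg, ← weightedSum_logAvg]
      _ ≤ _ := by
          gcongr <;> exact weightedSum_mono (fun j => logAvg_le_logWeight hμ j k) _
  calc weightedSum (fun j => 1 + logAvg (μ / 20) |(j k : ℝ)|) (u t)
      ≤ E * (b * P + a * Q) + E * (a * P + b * Q) := by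
        rw [weightedSum_add]
        exact add_le_add hmass havg
    _ = (a + b) * (E * (P + Q)) := by ring
    _ = E * (P + Q) := by rw [hab, one_mul]

theorem weightedSum_one_add_logAvg_le_of_one_le (h : LatticeFlow u u' L) (hL : 1 ≤ L)
    (hdec : SuperexpDecay u) (hμ : 0 < μ) (hμ4 : μ ≤ 4) (k : Fin d) {t : ℝ}
    (ht : t ∈ Set.Icc (0 : ℝ) 1) :
    weightedSum (fun j => 1 + logAvg (μ / 20) |(j k : ℝ)|) (u t) ≤
      ENNReal.ofReal (Real.exp (5 * L)) *
        weightedSum (fun j => ENNReal.ofReal (logWeight μ j)) (u 0) := by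
  set P := weightedSum (fun j => ENNReal.ofReal (logWeight μ j)) (u 0) with hP
  set E := ENNReal.ofReal (Real.exp (2 * L)) with hE
  have h0 : (0 : ℝ) ∈ Set.Icc (0 : ℝ) 1 := by simp
  have hmass : weightedSum (fun _ => 1) (u t) ≤ E * P :=
    (h.weightedSum_one_le hdec k h0 ht).trans (by
      gcongr
      exact weightedSum_mono (fun j => ENNReal.one_le_ofReal.2 (one_le_logWeight hμ.le j)) _)
  have hmeas : ∀ j : Fin d → ℤ, Measurable fun y : ℝ =>
      ENNReal.ofReal (Real.exp (4 * Real.sinh (μ / 20 * Real.log (1 + y))) *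
        Real.cosh (2 * (μ / 20 * Real.log (1 + y) * |(j k : ℝ)|))) := fun j =>
    ENNReal.measurable_ofReal.comp ((Real.measurable_exp.comp
      ((Real.measurable_sinh.comp (by fun_prop)).const_mul _)).mul
        (Real.measurable_cosh.comp (by fun_prop)))
  have havg : weightedSum (fun j => logAvg (μ / 20) |(j k : ℝ)|) (u t) ≤
      E * (ENNReal.ofReal (2 * Real.exp 2) * P) := by
    calc weightedSum (fun j => logAvg (μ / 20) |(j k : ℝ)|) (u t)
        ≤ ∫⁻ y, E * ∑' j, ENNReal.ofReal (Real.exp (4 * Real.sinh (μ / 20 * Real.log (1 + y))) *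
            Real.cosh (2 * (μ / 20 * Real.log (1 + y) * |(j k : ℝ)|))) *
              ENNReal.ofReal (‖u 0 j‖ ^ 2) ∂expLaw (8 * (μ / 20)) := by
          rw [weightedSum_logAvg]
          refine lintegral_mono_ae ((ae_expLaw_pos _).mono fun y hy => ?_)
          have hβ : 0 ≤ μ / 20 * Real.log (1 + y) :=
            mul_nonneg (by positivity) (Real.log_nonneg (by linarith))
          refine (h.weightedSum_coshWeight_le_exp hdec k hβ h0 ht).trans (le_of_eq ?_)
          rw [add_comm, Real.exp_add, ENNReal.ofReal_mul (Real.exp_pos _).le, mul_assoc,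
            weightedSum, ← ENNReal.tsum_mul_left]
          simp only [coshWeight, ENNReal.ofReal_mul (Real.exp_pos _).le, mul_assoc]
          rfl
      _ = E * ∑' j, (∫⁻ y, ENNReal.ofReal (Real.exp (4 * Real.sinh (μ / 20 * Real.log (1 + y))) *
            Real.cosh (2 * (μ / 20 * Real.log (1 + y) * |(j k : ℝ)|))) ∂expLaw (8 * (μ / 20))) *
              ENNReal.ofReal (‖u 0 j‖ ^ 2) := by
          rw [lintegral_const_mul _ (Measurable.tsum fun j => (hmeas j).mul_const _),
            lintegral_tsum fun j => ((hmeas j).mul_const _).aemeasurable]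
          congr 1
          exact tsum_congr fun j => lintegral_mul_const _ (hmeas j)
      _ ≤ E * (ENNReal.ofReal (2 * Real.exp 2) * P) := by
          rw [hP, ← weightedSum_const_mul]
          refine mul_le_mul_right (ENNReal.tsum_le_tsum fun j => mul_le_mul_left ?_ _) _
          refine (lintegral_exp_sinh_mul_cosh_le (by positivity) (by linarith)
            (abs_nonneg _)).trans ?_
          rw [← ENNReal.ofReal_mul (by positivity)]
          refine ENNReal.ofReal_le_ofReal (mul_le_mul_of_nonneg_left ?_ (by positivity))
          refine le_trans (Real.exp_le_exp.2 ?_)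
            (logWeight_mono hμ.le (abs_nonneg _) (abs_le_latNorm j k))
          have : 0 ≤ |(j k : ℝ)| * Real.log (|(j k : ℝ)| + 1) :=
            mul_nonneg (abs_nonneg _) (Real.log_nonneg (by linarith [abs_nonneg (j k : ℝ)]))
          have := mul_nonneg hμ.le this
          linarith
  calc weightedSum (fun j => 1 + logAvg (μ / 20) |(j k : ℝ)|) (u t)
      ≤ E * P + E * (ENNReal.ofReal (2 * Real.exp 2) * P) := by
        rw [weightedSum_add]
        exact add_le_add hmass havg
    _ = E * ENNReal.ofReal (1 + 2 * Real.exp 2) * P := by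
        rw [ENNReal.ofReal_add one_pos.le (by positivity), ENNReal.ofReal_one]
        ring
    _ ≤ _ := by
        gcongr
        rw [hE, ← ENNReal.ofReal_mul (Real.exp_pos _).le]
        refine ENNReal.ofReal_le_ofReal ?_
        calc Real.exp (2 * L) * (1 + 2 * Real.exp 2) ≤ Real.exp (2 * L) * Real.exp 3 :=
              mul_le_mul_of_nonneg_left one_add_two_mul_exp_two_le (Real.exp_pos _).le
          _ ≤ Real.exp (5 * L) := by
              rw [← Real.exp_add, Real.exp_le_exp]
              linarith

theorem weightedSum_logWeight_le (h : LatticeFlow u u' L) (hd : 1 ≤ d) (hμ : 0 < μ)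
    (h0 : Summable fun j => logWeight μ j * ‖u 0 j‖ ^ 2)
    (h1 : Summable fun j => logWeight μ j * ‖u 1 j‖ ^ 2) {t : ℝ} (ht : t ∈ Set.Icc (0 : ℝ) 1) :
    weightedSum (fun j => ENNReal.ofReal (logWeight (μ * logRate d) j)) (u t) ≤
      ENNReal.ofReal (Real.exp (5 * L)) *
        (weightedSum (fun j => ENNReal.ofReal (logWeight μ j)) (u 0) +
          weightedSum (fun j => ENNReal.ofReal (logWeight μ j)) (u 1)) := by
  by_cases hu : ∃ s ∈ Set.Icc (0 : ℝ) 1, ∃ j, u s j ≠ 0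
  swap
  · push Not at hu
    simp [weightedSum, hu t ht]
  rcases le_or_gt μ 4 with hμ4 | hμ4
  swap
  · obtain ⟨s, hs, j, hj⟩ := hu
    exact absurd (h.eq_zero_of_four_le hμ4.le ⟨0, hd⟩ h0 h1 s hs j) hj
  have hdec := h.superexpDecay hμ h0
  set W := ENNReal.ofReal (Real.exp (5 * L)) *
    (weightedSum (fun j => ENNReal.ofReal (logWeight μ j)) (u 0) +
      weightedSum (fun j => ENNReal.ofReal (logWeight μ j)) (u 1)) with hW
  have hk : ∀ k, weightedSum (fun j => 1 + logAvg (μ / 20) |(j k : ℝ)|) (u t) ≤ W := by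
    intro k
    rcases le_or_gt L 1 with hL | hL
    · refine (h.weightedSum_one_add_logAvg_le_of_le_one hL hdec hμ k hu ht).trans ?_
      have := h.nonneg
      rw [hW]
      gcongr
      norm_num
    · refine (h.weightedSum_one_add_logAvg_le_of_one_le hL.le hdec hμ hμ4 k ht).trans ?_
      rw [hW]
      gcongr
      exact le_self_add
  have hd0 : (d : ℝ≥0∞) ≠ 0 := by
    rw [Nat.cast_ne_zero]
    omega
  refine (ENNReal.mul_le_mul_iff_right hd0 (ENNReal.natCast_ne_top d)).1 ?_
  calc d * weightedSum (fun j => ENNReal.ofReal (logWeight (μ * logRate d) j)) (u t)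
      ≤ weightedSum (fun j => ∑ k, (1 + logAvg (μ / 20) |(j k : ℝ)|)) (u t) := by
        rw [← weightedSum_const_mul]
        exact weightedSum_mono (fun j => mul_logWeight_le hd hμ hμ4 j) _
    _ = ∑ k, weightedSum (fun j => 1 + logAvg (μ / 20) |(j k : ℝ)|) (u t) :=
        weightedSum_finsetSum _ (fun k j => 1 + logAvg (μ / 20) |(j k : ℝ)|) _
    _ ≤ ∑ _k : Fin d, W := Finset.sum_le_sum fun k _ => hk k
    _ = d * W := by simp

end LatticeFlow

theorem summable_of_weightedSum_ne_top {d : ℕ} {μ : ℝ} {v : (Fin d → ℤ) → ℂ}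
    (h : weightedSum (fun j => ENNReal.ofReal (logWeight μ j)) v ≠ ∞) :
    Summable fun j => logWeight μ j * ‖v j‖ ^ 2 := by
  refine (ENNReal.summable_toReal h).congr fun j => ?_
  rw [ENNReal.toReal_mul, ENNReal.toReal_ofReal (logWeight_pos μ j).le,
    ENNReal.toReal_ofReal (sq_nonneg _)]

/-- **Log-type weighted bound for discrete Schrödinger evolutions.**
If `u ∈ C¹([0,1], ℓ²(ℤ^d))` satisfies `|i∂_t u_j + Δ_d u_j| ≤ |V_j u_j|` with `‖V‖_∞ ≤ L`,
then for every `μ > 0` and `t ∈ [0,1]` there are constants `c₀ = c₀(d) > 0` and `c > 0`,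
independent of `μ` and `t`, such that
`Σ_j e^{2μc₀|j|log(|j|+1)}|u_j(t)|² ≤ e^{cL} Σ_j e^{2μ|j|log(|j|+1)}(|u_j(0)|² + |u_j(1)|²)`,
provided the right-hand side is finite. -/
theorem log_weighted_l2_bound (d : ℕ) (hd : 1 ≤ d) :
    ∃ c₀ : ℝ, 0 < c₀ ∧ ∃ c : ℝ, 0 < c ∧
      ∀ (u u' V : ℝ → (Fin d → ℤ) → ℂ) (L : ℝ), 0 ≤ L →
        -- `u ∈ C¹([0,1], ℓ²(ℤ^d))`, with time derivative `u'`
        (∀ j, ∀ t ∈ Set.Icc (0 : ℝ) 1,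
          HasDerivWithinAt (fun s => u s j) (u' t j) (Set.Icc (0 : ℝ) 1) t) →
        (∀ j, ContinuousOn (fun t => u' t j) (Set.Icc (0 : ℝ) 1)) →
        (∀ t ∈ Set.Icc (0 : ℝ) 1, Summable fun j => ‖u t j‖ ^ 2) →
        -- the differential inequality `|i ∂_t u_j + Δ_d u_j| ≤ |V_j u_j|`
        (∀ t ∈ Set.Icc (0 : ℝ) 1, ∀ j,
          ‖Complex.I * u' t j + discreteLap (u t) j‖ ≤ ‖V t j * u t j‖) →
        -- `‖V‖_∞ ≤ L`
        (∀ t ∈ Set.Icc (0 : ℝ) 1, ∀ j, ‖V t j‖ ≤ L) →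
        ∀ μ : ℝ, 0 < μ → ∀ t ∈ Set.Icc (0 : ℝ) 1,
          -- provided the right-hand side is finite
          (∑' j : Fin d → ℤ,
              ENNReal.ofReal
                (Real.exp (2 * μ * latNorm j * Real.log (latNorm j + 1)) *
                  (‖u 0 j‖ ^ 2 + ‖u 1 j‖ ^ 2))) ≠ ∞ →
          (∑' j : Fin d → ℤ,
              ENNReal.ofReal
                (Real.exp (2 * μ * c₀ * latNorm j * Real.log (latNorm j + 1)) *
                  ‖u t j‖ ^ 2)) ≤
            ENNReal.ofReal (Real.exp (c * L)) *
              ∑' j : Fin d → ℤ,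
                ENNReal.ofReal
                  (Real.exp (2 * μ * latNorm j * Real.log (latNorm j + 1)) *
                    (‖u 0 j‖ ^ 2 + ‖u 1 j‖ ^ 2)) := by
  refine ⟨logRate d, by unfold logRate; positivity, 5, by norm_num, ?_⟩
  intro u u' V L hL hderiv _ hsum hineq hV μ hμ t ht hfin
  have h : LatticeFlow u u' L := by
    refine ⟨hL, hderiv, hsum, fun t ht j => ?_⟩
    have h1 : ‖u' t j - Complex.I * discreteLap (u t) j‖ =
        ‖Complex.I * u' t j + discreteLap (u t) j‖ := by
      have h2 : Complex.I * u' t j + discreteLap (u t) j =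
          Complex.I * (u' t j - Complex.I * discreteLap (u t) j) := by
        linear_combination discreteLap (u t) j * Complex.I_mul_I
      rw [h2, norm_mul, Complex.norm_I, one_mul]
    rw [h1]
    refine (hineq t ht j).trans ?_
    rw [norm_mul]
    exact mul_le_mul_of_nonneg_right (hV t ht j) (norm_nonneg _)
  have hrhs : ∑' j : Fin d → ℤ, ENNReal.ofReal
      (Real.exp (2 * μ * latNorm j * Real.log (latNorm j + 1)) * (‖u 0 j‖ ^ 2 + ‖u 1 j‖ ^ 2)) =
      weightedSum (fun j => ENNReal.ofReal (logWeight μ j)) (u 0) +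
        weightedSum (fun j => ENNReal.ofReal (logWeight μ j)) (u 1) := by
    rw [weightedSum, weightedSum, ← ENNReal.tsum_add]
    refine tsum_congr fun j => ?_
    rw [← mul_add, ← ENNReal.ofReal_add (sq_nonneg _) (sq_nonneg _),
      ← ENNReal.ofReal_mul (logWeight_pos μ j).le, logWeight]
  have hlhs : ∑' j : Fin d → ℤ, ENNReal.ofReal
      (Real.exp (2 * μ * logRate d * latNorm j * Real.log (latNorm j + 1)) * ‖u t j‖ ^ 2) =
      weightedSum (fun j => ENNReal.ofReal (logWeight (μ * logRate d) j)) (u t) := by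
    refine tsum_congr fun j => ?_
    rw [← ENNReal.ofReal_mul (logWeight_pos _ j).le, logWeight, mul_assoc 2 μ]
  rw [hrhs] at hfin ⊢
  rw [hlhs]
  obtain ⟨h0, h1⟩ := ENNReal.add_ne_top.1 hfin
  exact h.weightedSum_logWeight_le hd hμ (summable_of_weightedSum_ne_top h0)
    (summable_of_weightedSum_ne_top h1) ht
end
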